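/- arXiv:0809.4402 — 4 statements merged into one kernel-verified Lean document; each statement's English description precedes it below -/
import Mathlib

section
/- Let f : ℝ → ℝ be C¹ with antiderivative F (F′ = f), and for parameters (a,E,c) set V(u;a,c) = F(u) − (c/2)u² − a·u. Let D ⊆ ℝ³ be an open set of parameters on which there exist C¹ functions u₋ < u₊ of (a,E,c) with V(u₋;a,c) = V(u₊;a,c) = E, V(u;a,c) < E for u₋ < u < u₊, and ∂V/∂u(u₋;a,c) < 0 < ∂V/∂u(u₊;a,c). Define the improper integrals T = 2∫_{u₋}^{u₊} (2(E−V(u;a,c)))^{−1/2} du, M = 2∫_{u₋}^{u₊} u·(2(E−V(u;a,c)))^{−1/2} du, P = 2∫_{u₋}^{u₊} u²·(2(E−V(u;a,c)))^{−1/2} du, and K = 2∫_{u₋}^{u₊} (2(E−V(u;a,c)))^{1/2} du. Then the integrals defining T, M, P converge, K is differentiable on D, and ∂K/∂E = T, ∂K/∂a = M, ∂K/∂c = P/2. -/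
open Set MeasureTheory

open scoped Topology

section SquareRootIntegral

variable {X : Type*} [NormedAddCommGroup X] [NormedSpace ℝ X]

/-- A `C¹` function vanishing on `{0} × X` with positive first partial derivative at `(0, x₀)`
grows at least linearly in the first variable, uniformly near `(0, x₀)`. -/
theorem exists_eventually_mul_fst_le {G : ℝ × X → ℝ} {x₀ : X}
    (hG : ContDiffAt ℝ 1 G (0, x₀)) (h0 : ∀ᶠ x in 𝓝 x₀, G (0, x) = 0)
    (hd : 0 < fderiv ℝ G (0, x₀) (1, 0)) :
    ∃ c > 0, ∀ᶠ z in 𝓝 ((0 : ℝ), x₀), 0 ≤ z.1 → c * z.1 ≤ G z := by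
  obtain ⟨c, hc0, hc⟩ := exists_between hd
  refine ⟨c, hc0, ?_⟩
  have hdiff : ∀ᶠ z in 𝓝 ((0 : ℝ), x₀), DifferentiableAt ℝ G z :=
    (hG.eventually (by simp)).mono fun z hz => hz.differentiableAt (by simp)
  have hcont : ContinuousAt (fun z => fderiv ℝ G z (1, 0)) (0, x₀) :=
    ((hG.fderiv_right (m := 0) (by simp)).continuousAt).clm_apply continuousAt_const
  have hzero : ∀ᶠ z in 𝓝 ((0 : ℝ), x₀), G (0, z.2) = 0 :=
    (continuous_snd.tendsto ((0 : ℝ), x₀)).eventually h0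
  obtain ⟨ε, hε, H⟩ := Metric.eventually_nhds_iff.1
    (hdiff.and ((hcont.eventually_const_lt hc).and hzero))
  refine Metric.eventually_nhds_iff.2 ⟨ε, hε, fun z hz hz0 => ?_⟩
  have hseg : ∀ t ∈ Icc 0 z.1, dist (t, z.2) ((0 : ℝ), x₀) < ε := by
    intro t ht
    refine lt_of_le_of_lt ?_ hz
    simp only [Prod.dist_eq, Real.dist_eq, sub_zero]
    exact max_le_max (abs_le_abs_of_nonneg ht.1 ht.2) le_rfl
  have hderiv : ∀ t ∈ Icc 0 z.1,
      HasDerivAt (fun t => G (t, z.2)) (fderiv ℝ G (t, z.2) (1, 0)) t := fun t ht =>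
    (H (hseg t ht)).1.hasFDerivAt.comp_hasDerivAt t
      ((hasDerivAt_id t).prodMk (hasDerivAt_const t z.2))
  have key := (convex_Icc 0 z.1).mul_sub_le_image_sub_of_le_deriv
    (fun t ht => (hderiv t ht).continuousAt.continuousWithinAt)
    (fun t ht => (hderiv t (interior_subset ht)).differentiableAt.differentiableWithinAt)
    (C := c)
    (fun t ht => by
      rw [(hderiv t (interior_subset ht)).deriv]
      exact (H (hseg t (interior_subset ht))).2.1.le)
    0 ⟨le_rfl, hz0⟩ z.1 ⟨hz0, le_rfl⟩ hz0
  have := (H hz).2.2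
  simpa [this] using key

/-- A `C¹` family of functions on `[0, 1]` with simple zeros at both endpoints is bounded below
by a multiple of `s (1 - s)`, uniformly in the parameter. -/
theorem exists_eventually_mul_le_of_simple_zeros {G : ℝ × X → ℝ} {x₀ : X}
    (hG : ∀ s ∈ Icc (0 : ℝ) 1, ContDiffAt ℝ 1 G (s, x₀))
    (h0 : ∀ᶠ x in 𝓝 x₀, G (0, x) = 0) (h1 : ∀ᶠ x in 𝓝 x₀, G (1, x) = 0)
    (hpos : ∀ s ∈ Ioo (0 : ℝ) 1, 0 < G (s, x₀))
    (hd0 : 0 < fderiv ℝ G (0, x₀) (1, 0)) (hd1 : fderiv ℝ G (1, x₀) (1, 0) < 0) :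
    ∃ c > 0, ∀ᶠ x in 𝓝 x₀, ∀ s ∈ Icc (0 : ℝ) 1, c * (s * (1 - s)) ≤ G (s, x) := by
  have hloc : ∀ s ∈ Icc (0 : ℝ) 1, ∃ c > 0, ∀ᶠ z in 𝓝 (s, x₀),
      z.1 ∈ Icc (0 : ℝ) 1 → c * (z.1 * (1 - z.1)) ≤ G z := by
    intro s hs
    rcases hs.1.eq_or_lt with rfl | hs0
    · obtain ⟨c, hc, H⟩ := exists_eventually_mul_fst_le (hG 0 (by simp)) h0 hd0
      refine ⟨c, hc, H.mono fun z hz hz1 => le_trans ?_ (hz hz1.1)⟩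
      have := hz1.1
      gcongr
      nlinarith
    rcases hs.2.eq_or_lt with rfl | hs1
    · let r : ℝ × X → ℝ × X := fun z => (1 - z.1, z.2)
      have hr : ContDiff ℝ 1 r := (contDiff_const.sub contDiff_fst).prodMk contDiff_snd
      have hr0 : r (0, x₀) = (1, x₀) := by simp [r]
      have hGr : ContDiffAt ℝ 1 (fun z => G (r z)) (0, x₀) := by
        have h := hG 1 (by simp)
        rw [← hr0] at h
        exact h.comp (0, x₀) hr.contDiffAt
      have hdr : fderiv ℝ (fun z => G (r z)) (0, x₀) (1, 0) = - fderiv ℝ G (1, x₀) (1, 0) := by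
        have e1 : HasDerivAt (fun t : ℝ => (t, x₀)) (1, 0) 0 :=
          (hasDerivAt_id 0).prodMk (hasDerivAt_const 0 x₀)
        have e2 : HasDerivAt (fun t : ℝ => (1 - t, x₀)) (-1, 0) 0 :=
          ((hasDerivAt_id 0).const_sub 1).prodMk (hasDerivAt_const 0 x₀)
        have a1 := (hGr.differentiableAt (by simp)).hasFDerivAt.comp_hasDerivAt 0 e1
        have a2 : HasDerivAt (fun t : ℝ => G (1 - t, x₀)) (fderiv ℝ G (1, x₀) (-1, 0)) 0 := by
          refine HasFDerivAt.comp_hasDerivAt (l := G) (f := fun t : ℝ => (1 - t, x₀)) 0 ?_ e2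
          simpa using ((hG 1 (by simp)).differentiableAt (by simp)).hasFDerivAt
        rw [a1.unique a2, ← map_neg]
        simp
      obtain ⟨c, hc, H⟩ := exists_eventually_mul_fst_le hGr
        (h1.mono fun x hx => by simpa [r] using hx) (by rw [hdr]; linarith)
      refine ⟨c, hc, ?_⟩
      have ht : Filter.Tendsto r (𝓝 (1, x₀)) (𝓝 (0, x₀)) := by
        have := hr.continuous.tendsto (1, x₀)
        simpa [r] using this
      filter_upwards [ht.eventually H] with z hz hz1
      have hz2 := hz (by simpa [r] using hz1.2)
      simp only [r, sub_sub_cancel] at hz2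
      refine le_trans ?_ hz2
      have := hz1.1
      have := hz1.2
      gcongr
      nlinarith
    · obtain ⟨c, hc, hc'⟩ := exists_between (hpos s ⟨hs0, hs1⟩)
      refine ⟨c, hc, ?_⟩
      filter_upwards [(hG s hs).continuousAt.eventually_const_lt hc'] with z hz hz1
      refine le_trans ?_ hz.le
      have := hz1.1
      have := hz1.2
      nlinarith [mul_nonneg hz1.1 (sub_nonneg.2 hz1.2), sq_nonneg z.1, sq_nonneg (1 - z.1)]
  have key : ∃ c > 0, ∀ᶠ x in 𝓝 x₀, ∀ s ∈ Icc (0 : ℝ) 1, s ∈ Icc (0 : ℝ) 1 →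
      c * (s * (1 - s)) ≤ G (s, x) := by
    refine isCompact_Icc.induction_on (p := fun S => ∃ c > 0, ∀ᶠ x in 𝓝 x₀, ∀ s ∈ S,
      s ∈ Icc (0 : ℝ) 1 → c * (s * (1 - s)) ≤ G (s, x)) ⟨1, one_pos, by simp⟩ ?_ ?_ ?_
    · rintro S T hST ⟨c, hc, H⟩
      exact ⟨c, hc, H.mono fun x hx s hs => hx s (hST hs)⟩
    · rintro S T ⟨c, hc, H⟩ ⟨c', hc', H'⟩
      refine ⟨min c c', lt_min hc hc', ?_⟩
      filter_upwards [H, H'] with x hx hx' s hs hs01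
      have hnn : 0 ≤ s * (1 - s) := mul_nonneg hs01.1 (sub_nonneg.2 hs01.2)
      rcases hs with hs | hs
      · exact (mul_le_mul_of_nonneg_right (min_le_left _ _) hnn).trans (hx s hs hs01)
      · exact (mul_le_mul_of_nonneg_right (min_le_right _ _) hnn).trans (hx' s hs hs01)
    · intro s hs
      obtain ⟨c, hc, H⟩ := hloc s hs
      rw [nhds_prod_eq, Filter.eventually_prod_iff] at H
      obtain ⟨pa, ha, pb, hb, H⟩ := H
      exact ⟨{t | pa t}, mem_nhdsWithin_of_mem_nhds ha, c, hc,
        hb.mono fun x hx t ht ht1 => H ht hx ht1⟩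
  obtain ⟨c, hc, H⟩ := key
  exact ⟨c, hc, H.mono fun x hx s hs => hx s hs hs⟩

theorem intervalIntegrable_inv_sqrt_mul_one_sub :
    IntervalIntegrable (fun s : ℝ => (√(s * (1 - s)))⁻¹) volume 0 1 := by
  have h1 : IntervalIntegrable (fun s : ℝ => s ^ (-(1 / 2) : ℝ)) volume 0 1 :=
    intervalIntegral.intervalIntegrable_rpow' (by norm_num)
  have h2 : IntervalIntegrable (fun s : ℝ => (1 - s) ^ (-(1 / 2) : ℝ)) volume 0 1 := by
    simpa using (h1.comp_sub_left 1).symm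
  refine (h1.add h2).mono_fun (by fun_prop) ?_
  rw [uIoc_of_le zero_le_one, ← restrict_Ioo_eq_restrict_Ioc]
  filter_upwards [ae_restrict_mem measurableSet_Ioo] with s hs
  have hs0 : 0 < s := hs.1
  have hs1 : 0 < 1 - s := sub_pos.2 hs.2
  have e1 : s ^ (-(1 / 2) : ℝ) = (√s)⁻¹ := by rw [Real.rpow_neg hs0.le, Real.sqrt_eq_rpow]
  have e2 : (1 - s) ^ (-(1 / 2) : ℝ) = (√(1 - s))⁻¹ := by
    rw [Real.rpow_neg hs1.le, Real.sqrt_eq_rpow]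
  have p0 := Real.sqrt_pos.2 hs0
  have p1 := Real.sqrt_pos.2 hs1
  rw [Real.norm_of_nonneg (by positivity), e1, e2,
    Real.norm_of_nonneg (by positivity), Real.sqrt_mul hs0.le]
  rw [inv_add_inv p0.ne' p1.ne', inv_eq_one_div]
  gcongr
  nlinarith [Real.sq_sqrt hs0.le, Real.sq_sqrt hs1.le, mul_pos p0 p1]

/-- The inverse square root of a continuous function bounded below by a positive multiple of
`s (1 - s)` is integrable on `[0, 1]`. -/
theorem intervalIntegrable_inv_sqrt_of_le {h : ℝ → ℝ} (hh : ContinuousOn h (Icc 0 1)) {c : ℝ}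
    (hc : 0 < c) (hle : ∀ s ∈ Icc (0 : ℝ) 1, c * (s * (1 - s)) ≤ h s) :
    IntervalIntegrable (fun s => (√(h s))⁻¹) volume 0 1 := by
  refine (intervalIntegrable_inv_sqrt_mul_one_sub.const_mul (√c)⁻¹).mono_fun ?_ ?_
  · rw [uIoc_of_le zero_le_one]
    exact ((hh.mono Ioc_subset_Icc_self).sqrt.aemeasurable
      measurableSet_Ioc).inv.aestronglyMeasurable
  · rw [uIoc_of_le zero_le_one, ← restrict_Ioo_eq_restrict_Ioc]
    filter_upwards [ae_restrict_mem measurableSet_Ioo] with s hs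
    have hs0 : 0 < s * (1 - s) := mul_pos hs.1 (sub_pos.2 hs.2)
    rw [Real.norm_of_nonneg (by positivity), Real.norm_of_nonneg (by positivity),
      ← mul_inv, ← Real.sqrt_mul hc.le]
    have := hle s (Ioo_subset_Icc_self hs)
    gcongr

/-- Differentiation under the integral sign for `∫₀¹ √(G (s, x)) ds`, where `G` is `C¹` with
simple zeros at `s = 0` and `s = 1`. -/
theorem hasFDerivAt_integral_sqrt_of_simple_zeros {G : ℝ × X → ℝ} {x₀ : X}
    (hG : ∀ s ∈ Icc (0 : ℝ) 1, ContDiffAt ℝ 1 G (s, x₀))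
    (h0 : ∀ᶠ x in 𝓝 x₀, G (0, x) = 0) (h1 : ∀ᶠ x in 𝓝 x₀, G (1, x) = 0)
    (hpos : ∀ s ∈ Ioo (0 : ℝ) 1, 0 < G (s, x₀))
    (hd0 : 0 < fderiv ℝ G (0, x₀) (1, 0)) (hd1 : fderiv ℝ G (1, x₀) (1, 0) < 0) :
    IntervalIntegrable (fun s => (√(G (s, x₀)))⁻¹) volume 0 1 ∧
    HasFDerivAt (fun x => ∫ s in (0 : ℝ)..1, √(G (s, x)))
      (∫ s in (0 : ℝ)..1, (1 / (2 * √(G (s, x₀)))) •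
        (fderiv ℝ G (s, x₀)).comp (ContinuousLinearMap.inr ℝ ℝ X)) x₀ := by
  obtain ⟨c, hc, hle⟩ := exists_eventually_mul_le_of_simple_zeros hG h0 h1 hpos hd0 hd1
  have hfd : ∀ s ∈ Icc (0 : ℝ) 1, ContinuousAt (fderiv ℝ G) (s, x₀) := fun s hs =>
    ((hG s hs).fderiv_right (m := 0) (by simp)).continuousAt
  have hcurve : ∀ (x : X) (s : ℝ), ContinuousAt (fun s : ℝ => (s, x)) s := fun x s => by fun_prop
  have hcd : ∀ᶠ x in 𝓝 x₀, ∀ s ∈ Icc (0 : ℝ) 1, ContDiffAt ℝ 1 G (s, x) := by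
    refine isCompact_Icc.eventually_forall_of_forall_eventually
      (P := fun x s => ContDiffAt ℝ 1 G (s, x)) fun s hs => ?_
    exact (continuous_swap.tendsto (x₀, s)).eventually ((hG s hs).eventually (by simp))
  have hcont : ∀ᶠ x in 𝓝 x₀, ContinuousOn (fun s => G (s, x)) (Icc 0 1) :=
    hcd.mono fun x hx s hs => by
      exact (ContinuousAt.comp (f := fun s : ℝ => (s, x)) (hx s hs).continuousAt
        (hcurve x s)).continuousWithinAt
  have hcont' : ContinuousOn (fun s => fderiv ℝ G (s, x₀)) (Icc 0 1) := fun s hs =>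
    (ContinuousAt.comp (f := fun s : ℝ => (s, x₀)) (hfd s hs) (hcurve x₀ s)).continuousWithinAt
  obtain ⟨C, hC⟩ := isCompact_Icc.exists_bound_of_continuousOn hcont'
  have hbd : ∀ᶠ x in 𝓝 x₀, ∀ s ∈ Icc (0 : ℝ) 1, ‖fderiv ℝ G (s, x)‖ ≤ C + 1 := by
    refine isCompact_Icc.eventually_forall_of_forall_eventually
      (P := fun x s => ‖fderiv ℝ G (s, x)‖ ≤ C + 1) fun s hs => ?_
    have : ∀ᶠ z in 𝓝 (s, x₀), ‖fderiv ℝ G z‖ < C + 1 :=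
      (hfd s hs).norm.eventually_lt_const (by linarith [hC s hs])
    exact ((continuous_swap.tendsto (x₀, s)).eventually this).mono fun z hz => le_of_lt hz
  have hC0 : 0 ≤ C + 1 := by
    have := (norm_nonneg _).trans (hC 0 (by simp))
    linarith
  have hinv := intervalIntegrable_inv_sqrt_of_le hcont.self_of_nhds hc hle.self_of_nhds
  refine ⟨hinv, ?_⟩
  have hIoo : ∀ᵐ t : ℝ, t ∈ uIoc (0 : ℝ) 1 → t ∈ Ioo (0 : ℝ) 1 := by
    have : ∀ᵐ t : ℝ, t ≠ 1 := by simp [ae_iff]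
    filter_upwards [this] with t ht ht'
    rw [uIoc_of_le zero_le_one] at ht'
    exact ⟨ht'.1, lt_of_le_of_ne ht'.2 ht⟩
  have hGpos : ∀ x, (∀ s ∈ Icc (0 : ℝ) 1, c * (s * (1 - s)) ≤ G (s, x)) →
      ∀ t ∈ Ioo (0 : ℝ) 1, 0 < G (t, x) := fun x hx t ht =>
    lt_of_lt_of_le (mul_pos hc (mul_pos ht.1 (sub_pos.2 ht.2))) (hx t (Ioo_subset_Icc_self ht))
  have hmeas : ∀ x, ContinuousOn (fun s => G (s, x)) (Icc 0 1) →
      AEStronglyMeasurable (fun s => √(G (s, x))) (volume.restrict (uIoc (0 : ℝ) 1)) := by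
    intro x hx
    rw [uIoc_of_le zero_le_one]
    exact (hx.mono Ioc_subset_Icc_self).sqrt.aestronglyMeasurable measurableSet_Ioc
  refine intervalIntegral.hasFDerivAt_integral_of_dominated_of_fderiv_le
    (F := fun x s => √(G (s, x)))
    (F' := fun x s => (1 / (2 * √(G (s, x)))) •
      (fderiv ℝ G (s, x)).comp (ContinuousLinearMap.inr ℝ ℝ X))
    (bound := fun s => (2 * √c)⁻¹ * (C + 1) * (√(s * (1 - s)))⁻¹)
    (hle.and (hcd.and hbd)) (hcont.mono hmeas) ?_ ?_ ?_
    (intervalIntegrable_inv_sqrt_mul_one_sub.const_mul _) ?_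
  · refine ContinuousOn.intervalIntegrable ?_
    rw [uIcc_of_le zero_le_one]
    exact hcont.self_of_nhds.sqrt
  · have m1 := (((hmeas x₀ hcont.self_of_nhds).aemeasurable.const_mul 2).const_div
      1).aestronglyMeasurable
    have m2 : AEStronglyMeasurable (fun s => (fderiv ℝ G (s, x₀)).comp
        (ContinuousLinearMap.inr ℝ ℝ X)) (volume.restrict (uIoc (0 : ℝ) 1)) := by
      rw [uIoc_of_le zero_le_one]
      exact ((hcont'.mono Ioc_subset_Icc_self).clm_comp continuousOn_const).aestronglyMeasurable
        measurableSet_Ioc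
    exact m1.smul m2
  · filter_upwards [hIoo] with t ht ht' x hx
    have hs := ht ht'
    have hs' := Ioo_subset_Icc_self hs
    have hlow := hx.1 t hs'
    have hp := hGpos x hx.1 t hs
    have hs0 : 0 < t * (1 - t) := mul_pos hs.1 (sub_pos.2 hs.2)
    rw [norm_smul, Real.norm_of_nonneg (by positivity)]
    calc 1 / (2 * √(G (t, x))) * ‖(fderiv ℝ G (t, x)).comp (ContinuousLinearMap.inr ℝ ℝ X)‖
        ≤ 1 / (2 * √(c * (t * (1 - t)))) * ((C + 1) * 1) := by
          gcongr
          refine (ContinuousLinearMap.opNorm_comp_le _ _).trans ?_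
          gcongr
          · exact hx.2.2 t hs'
          · exact ContinuousLinearMap.norm_inr_le_one ℝ ℝ X
      _ = (2 * √c)⁻¹ * (C + 1) * (√(t * (1 - t)))⁻¹ := by
          rw [Real.sqrt_mul hc.le]
          field_simp
  · filter_upwards [hIoo] with t ht ht' x hx
    have hs := ht ht'
    have hp := hGpos x hx.1 t hs
    have hF := ((hx.2.1 t (Ioo_subset_Icc_self hs)).differentiableAt (by simp)).hasFDerivAt
    exact (hF.comp x (hasFDerivAt_prodMk_right t x)).sqrt hp.ne'

/-- Derivative of `∫ √g` between two simple zeros `α x < β x` of a positive `C¹` function `g`: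
the motion of the endpoints does not contribute. -/
theorem hasFDerivAt_integral_sqrt_between_simple_zeros {g : ℝ × X → ℝ} (hg : ContDiff ℝ 1 g)
    {α β : X → ℝ} {x₀ : X} (hα : ContDiffAt ℝ 1 α x₀) (hβ : ContDiffAt ℝ 1 β x₀)
    (hlt : α x₀ < β x₀)
    (hgα : ∀ᶠ x in 𝓝 x₀, g (α x, x) = 0) (hgβ : ∀ᶠ x in 𝓝 x₀, g (β x, x) = 0)
    (hpos : ∀ u ∈ Ioo (α x₀) (β x₀), 0 < g (u, x₀))
    (hdα : 0 < fderiv ℝ g (α x₀, x₀) (1, 0)) (hdβ : fderiv ℝ g (β x₀, x₀) (1, 0) < 0) :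
    IntervalIntegrable (fun u => (√(g (u, x₀)))⁻¹) volume (α x₀) (β x₀) ∧
    ∃ A : X →L[ℝ] ℝ, HasFDerivAt (fun x => ∫ u in α x..β x, √(g (u, x))) A x₀ ∧
      ∀ v, A v = ∫ u in α x₀..β x₀, fderiv ℝ g (u, x₀) (0, v) / 2 * (√(g (u, x₀)))⁻¹ := by
  set L := β x₀ - α x₀ with hLdef
  have hL : 0 < L := sub_pos.2 hlt
  set α' := fderiv ℝ α x₀
  set β' := fderiv ℝ β x₀
  have hα' : HasFDerivAt α α' x₀ := (hα.differentiableAt (by simp)).hasFDerivAt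
  have hβ' : HasFDerivAt β β' x₀ := (hβ.differentiableAt (by simp)).hasFDerivAt
  let w : ℝ × X → ℝ × X := fun z => (α z.2 + (β z.2 - α z.2) * z.1, z.2)
  let G : ℝ × X → ℝ := fun z => g (w z)
  have hw : ∀ s, ContDiffAt ℝ 1 w (s, x₀) := by
    intro s
    have a : ContDiffAt ℝ 1 (fun z : ℝ × X => α z.2) (s, x₀) := hα.comp (s, x₀) contDiffAt_snd
    have b : ContDiffAt ℝ 1 (fun z : ℝ × X => β z.2) (s, x₀) := hβ.comp (s, x₀) contDiffAt_snd
    exact (a.add ((b.sub a).mul contDiffAt_fst)).prodMk contDiffAt_snd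
  have hG : ∀ s, ContDiffAt ℝ 1 G (s, x₀) := fun s => hg.contDiffAt.comp (s, x₀) (hw s)
  let y : ℝ → ℝ := fun s => α x₀ + L * s
  have hfw : ∀ s t v, fderiv ℝ w (s, x₀) (t, v) = (α' v + s * (β' v - α' v) + L * t, v) := by
    intro s t v
    have a : HasFDerivAt (fun z : ℝ × X => α z.2) (α'.comp (ContinuousLinearMap.snd ℝ ℝ X))
      (s, x₀) := HasFDerivAt.comp (g := α) (s, x₀) hα' hasFDerivAt_snd
    have b : HasFDerivAt (fun z : ℝ × X => β z.2) (β'.comp (ContinuousLinearMap.snd ℝ ℝ X))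
      (s, x₀) := HasFDerivAt.comp (g := β) (s, x₀) hβ' hasFDerivAt_snd
    have h : HasFDerivAt w _ (s, x₀) :=
      (a.add ((b.sub a).mul hasFDerivAt_fst)).prodMk hasFDerivAt_snd
    rw [h.fderiv]
    simp [hLdef]
    ring
  have hfG : ∀ s t v, fderiv ℝ G (s, x₀) (t, v) =
      (α' v + s * (β' v - α' v) + L * t) * fderiv ℝ g (y s, x₀) (1, 0)
        + fderiv ℝ g (y s, x₀) (0, v) := by
    intro s t v
    have h1 : HasFDerivAt G _ (s, x₀) := HasFDerivAt.comp (g := g) (f := w) (s, x₀)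
      (hg.differentiable (by simp) _).hasFDerivAt ((hw s).differentiableAt (by simp)).hasFDerivAt
    rw [h1.fderiv, ContinuousLinearMap.comp_apply, hfw]
    have e : w (s, x₀) = (y s, x₀) := rfl
    have hsplit : (α' v + s * (β' v - α' v) + L * t, v) =
        (α' v + s * (β' v - α' v) + L * t) • ((1 : ℝ), (0 : X)) + (0, v) := by simp
    rw [e, hsplit, map_add, map_smul, smul_eq_mul]
  have hy0 : y 0 = α x₀ := by simp [y]
  have hy1 : y 1 = β x₀ := by simp [y, hLdef]
  have hG0 : ∀ᶠ x in 𝓝 x₀, G (0, x) = 0 := hgα.mono fun x hx => by simpa [G, w] using hx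
  have hG1 : ∀ᶠ x in 𝓝 x₀, G (1, x) = 0 := hgβ.mono fun x hx => by simpa [G, w] using hx
  have hGpos : ∀ s ∈ Ioo (0 : ℝ) 1, 0 < G (s, x₀) := by
    intro s hs
    refine hpos _ ⟨?_, ?_⟩
    · have := mul_pos hL hs.1
      simp only [← hLdef]
      linarith
    · have := mul_lt_mul_of_pos_left hs.2 hL
      simp only [← hLdef]
      linarith
  obtain ⟨hinv, hder⟩ := hasFDerivAt_integral_sqrt_of_simple_zeros (fun s _ => hG s) hG0 hG1 hGpos
    (by rw [hfG, hy0]; simpa [Prod.mk_zero_zero] using mul_pos hL hdα)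
    (by rw [hfG, hy1]; simpa [Prod.mk_zero_zero] using mul_neg_of_pos_of_neg hL hdβ)
  have hGy : ∀ s, G (s, x₀) = g (y s, x₀) := fun s => rfl
  have hyc : Continuous y := by fun_prop
  have hGc : Continuous fun s => √(G (s, x₀)) := by
    simp only [hGy]
    exact (hg.continuous.comp (hyc.prodMk continuous_const)).sqrt
  have hgc : ∀ v, Continuous fun s => fderiv ℝ g (y s, x₀) v := fun v =>
    ((hg.continuous_fderiv (by simp)).comp (hyc.prodMk continuous_const)).clm_apply
      continuous_const
  have hscale : ∀ h : ℝ → ℝ, L * ∫ s in (0 : ℝ)..1, h (y s) = ∫ u in α x₀..β x₀, h u := by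
    intro h
    simp [y, hLdef]
  constructor
  · have h1 : IntervalIntegrable (fun s => (√(g (α x₀ + L * s, x₀)))⁻¹) volume (0 / L) (L / L) := by
      simpa [hL.ne'] using hinv
    have h2 := (IntervalIntegrable.comp_mul_left_iff
      (f := fun s => (√(g (α x₀ + s, x₀)))⁻¹) hL.ne').1 h1
    have h3 := (IntervalIntegrable.comp_add_left_iff (a := α x₀) (b := β x₀) (c := α x₀)
      (f := fun s => (√(g (s, x₀)))⁻¹)).1 (by simpa [← hLdef] using h2)
    exact h3
  · have hK : (fun x => ∫ u in α x..β x, √(g (u, x))) =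
        fun x => (β x - α x) * ∫ s in (0 : ℝ)..1, √(G (s, x)) := by
      funext x
      have := intervalIntegral.smul_integral_comp_add_mul (a := 0) (b := 1)
        (fun u => √(g (u, x))) (β x - α x) (α x)
      simpa [G, w] using this.symm
    rw [hK]
    refine ⟨_, (hβ'.sub hα').mul hder, fun v => ?_⟩
    have hinv2 : IntervalIntegrable (fun s => 1 / (2 * √(G (s, x₀)))) volume 0 1 := by
      simpa [mul_comm] using hinv.mul_const (2⁻¹ : ℝ)
    have hcomp : IntervalIntegrable (fun s => (1 / (2 * √(G (s, x₀)))) •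
        (fderiv ℝ G (s, x₀)).comp (ContinuousLinearMap.inr ℝ ℝ X)) volume 0 1 := by
      refine hinv2.smul_continuousOn fun s _ => ContinuousAt.continuousWithinAt ?_
      have hc : ContinuousAt (fderiv ℝ G) (s, x₀) :=
        ((hG s).fderiv_right (m := 0) (by simp)).continuousAt
      exact (ContinuousAt.comp (f := fun s : ℝ => (s, x₀)) hc
        (by fun_prop)).clm_comp continuousAt_const
    have happ : (∫ s in (0 : ℝ)..1, (1 / (2 * √(G (s, x₀)))) •
        (fderiv ℝ G (s, x₀)).comp (ContinuousLinearMap.inr ℝ ℝ X)) v =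
        ∫ s in (0 : ℝ)..1, (1 / (2 * √(G (s, x₀)))) *
          ((α' v + s * (β' v - α' v)) * fderiv ℝ g (y s, x₀) (1, 0)
            + fderiv ℝ g (y s, x₀) (0, v)) := by
      rw [ContinuousLinearMap.intervalIntegral_apply hcomp]
      simp [hfG]
    have hk2 : IntervalIntegrable (fun s => (1 / (2 * √(G (s, x₀)))) *
        ((α' v + s * (β' v - α' v)) * fderiv ℝ g (y s, x₀) (1, 0))) volume 0 1 :=
      hinv2.mul_continuousOn (Continuous.continuousOn (by have := hgc (1, 0); fun_prop))
    have hk3 : IntervalIntegrable (fun s => (1 / (2 * √(G (s, x₀)))) *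
        fderiv ℝ g (y s, x₀) (0, v)) volume 0 1 :=
      hinv2.mul_continuousOn (hgc (0, v)).continuousOn
    have hk1 : IntervalIntegrable (fun s => (β' v - α' v) * √(G (s, x₀))) volume 0 1 :=
      (hGc.intervalIntegrable _ _).const_mul _
    have hFTC : ∫ s in (0 : ℝ)..1, ((β' v - α' v) * √(G (s, x₀)) +
        L * ((1 / (2 * √(G (s, x₀)))) *
        ((α' v + s * (β' v - α' v)) * fderiv ℝ g (y s, x₀) (1, 0)))) = 0 := by
      rw [intervalIntegral.integral_eq_sub_of_hasDerivAt_of_le zero_le_one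
        (f := fun s => (α' v + s * (β' v - α' v)) * √(G (s, x₀))) ?_ ?_ (hk1.add (hk2.const_mul L))]
      · simp [hG0.self_of_nhds, hG1.self_of_nhds]
      · exact Continuous.continuousOn (by fun_prop)
      · intro s hs
        have d1 : HasDerivAt (fun s => G (s, x₀)) (L * fderiv ℝ g (y s, x₀) (1, 0)) s := by
          have := ((hG s).differentiableAt (by simp)).hasFDerivAt.comp_hasDerivAt s
            ((hasDerivAt_id s).prodMk (hasDerivAt_const s x₀))
          simpa [hfG, Prod.mk_zero_zero, Function.comp_def] using this
        have d2 : HasDerivAt (fun s : ℝ => α' v + s * (β' v - α' v)) (β' v - α' v) s := by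
          simpa using ((hasDerivAt_id s).mul_const (β' v - α' v)).const_add (α' v)
        refine (d2.mul (d1.sqrt (hGpos s hs).ne')).congr_deriv ?_
        ring
    rw [intervalIntegral.integral_add hk1 (hk2.const_mul L),
      intervalIntegral.integral_const_mul, intervalIntegral.integral_const_mul] at hFTC
    simp only [mul_add] at happ
    rw [intervalIntegral.integral_add (by simpa only [mul_add] using hk2) hk3] at happ
    rw [← hscale fun u => fderiv ℝ g (u, x₀) (0, v) / 2 * (√(g (u, x₀)))⁻¹]
    simp only [add_apply, smul_apply, smul_eq_mul,
      sub_apply, happ]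
    have e : ∫ s in (0 : ℝ)..1, fderiv ℝ g (y s, x₀) (0, v) / 2 * (√(g (y s, x₀)))⁻¹ =
        ∫ s in (0 : ℝ)..1, (1 / (2 * √(G (s, x₀)))) * fderiv ℝ g (y s, x₀) (0, v) := by
      refine intervalIntegral.integral_congr fun s _ => ?_
      simp only [hGy]
      rw [one_div, mul_inv]
      ring
    have hsub : (β - α) x₀ = L := rfl
    rw [e, hsub]
    linear_combination hFTC

end SquareRootIntegral

/-- Action identities: with effective potential `V(u; a, c) = F(u) - (c/2)u² - au`
(`F′ = f`, `f` of class `C¹`) and `C¹` simple turning points `u₋ < u₊` on an open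
parameter set `D` (parameters `p = (a, E, c)` with `a = p.1`, `E = p.2.1`,
`c = p.2.2`), the integrals defining the period `T`, the mass `M` and the momentum `P`
converge, the classical action `K = 2∫ √(2(E - V))` is differentiable on `D`, and
`∂K/∂E = T`, `∂K/∂a = M`, `∂K/∂c = P/2`. -/
theorem stmt_10 (f F : ℝ → ℝ) (hf : ContDiff ℝ 1 f)
    (hF : ∀ x : ℝ, HasDerivAt F (f x) x)
    (V : ℝ → ℝ → ℝ → ℝ)
    (hV : ∀ u a c : ℝ, V u a c = F u - c / 2 * u ^ 2 - a * u)
    (D : Set (ℝ × ℝ × ℝ)) (hD : IsOpen D)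
    (um up : ℝ × ℝ × ℝ → ℝ)
    (humc : ContDiffOn ℝ 1 um D) (hupc : ContDiffOn ℝ 1 up D)
    (hlt : ∀ p ∈ D, um p < up p)
    (hVm : ∀ p ∈ D, V (um p) p.1 p.2.2 = p.2.1)
    (hVp : ∀ p ∈ D, V (up p) p.1 p.2.2 = p.2.1)
    (hVlt : ∀ p ∈ D, ∀ u ∈ Ioo (um p) (up p), V u p.1 p.2.2 < p.2.1)
    (hdm : ∀ p ∈ D, f (um p) - p.2.2 * um p - p.1 < 0)
    (hdp : ∀ p ∈ D, 0 < f (up p) - p.2.2 * up p - p.1) :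
    (∀ p ∈ D, IntervalIntegrable
      (fun u => (Real.sqrt (2 * (p.2.1 - V u p.1 p.2.2)))⁻¹) volume (um p) (up p)) ∧
    (∀ p ∈ D, IntervalIntegrable
      (fun u => u * (Real.sqrt (2 * (p.2.1 - V u p.1 p.2.2)))⁻¹) volume (um p) (up p)) ∧
    (∀ p ∈ D, IntervalIntegrable
      (fun u => u ^ 2 * (Real.sqrt (2 * (p.2.1 - V u p.1 p.2.2)))⁻¹)
        volume (um p) (up p)) ∧
    DifferentiableOn ℝ
      (fun p : ℝ × ℝ × ℝ =>
        2 * ∫ u in um p..up p, Real.sqrt (2 * (p.2.1 - V u p.1 p.2.2))) D ∧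
    (∀ p ∈ D,
      HasDerivAt
        (fun E => 2 * ∫ u in um (p.1, E, p.2.2)..up (p.1, E, p.2.2),
          Real.sqrt (2 * (E - V u p.1 p.2.2)))
        (2 * ∫ u in um p..up p, (Real.sqrt (2 * (p.2.1 - V u p.1 p.2.2)))⁻¹)
        p.2.1) ∧
    (∀ p ∈ D,
      HasDerivAt
        (fun a => 2 * ∫ u in um (a, p.2.1, p.2.2)..up (a, p.2.1, p.2.2),
          Real.sqrt (2 * (p.2.1 - V u a p.2.2)))
        (2 * ∫ u in um p..up p, u * (Real.sqrt (2 * (p.2.1 - V u p.1 p.2.2)))⁻¹)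
        p.1) ∧
    (∀ p ∈ D,
      HasDerivAt
        (fun c => 2 * ∫ u in um (p.1, p.2.1, c)..up (p.1, p.2.1, c),
          Real.sqrt (2 * (p.2.1 - V u p.1 c)))
        ((2 * ∫ u in um p..up p,
          u ^ 2 * (Real.sqrt (2 * (p.2.1 - V u p.1 p.2.2)))⁻¹) / 2)
        p.2.2) := by
  obtain rfl : V = fun u a c => F u - c / 2 * u ^ 2 - a * u := by
    funext u a c
    exact hV u a c
  let g : ℝ × (ℝ × ℝ × ℝ) → ℝ := fun z =>
    2 * (z.2.2.1 - (F z.1 - z.2.2.2 / 2 * z.1 ^ 2 - z.2.1 * z.1))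
  have hF1 : ContDiff ℝ 1 F := by
    refine contDiff_one_iff_deriv.2 ⟨fun x => (hF x).differentiableAt, ?_⟩
    rw [funext fun x => (hF x).deriv]
    exact hf.continuous
  have hg : ContDiff ℝ 1 g := by
    have := hF1.comp (contDiff_fst : ContDiff ℝ 1 (Prod.fst : ℝ × (ℝ × ℝ × ℝ) → ℝ))
    unfold g
    fun_prop
  have hgu : ∀ u p, fderiv ℝ g (u, p) (1, 0) = -2 * (f u - p.2.2 * u - p.1) := by
    intro u p
    have h1 := (hg.differentiable (by simp) (u, p)).hasFDerivAt.comp_hasDerivAt u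
      ((hasDerivAt_id u).prodMk (hasDerivAt_const u p))
    have h2 : HasDerivAt (fun t => g (t, p)) _ u :=
      ((((hF u).sub ((hasDerivAt_pow 2 u).const_mul (p.2.2 / 2))).sub
        ((hasDerivAt_id u).const_mul p.1)).const_sub p.2.1).const_mul 2
    rw [h1.unique h2]
    simp
    ring
  have hgp : ∀ u p v, fderiv ℝ g (u, p) (0, v) = 2 * (v.2.1 + v.2.2 / 2 * u ^ 2 + v.1 * u) := by
    intro u p v
    have hline : HasDerivAt (fun t : ℝ => (u, p + t • v)) (0, v) 0 := by
      refine (hasDerivAt_const (0 : ℝ) u).prodMk ?_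
      simpa using ((hasDerivAt_id (0 : ℝ)).smul_const v).const_add p
    have h1 : HasDerivAt (fun t : ℝ => g (u, p + t • v)) (fderiv ℝ g (u, p) (0, v)) 0 := by
      refine HasFDerivAt.comp_hasDerivAt (l := g) (f := fun t : ℝ => (u, p + t • v)) 0 ?_ hline
      simpa using (hg.differentiable (by simp) (u, p)).hasFDerivAt
    have h2 : HasDerivAt (fun t : ℝ => g (u, p + t • v))
        (2 * (v.2.1 + v.2.2 / 2 * u ^ 2 + v.1 * u)) 0 := by
      have := ((hasDerivAt_id (0 : ℝ)).mul_const
        (2 * (v.2.1 + v.2.2 / 2 * u ^ 2 + v.1 * u))).add_const (g (u, p))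
      rw [one_mul] at this
      refine this.congr_of_eventuallyEq (Filter.Eventually.of_forall fun t => ?_)
      simp [g]
      ring
    exact h1.unique h2
  have key := fun p (hp : p ∈ D) =>
    have hnhds := hD.mem_nhds hp
    hasFDerivAt_integral_sqrt_between_simple_zeros hg (humc.contDiffAt hnhds)
      (hupc.contDiffAt hnhds) (hlt p hp)
      (by
        filter_upwards [hnhds] with q hq
        simp only [g]
        linarith [hVm q hq])
      (by
        filter_upwards [hnhds] with q hq
        simp only [g]
        linarith [hVp q hq])
      (fun u hu => by
        simp only [g]
        linarith [hVlt p hp u hu])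
      (by
        rw [hgu]
        linarith [hdm p hp])
      (by
        rw [hgu]
        linarith [hdp p hp])
  have partials : ∀ p ∈ D, ∀ (v : ℝ × ℝ × ℝ) (γ : ℝ → ℝ × ℝ × ℝ) (t : ℝ), γ t = p →
      HasDerivAt γ v t →
      HasDerivAt (fun s => 2 * ∫ u in um (γ s)..up (γ s), √(g (u, γ s)))
        (2 * ∫ u in um p..up p, (v.2.1 + v.2.2 / 2 * u ^ 2 + v.1 * u) * (√(g (u, p)))⁻¹) t := by
    intro p hp v γ t ht hγ
    obtain ⟨-, A, hA, hAv⟩ := key p hp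
    have hA' : ∫ u in um p..up p, (v.2.1 + v.2.2 / 2 * u ^ 2 + v.1 * u) * (√(g (u, p)))⁻¹ =
        A v := by
      simp only [hAv, hgp, mul_div_cancel_left₀ _ (two_ne_zero' ℝ)]
    rw [hA']
    subst ht
    exact (hA.comp_hasDerivAt t hγ).const_mul 2
  refine ⟨fun p hp => (key p hp).1, fun p hp => ?_, fun p hp => ?_, fun p hp => ?_,
    fun p hp => ?_, fun p hp => ?_, fun p hp => ?_⟩
  · exact (key p hp).1.continuousOn_mul continuousOn_id
  · exact (key p hp).1.continuousOn_mul (continuousOn_id.pow 2)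
  · obtain ⟨-, A, hA, -⟩ := key p hp
    exact (hA.const_mul 2).differentiableAt.differentiableWithinAt
  · simpa [g] using partials p hp (0, 1, 0) (fun E => (p.1, E, p.2.2)) p.2.1 rfl
      ((hasDerivAt_const _ _).prodMk ((hasDerivAt_id _).prodMk (hasDerivAt_const _ _)))
  · simpa [g] using partials p hp (1, 0, 0) (fun a => (a, p.2.1, p.2.2)) p.1 rfl
      ((hasDerivAt_id _).prodMk ((hasDerivAt_const _ _).prodMk (hasDerivAt_const _ _)))
  · have h := partials p hp (0, 0, 1) (fun c => (p.1, p.2.1, c)) p.2.2 rfl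
      ((hasDerivAt_const _ _).prodMk ((hasDerivAt_const _ _).prodMk (hasDerivAt_id _)))
    convert h using 1
    rw [mul_div_assoc, ← intervalIntegral.integral_div]
    congr 2
    funext u
    simp only [g]
    ring
end

section
/- In the setup of the turning-point integrals: let f be C¹ with F′ = f, V(u;a,c) = F(u) − (c/2)u² − a·u, and let u₋ < u₊ be C¹ simple turning points on an open parameter set D ⊆ ℝ³ (V(u±) = E, V < E on (u₋,u₊), ∂V/∂u(u₋) < 0 < ∂V/∂u(u₊)). Define T = 2∫_{u₋}^{u₊} (2(E−V))^{−1/2} du, M = 2∫ u(2(E−V))^{−1/2} du, P = 2∫ u²(2(E−V))^{−1/2} du, and H = 2∫_{u₋}^{u₊} (E − V(u;a,c) − F(u))·(2(E−V))^{−1/2} du, and assume T, M, P, H are differentiable on D. Then for each of the three parameter directions ξ ∈ {a, E, c}: E·∂_ξT + a·∂_ξM + (c/2)·∂_ξP + ∂_ξH = 0; that is, E∇T + a∇M + (c/2)∇P + ∇H = 0 where ∇ = (∂_a, ∂_E, ∂_c). -/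
open Set MeasureTheory

open Filter Topology in
/-- Near a simple zero `a` of `g` with positive slope, `1 / √g` is integrable on the right of `a`. -/
theorem eventually_intervalIntegrable_inv_sqrt {g : ℝ → ℝ} {a g' : ℝ} (hg : Continuous g)
    (ha : g a = 0) (hd : HasDerivAt g g' a) (hg' : 0 < g') :
    ∀ᶠ m in 𝓝[>] a, IntervalIntegrable (fun u ↦ (√(g u))⁻¹) volume a m := by
  have hslope : ∀ᶠ u in 𝓝[>] a, g' / 2 < slope g a u :=
    (hasDerivAt_iff_tendsto_slope.1 hd |>.mono_left
      (nhdsWithin_mono a fun u hu ↦ ne_of_gt hu)).eventually_const_lt (half_lt_self hg')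
  obtain ⟨b, hb, hsub⟩ := (mem_nhdsGT_iff_exists_Ioo_subset).1 hslope
  filter_upwards [Ioo_mem_nhdsGT hb] with m hm
  have hrpow : IntervalIntegrable (fun u : ℝ ↦ u ^ (-(1 / 2) : ℝ)) volume (a - a) (m - a) :=
    intervalIntegral.intervalIntegrable_rpow' (by norm_num)
  have hshift := (hrpow.comp_sub_right a).const_mul (√(g' / 2))⁻¹
  simp only [sub_add_cancel] at hshift
  refine hshift.mono_fun' hg.sqrt.measurable.inv.aestronglyMeasurable ?_
  rw [uIoc_of_le hm.1.le]
  refine (ae_restrict_iff' measurableSet_Ioc).2 (.of_forall fun u hu ↦ ?_)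
  have hua : 0 < u - a := sub_pos.2 hu.1
  have hlow : g' / 2 * (u - a) ≤ g u := by
    have h : g' / 2 < slope g a u := hsub ⟨hu.1, hu.2.trans_lt hm.2⟩
    rw [slope_def_field, ha, sub_zero, lt_div_iff₀ hua] at h
    exact h.le
  beta_reduce
  rw [Real.norm_of_nonneg (by positivity), Real.rpow_neg hua.le, ← Real.sqrt_eq_rpow, ← mul_inv,
    ← Real.sqrt_mul (by positivity)]
  gcongr

/-- `1 / √g` is integrable between two consecutive simple zeros of `g`. -/
theorem intervalIntegrable_inv_sqrt {g : ℝ → ℝ} {a b ga gb : ℝ} (hg : Continuous g)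
    (hab : a < b) (ha : g a = 0) (hb : g b = 0) (hpos : ∀ u ∈ Ioo a b, 0 < g u)
    (hda : HasDerivAt g ga a) (hga : 0 < ga) (hdb : HasDerivAt g gb b) (hgb : gb < 0) :
    IntervalIntegrable (fun u ↦ (√(g u))⁻¹) volume a b := by
  obtain ⟨m, hm, hmab⟩ := ((eventually_intervalIntegrable_inv_sqrt hg ha hda hga).and
    (Ioo_mem_nhdsGT hab)).exists
  have hdn : HasDerivAt (fun u ↦ g (-u)) (-gb) (-b) := by
    have h : HasDerivAt g gb (- -b) := by rwa [neg_neg]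
    simpa [Function.comp_def] using h.comp (-b) (hasDerivAt_neg (-b))
  obtain ⟨n, hn, hnab⟩ := ((eventually_intervalIntegrable_inv_sqrt (g := fun u ↦ g (-u))
    (hg.comp continuous_neg) (by simpa using hb) hdn (neg_pos.2 hgb)).and
    (Ioo_mem_nhdsGT (neg_lt_neg hab))).exists
  have hright : IntervalIntegrable (fun u ↦ (√(g u))⁻¹) volume b (-n) := by
    rw [IntervalIntegrable.iff_comp_neg]
    simpa using hn
  have hsub : uIcc m (-n) ⊆ Ioo a b :=
    ordConnected_Ioo.uIcc_subset hmab ⟨by linarith [hnab.2], by linarith [hnab.1]⟩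
  have hmid : IntervalIntegrable (fun u ↦ (√(g u))⁻¹) volume m (-n) :=
    (hg.sqrt.continuousOn.inv₀ fun u hu ↦
      (Real.sqrt_pos.2 (hpos u (hsub hu))).ne').intervalIntegrable
  exact (hm.trans hmid).trans hright.symm

open Filter Topology Asymptotics in
/-- The integral of a function vanishing at `(p, α p)` over the interval between `α q` and `α p`
has zero derivative at `q = p`. -/
theorem hasFDerivAt_integral_endpoint_zero {E : Type*} [NormedAddCommGroup E] [NormedSpace ℝ E]
    {g : E → ℝ → ℝ} {α : E → ℝ} {p : E} (hg : ContinuousAt (Function.uncurry g) (p, α p))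
    (h0 : g p (α p) = 0) (hα : DifferentiableAt ℝ α p) :
    HasFDerivAt (fun q ↦ ∫ u in α q..α p, g q u) (0 : E →L[ℝ] ℝ) p := by
  have hint : (fun q ↦ ∫ u in α q..α p, g q u) =o[𝓝 p] fun q ↦ α q - α p := by
    refine isLittleO_iff.2 fun ε hε ↦ ?_
    have hsmall : ∀ᶠ z in 𝓝 p ×ˢ 𝓝 (α p), ‖g z.1 z.2‖ ≤ ε := by
      rw [← nhds_prod_eq]
      have h : Tendsto (fun z ↦ ‖Function.uncurry g z‖) (𝓝 (p, α p)) (𝓝 0) := by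
        simpa [ContinuousAt, h0] using hg.norm
      exact h.eventually_le_const hε
    obtain ⟨Q, hQ, R, hR, hQR⟩ := eventually_prod_iff.1 hsmall
    obtain ⟨δ, hδ, hball⟩ := Metric.eventually_nhds_iff_ball.1 hR
    filter_upwards [hQ, hα.continuousAt (Metric.ball_mem_nhds _ hδ)] with q hq hαq
    have hsub : uIcc (α q) (α p) ⊆ Metric.ball (α p) δ := by
      rw [Real.ball_eq_Ioo] at hαq ⊢
      exact ordConnected_Ioo.uIcc_subset hαq ⟨by linarith, by linarith⟩
    refine (intervalIntegral.norm_integral_le_of_norm_le_const fun u hu ↦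
      hQR hq (hball u (hsub (uIoc_subset_uIcc hu)))).trans_eq ?_
    rw [abs_sub_comm, Real.norm_eq_abs]
  rw [hasFDerivAt_iff_isLittleO]
  simpa using hint.trans_isBigO hα.isBigO_sub

/-- The bound `|√x - √y| ≤ |x - y| / √y` for `y > 0`. -/
theorem abs_sqrt_sub_sqrt_le_inv_sqrt_mul (x : ℝ) {y : ℝ} (hy : 0 < y) :
    |√x - √y| ≤ (√y)⁻¹ * |x - y| := by
  have hsy : 0 < √y := Real.sqrt_pos.2 hy
  rw [inv_mul_eq_div, le_div_iff₀ hsy]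
  rcases le_total x 0 with hx | hx
  · rw [Real.sqrt_eq_zero_of_nonpos hx, zero_sub, abs_neg, abs_of_pos hsy,
      Real.mul_self_sqrt hy.le, abs_of_nonpos (by linarith)]
    linarith
  · have hfac : x - y = (√x - √y) * (√x + √y) := by
      nlinarith [Real.mul_self_sqrt hx, Real.mul_self_sqrt hy.le]
    rw [hfac, abs_mul, abs_of_nonneg (a := √x + √y) (by positivity)]
    gcongr
    linarith [Real.sqrt_nonneg x]

open Filter Topology in
/-- Differentiation of the turning-point integral `∫ √G` with `G` affine in the parameter: the
moving end points do not contribute. -/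
theorem hasFDerivAt_integral_sqrt {E : Type*} [NormedAddCommGroup E] [NormedSpace ℝ E]
    {G₀ : ℝ → ℝ} {L : ℝ → E →L[ℝ] ℝ} (hG₀ : Continuous G₀) (hL : Continuous L)
    {α β : E → ℝ} {p : E} (hα : DifferentiableAt ℝ α p) (hβ : DifferentiableAt ℝ β p)
    (hαβ : α p < β p) (h0α : G₀ (α p) + L (α p) p = 0) (h0β : G₀ (β p) + L (β p) p = 0)
    (hpos : ∀ u ∈ Ioo (α p) (β p), 0 < G₀ u + L u p)
    (hint : IntervalIntegrable (fun u ↦ (√(G₀ u + L u p))⁻¹) volume (α p) (β p)) :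
    HasFDerivAt (fun q ↦ ∫ u in α q..β q, √(G₀ u + L u q))
      (∫ u in α p..β p, (2 * √(G₀ u + L u p))⁻¹ • L u) p := by
  have hcont : Continuous (Function.uncurry fun q u ↦ √(G₀ u + L u q)) := by
    simp only [Function.uncurry_def]
    fun_prop
  have hcontu (q : E) : Continuous fun u ↦ √(G₀ u + L u q) := by fun_prop
  have hfix : HasFDerivAt (fun q ↦ ∫ u in α p..β p, √(G₀ u + L u q))
      (∫ u in α p..β p, (2 * √(G₀ u + L u p))⁻¹ • L u) p := by
    have hbound : IntegrableOn (fun u ↦ (√(G₀ u + L u p))⁻¹ * ‖L u‖) (Ioo (α p) (β p)) :=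
      (intervalIntegrable_iff_integrableOn_Ioo_of_le hαβ.le).1
        (hint.mul_continuousOn hL.norm.continuousOn)
    simp only [intervalIntegral.integral_of_le hαβ.le, integral_Ioc_eq_integral_Ioo]
    refine (hasFDerivAt_integral_of_dominated_loc_of_lip'
      (bound := fun u ↦ (√(G₀ u + L u p))⁻¹ * ‖L u‖) univ_mem
      (fun q _ ↦ (hcontu q).aestronglyMeasurable)
      ((intervalIntegrable_iff_integrableOn_Ioo_of_le hαβ.le).1
        ((hcontu p).intervalIntegrable _ _)) ?_ ?_ hbound ?_).2
    · exact (measurable_const.mul (hcontu p).measurable).inv.aestronglyMeasurable.smul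
        hL.aestronglyMeasurable
    · refine (ae_restrict_iff' measurableSet_Ioo).2 (.of_forall fun u hu q _ ↦ ?_)
      refine (abs_sqrt_sub_sqrt_le_inv_sqrt_mul _ (hpos u hu)).trans ?_
      rw [mul_assoc, add_sub_add_left_eq_sub, ← map_sub]
      gcongr
      exact (L u).le_opNorm _
    · refine (ae_restrict_iff' measurableSet_Ioo).2 (.of_forall fun u hu ↦ ?_)
      simpa using ((L u).hasFDerivAt.const_add (G₀ u)).sqrt (hpos u hu).ne'
  have hleft := hasFDerivAt_integral_endpoint_zero hcont.continuousAt (by simp [h0α]) hα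
  have hright := hasFDerivAt_integral_endpoint_zero hcont.continuousAt (by simp [h0β]) hβ
  have hsum := (hleft.add hfix).sub hright
  rw [zero_add, sub_zero] at hsum
  refine hsum.congr_of_eventuallyEq (.of_forall fun q ↦ ?_)
  have hii (x y : ℝ) := (hcontu q).intervalIntegrable (μ := volume) x y
  simp only [Pi.add_apply, Pi.sub_apply]
  rw [intervalIntegral.integral_add_adjacent_intervals (hii _ _) (hii _ _),
    ← intervalIntegral.integral_add_adjacent_intervals (hii (α q) (β q)) (hii (β q) (β p)),
    add_sub_cancel_right]

/-- The gradient identity `E ∇T + a ∇M + (c/2) ∇P + ∇H = 0` for the period, mass,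
momentum and Hamiltonian of the periodic traveling wave, defined as turning-point
integrals with effective potential `V(u; a, c) = F(u) - (c/2)u² - au` (`F′ = f`),
assuming these four functions are differentiable on the open parameter set `D`.
Parameters: `p = (a, E, c)` with `a = p.1`, `E = p.2.1`, `c = p.2.2`. -/
theorem stmt_12 (f F : ℝ → ℝ) (hf : ContDiff ℝ 1 f)
    (hF : ∀ x : ℝ, HasDerivAt F (f x) x)
    (V : ℝ → ℝ → ℝ → ℝ)
    (hV : ∀ u a c : ℝ, V u a c = F u - c / 2 * u ^ 2 - a * u)
    (D : Set (ℝ × ℝ × ℝ)) (hD : IsOpen D)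
    (um up : ℝ × ℝ × ℝ → ℝ)
    (humc : ContDiffOn ℝ 1 um D) (hupc : ContDiffOn ℝ 1 up D)
    (hlt : ∀ p ∈ D, um p < up p)
    (hVm : ∀ p ∈ D, V (um p) p.1 p.2.2 = p.2.1)
    (hVp : ∀ p ∈ D, V (up p) p.1 p.2.2 = p.2.1)
    (hVlt : ∀ p ∈ D, ∀ u ∈ Ioo (um p) (up p), V u p.1 p.2.2 < p.2.1)
    (hdm : ∀ p ∈ D, f (um p) - p.2.2 * um p - p.1 < 0)
    (hdp : ∀ p ∈ D, 0 < f (up p) - p.2.2 * up p - p.1)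
    (T M P H : ℝ × ℝ × ℝ → ℝ)
    (hT : ∀ p ∈ D, T p =
      2 * ∫ u in um p..up p, (Real.sqrt (2 * (p.2.1 - V u p.1 p.2.2)))⁻¹)
    (hM : ∀ p ∈ D, M p =
      2 * ∫ u in um p..up p, u * (Real.sqrt (2 * (p.2.1 - V u p.1 p.2.2)))⁻¹)
    (hP : ∀ p ∈ D, P p =
      2 * ∫ u in um p..up p, u ^ 2 * (Real.sqrt (2 * (p.2.1 - V u p.1 p.2.2)))⁻¹)
    (hH : ∀ p ∈ D, H p =
      2 * ∫ u in um p..up p,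
        (p.2.1 - V u p.1 p.2.2 - F u) * (Real.sqrt (2 * (p.2.1 - V u p.1 p.2.2)))⁻¹)
    (hTd : DifferentiableOn ℝ T D) (hMd : DifferentiableOn ℝ M D)
    (hPd : DifferentiableOn ℝ P D) (hHd : DifferentiableOn ℝ H D) :
    ∀ p ∈ D,
      p.2.1 • fderiv ℝ T p + p.1 • fderiv ℝ M p + (p.2.2 / 2) • fderiv ℝ P p
        + fderiv ℝ H p = 0 := by
  have hFc : Continuous F := continuous_iff_continuousAt.2 fun x ↦ (hF x).continuousAt
  let G₀ : ℝ → ℝ := fun u ↦ -(2 * F u)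
  let da : ℝ × ℝ × ℝ →L[ℝ] ℝ := ContinuousLinearMap.fst ℝ ℝ (ℝ × ℝ)
  let dE : ℝ × ℝ × ℝ →L[ℝ] ℝ :=
    (ContinuousLinearMap.fst ℝ ℝ ℝ).comp (ContinuousLinearMap.snd ℝ ℝ (ℝ × ℝ))
  let dc : ℝ × ℝ × ℝ →L[ℝ] ℝ :=
    (ContinuousLinearMap.snd ℝ ℝ ℝ).comp (ContinuousLinearMap.snd ℝ ℝ (ℝ × ℝ))
  let L : ℝ → ℝ × ℝ × ℝ →L[ℝ] ℝ := fun u ↦ (2 : ℝ) • dE + (2 * u) • da + (u ^ 2) • dc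
  have hG (q : ℝ × ℝ × ℝ) (u : ℝ) : 2 * (q.2.1 - V u q.1 q.2.2) = G₀ u + L u q := by
    simp [G₀, L, da, dE, dc, hV]
    ring
  have hGc (q : ℝ × ℝ × ℝ) : Continuous fun u ↦ G₀ u + L u q := by
    simp only [G₀, L]
    fun_prop
  have hzm (q) (hq : q ∈ D) : G₀ (um q) + L (um q) q = 0 := by
    rw [← hG, hVm q hq, sub_self, mul_zero]
  have hzp (q) (hq : q ∈ D) : G₀ (up q) + L (up q) q = 0 := by
    rw [← hG, hVp q hq, sub_self, mul_zero]
  have hpos (q) (hq : q ∈ D) (u) (hu : u ∈ Ioo (um q) (up q)) : 0 < G₀ u + L u q := by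
    rw [← hG]
    linarith [hVlt q hq u hu]
  have hGd (q : ℝ × ℝ × ℝ) (u : ℝ) :
      HasDerivAt (fun u ↦ G₀ u + L u q) (-2 * (f u - q.2.2 * u - q.1)) u := by
    have h := ((hF u).const_mul (-2)).add ((((hasDerivAt_id u).const_mul (2 * q.1)).add
      ((hasDerivAt_pow 2 u).const_mul q.2.2)).const_add (2 * q.2.1))
    refine (h.congr_deriv ?_).congr_of_eventuallyEq (.of_forall fun v ↦ ?_)
    · simp
      ring
    · simp [G₀, L, da, dE, dc]
      ring
  have hint (q) (hq : q ∈ D) :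
      IntervalIntegrable (fun u ↦ (√(G₀ u + L u q))⁻¹) volume (um q) (up q) :=
    intervalIntegrable_inv_sqrt (hGc q) (hlt q hq) (hzm q hq) (hzp q hq) (hpos q hq)
      (hGd q _) (by linarith [hdm q hq]) (hGd q _) (by linarith [hdp q hq])
  have hint1 (q) (hq : q ∈ D) :
      IntervalIntegrable (fun u ↦ u * (√(G₀ u + L u q))⁻¹) volume (um q) (up q) :=
    (hint q hq).continuousOn_mul continuousOn_id
  have hint2 (q) (hq : q ∈ D) :
      IntervalIntegrable (fun u ↦ u ^ 2 * (√(G₀ u + L u q))⁻¹) volume (um q) (up q) :=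
    (hint q hq).continuousOn_mul (continuousOn_id.pow 2)
  simp only [hG] at hT hM hP hH
  have hHeq (q) (hq : q ∈ D) : H q = 2 * (∫ u in um q..up q, √(G₀ u + L u q))
      - q.2.1 * T q - q.1 * M q - q.2.2 / 2 * P q := by
    have hsplit : (∫ u in um q..up q,
        (q.2.1 - V u q.1 q.2.2 - F u) * (√(G₀ u + L u q))⁻¹) =
        ∫ u in um q..up q, (√(G₀ u + L u q) - q.2.1 * (√(G₀ u + L u q))⁻¹
          - q.1 * (u * (√(G₀ u + L u q))⁻¹) - q.2.2 / 2 * (u ^ 2 * (√(G₀ u + L u q))⁻¹)) := by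
      rw [intervalIntegral.integral_of_le (hlt q hq).le,
        intervalIntegral.integral_of_le (hlt q hq).le, integral_Ioc_eq_integral_Ioo,
        integral_Ioc_eq_integral_Ioo]
      refine setIntegral_congr_fun measurableSet_Ioo fun u hu ↦ ?_
      have hs := Real.sqrt_pos.2 (hpos q hq u hu)
      have hsq := Real.sq_sqrt (hpos q hq u hu).le
      have hGu := hG q u
      have hVu := hV u q.1 q.2.2
      field_simp
      linarith
    have hi := (hGc q).sqrt.intervalIntegrable (μ := volume) (um q) (up q)
    rw [hH q hq, hT q hq, hM q hq, hP q hq, hsplit, intervalIntegral.integral_sub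
        ((hi.sub ((hint q hq).const_mul _)).sub ((hint1 q hq).const_mul _))
        ((hint2 q hq).const_mul _),
      intervalIntegral.integral_sub (hi.sub ((hint q hq).const_mul _)) ((hint1 q hq).const_mul _),
      intervalIntegral.integral_sub hi ((hint q hq).const_mul _)]
    simp only [intervalIntegral.integral_const_mul]
    ring
  intro p hp
  have hDp : D ∈ nhds p := hD.mem_nhds hp
  have hK := (hasFDerivAt_integral_sqrt (G₀ := G₀) (L := L) (by fun_prop) (by fun_prop)
    ((humc.differentiableOn one_ne_zero).differentiableAt hDp)
    ((hupc.differentiableOn one_ne_zero).differentiableAt hDp)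
    (hlt p hp) (hzm p hp) (hzp p hp) (hpos p hp) (hint p hp)).const_mul 2
  have hKval : (2 : ℝ) • (∫ u in um p..up p, (2 * √(G₀ u + L u p))⁻¹ • L u) =
      T p • dE + M p • da + (P p / 2) • dc := by
    have hexp (u : ℝ) : (2 * √(G₀ u + L u p))⁻¹ • L u = (√(G₀ u + L u p))⁻¹ • dE
        + (u * (√(G₀ u + L u p))⁻¹) • da + (u ^ 2 * (√(G₀ u + L u p))⁻¹) • ((1 / 2 : ℝ) • dc) := by
      simp only [L, mul_inv, smul_add, smul_smul]
      congr 2 <;> ring_nf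
    have i0 : IntervalIntegrable (fun u ↦ (√(G₀ u + L u p))⁻¹ • dE) volume (um p) (up p) :=
      (hint p hp).smul_continuousOn continuousOn_const
    have i1 : IntervalIntegrable (fun u ↦ (u * (√(G₀ u + L u p))⁻¹) • da) volume (um p) (up p) :=
      (hint1 p hp).smul_continuousOn continuousOn_const
    have i2 : IntervalIntegrable (fun u ↦ (u ^ 2 * (√(G₀ u + L u p))⁻¹) • ((1 / 2 : ℝ) • dc))
        volume (um p) (up p) :=
      (hint2 p hp).smul_continuousOn continuousOn_const
    rw [intervalIntegral.integral_congr fun u _ ↦ hexp u,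
      intervalIntegral.integral_add (i0.add i1) i2, intervalIntegral.integral_add i0 i1,
      intervalIntegral.integral_smul_const, intervalIntegral.integral_smul_const,
      intervalIntegral.integral_smul_const, hT p hp, hM p hp, hP p hp]
    simp only [smul_add, smul_smul]
    congr 2
    ring
  rw [hKval] at hK
  have hTp := (hTd.differentiableAt hDp).hasFDerivAt
  have hMp := (hMd.differentiableAt hDp).hasFDerivAt
  have hPp := (hPd.differentiableAt hDp).hasFDerivAt
  have hHp := (((hK.sub (dE.hasFDerivAt.mul hTp)).sub (da.hasFDerivAt.mul hMp)).sub
    ((dc.hasFDerivAt.mul_const (1 / 2)).mul hPp)).congr_of_eventuallyEq (f₁ := H) <| by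
      filter_upwards [hDp] with q hq
      simp [hHeq q hq, da, dE, dc, div_eq_mul_inv]
  rw [hHp.fderiv]
  ext <;> simp [da, dE, dc] <;> ring
end

section
/- Let f : ℝ → ℝ be C² with antiderivative F, let D ⊆ ℝ³ be open with parameters (a,E,c), and let u : ℝ × D → ℝ be a C² family such that each u(·;a,E,c) satisfies u″ + f(u) − c·u = a and (1/2)(u′)² + F(u) − (c/2)u² − a·u = E, with u(0) = u₋ a turning point (u′(0) = 0, ∂V/∂u(u₋) < 0), and is periodic with period T(a,E,c); assume T and the mass M = ∫₀^T u dx and momentum P = ∫₀^T u² dx are C¹ on D. For μ ∈ ℂ let Φ(·;μ) be the solution of the linear system Φ′ = H(x;μ)Φ, Φ(0;μ) = I, where H(x;μ) is the 3×3 matrix with rows (0,1,0), (0,0,1), (−μ − f″(u)·u′, c − f′(u), 0), so that μ ↦ Φ(x;μ) is analytic. Then d(μ) := det(Φ(T;μ) − I) satisfies d(0) = d′(0) = d″(0) = 0 and d‴(0) = −3·det J, where J is the 3×3 Jacobian matrix with rows (∂_aT, ∂_aM, ∂_aP), (∂_ET, ∂_EM, ∂_EP), (∂_cT, ∂_cM,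 ∂_cP); equivalently d(μ) = −(1/2){T,M,P}_{a,E,c}·μ³ + O(|μ|⁴) as μ → 0. -/
open Set Matrix MeasureTheory
open Filter Topology

/-- Differentiation under the integral sign over a bounded interval for a jointly `C¹` integrand. -/
theorem hasDerivAt_intervalIntegral_of_contDiffOn {S : Set ℝ} (hS : IsOpen S) {G : ℝ → ℝ → ℝ}
    (hG : ContDiffOn ℝ 1 (fun z : ℝ × ℝ => G z.1 z.2) (S ×ˢ univ)) {s₀ : ℝ} (hs₀ : s₀ ∈ S)
    {G' : ℝ → ℝ} (hG' : ∀ t, HasDerivAt (fun s => G s t) (G' t) s₀) (a b : ℝ) :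
    HasDerivAt (fun s => ∫ t in a..b, G s t) (∫ t in a..b, G' t) s₀ := by
  have hopen : IsOpen (S ×ˢ (univ : Set ℝ)) := hS.prod isOpen_univ
  obtain ⟨r, hr, hrS⟩ := Metric.nhds_basis_closedBall.mem_iff.1 (hS.mem_nhds hs₀)
  have hcont : ContinuousOn (fderiv ℝ (fun z : ℝ × ℝ => G z.1 z.2)) (S ×ˢ univ) :=
    hG.continuousOn_fderiv_of_isOpen hopen le_rfl
  set g : ℝ → ℝ → ℝ := fun s t => fderiv ℝ (fun z : ℝ × ℝ => G z.1 z.2) (s, t) (1, 0) with hg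
  have hgc : ContinuousOn (fun z : ℝ × ℝ => g z.1 z.2) (S ×ˢ univ) :=
    hcont.clm_apply continuousOn_const
  have hderiv : ∀ s ∈ S, ∀ t, HasDerivAt (fun s => G s t) (g s t) s := by
    intro s hs t
    have h1 : HasFDerivAt (fun z : ℝ × ℝ => G z.1 z.2)
        (fderiv ℝ (fun z : ℝ × ℝ => G z.1 z.2) (s, t)) (s, t) :=
      ((hG.differentiableOn one_ne_zero).differentiableAt
        (hopen.mem_nhds ⟨hs, mem_univ _⟩)).hasFDerivAt
    have h2 : HasDerivAt (fun s : ℝ => (s, t)) ((1 : ℝ), (0 : ℝ)) s :=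
      (hasDerivAt_id s).prodMk (hasDerivAt_const s t)
    exact h1.comp_hasDerivAt s h2
  have hGcont : ∀ s ∈ S, Continuous (G s) := fun s hs =>
    hG.continuousOn.comp_continuous (Continuous.prodMk_right s) fun t => ⟨hs, mem_univ t⟩
  have hgcont : Continuous (g s₀) :=
    hgc.comp_continuous (Continuous.prodMk_right s₀) fun t => ⟨hs₀, mem_univ t⟩
  have hGg : G' = g s₀ := funext fun t => (hG' t).unique (hderiv s₀ hs₀ t)
  obtain ⟨C, hC⟩ := ((isCompact_closedBall s₀ r).prod
    (isCompact_uIcc (a := a) (b := b))).exists_bound_of_continuousOn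
    (hgc.mono (prod_mono hrS (subset_univ _)))
  rw [hGg]
  refine (intervalIntegral.hasDerivAt_integral_of_dominated_loc_of_deriv_le (F' := g)
    (bound := fun _ => C) (Metric.closedBall_mem_nhds s₀ hr) ?_
    ((hGcont s₀ hs₀).intervalIntegrable a b) hgcont.aestronglyMeasurable ?_
    intervalIntegrable_const ?_).2
  · filter_upwards [hS.mem_nhds hs₀] with s hs using (hGcont s hs).aestronglyMeasurable
  · exact .of_forall fun t ht s hs => hC (s, t) ⟨hs, uIoc_subset_uIcc ht⟩
  · exact .of_forall fun t _ s hs => hderiv s (hrS hs) t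

section Family

variable {E : Type*} [NormedAddCommGroup E] [NormedSpace ℝ E] {D : Set E}

theorem isOpen_preimage_line (hD : IsOpen D) (p e : E) : IsOpen {s : ℝ | p + s • e ∈ D} :=
  hD.preimage (by fun_prop)

theorem contDiffOn_line {w : E → ℝ → ℝ} {n : WithTop ℕ∞}
    (hw : ContDiffOn ℝ n (fun q : E × ℝ => w q.1 q.2) (D ×ˢ univ)) (p e : E) :
    ContDiffOn ℝ n (fun z : ℝ × ℝ => w (p + z.1 • e) z.2) ({s : ℝ | p + s • e ∈ D} ×ˢ univ) := by
  refine hw.comp (f := fun z : ℝ × ℝ => (p + z.1 • e, z.2)) (by fun_prop) ?_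
  rintro ⟨s, x⟩ ⟨hs, -⟩
  exact ⟨hs, mem_univ _⟩

theorem hasDerivAt_line (p e : E) (s : ℝ) : HasDerivAt (fun s : ℝ => p + s • e) e s := by
  simpa using ((hasDerivAt_id s).smul_const e).const_add p

theorem hasFDerivAt_family (hD : IsOpen D) {w : E → ℝ → ℝ}
    (hw : ContDiffOn ℝ 1 (fun q : E × ℝ => w q.1 q.2) (D ×ˢ univ)) {p : E} (hp : p ∈ D) (x : ℝ) :
    HasFDerivAt (fun q : E × ℝ => w q.1 q.2)
      (fderiv ℝ (fun q : E × ℝ => w q.1 q.2) (p, x)) (p, x) :=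
  ((hw.differentiableOn one_ne_zero).differentiableAt
    ((hD.prod isOpen_univ).mem_nhds ⟨hp, mem_univ x⟩)).hasFDerivAt

theorem hasDerivAt_family_line (hD : IsOpen D) {w : E → ℝ → ℝ}
    (hw : ContDiffOn ℝ 1 (fun q : E × ℝ => w q.1 q.2) (D ×ˢ univ)) {p : E} (hp : p ∈ D)
    (e : E) (x : ℝ) :
    HasDerivAt (fun s : ℝ => w (p + s • e) x)
      (fderiv ℝ (fun q : E × ℝ => w q.1 q.2) (p, x) (e, 0)) 0 := by
  have h1 := hasFDerivAt_family hD hw hp x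
  have h2 : HasDerivAt (fun s : ℝ => (p + s • e, x)) (e, (0 : ℝ)) 0 :=
    (hasDerivAt_line p e 0).prodMk (hasDerivAt_const 0 x)
  have h1' : HasFDerivAt (fun q : E × ℝ => w q.1 q.2)
      (fderiv ℝ (fun q : E × ℝ => w q.1 q.2) (p, x)) (p + (0 : ℝ) • e, x) := by simpa using h1
  exact h1'.comp_hasDerivAt 0 h2

theorem continuous_fderiv_family (hD : IsOpen D) {w : E → ℝ → ℝ}
    (hw : ContDiffOn ℝ 1 (fun q : E × ℝ => w q.1 q.2) (D ×ˢ univ)) {p : E} (hp : p ∈ D)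
    (e : E × ℝ) :
    Continuous fun x => fderiv ℝ (fun q : E × ℝ => w q.1 q.2) (p, x) e :=
  ((hw.continuousOn_fderiv_of_isOpen (hD.prod isOpen_univ) le_rfl).clm_apply
    continuousOn_const).comp_continuous (Continuous.prodMk_right p) fun x => ⟨hp, mem_univ x⟩

/-- Parameter and space derivatives commute for a `C¹` family whose space derivative is `C¹`. -/
theorem hasDerivAt_fderiv_family (hD : IsOpen D) {w g : E → ℝ → ℝ}
    (hw : ContDiffOn ℝ 1 (fun q : E × ℝ => w q.1 q.2) (D ×ˢ univ))
    (hg : ContDiffOn ℝ 1 (fun q : E × ℝ => g q.1 q.2) (D ×ˢ univ))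
    (hwg : ∀ p ∈ D, ∀ x, HasDerivAt (w p) (g p x) x) {p : E} (hp : p ∈ D) (e : E) (x : ℝ) :
    HasDerivAt (fun y => fderiv ℝ (fun q : E × ℝ => w q.1 q.2) (p, y) (e, 0))
      (fderiv ℝ (fun q : E × ℝ => g q.1 q.2) (p, x) (e, 0)) x := by
  have hgc : ∀ q ∈ D, Continuous (g q) := fun q hq =>
    hg.continuousOn.comp_continuous (Continuous.prodMk_right q) fun t => ⟨hq, mem_univ t⟩
  have hgc' := continuous_fderiv_family hD hg hp (e, 0)
  have hS := isOpen_preimage_line hD p e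
  have h0 : (0 : ℝ) ∈ {s : ℝ | p + s • e ∈ D} := by simpa using hp
  have key : (fun y => fderiv ℝ (fun q : E × ℝ => w q.1 q.2) (p, y) (e, 0)) = fun y =>
      fderiv ℝ (fun q : E × ℝ => w q.1 q.2) (p, 0) (e, 0) +
        ∫ t in (0 : ℝ)..y, fderiv ℝ (fun q : E × ℝ => g q.1 q.2) (p, t) (e, 0) := by
    funext y
    refine (hasDerivAt_family_line hD hw hp e y).unique ?_
    refine ((hasDerivAt_family_line hD hw hp e 0).add
      (hasDerivAt_intervalIntegral_of_contDiffOn hS (contDiffOn_line hg p e) h0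
        (hasDerivAt_family_line hD hg hp e) 0 y)).congr_of_eventuallyEq ?_
    filter_upwards [hS.mem_nhds h0] with s hs
    simp only [Pi.add_apply]
    rw [intervalIntegral.integral_eq_sub_of_hasDerivAt (fun t _ => hwg _ hs t)
      ((hgc _ hs).intervalIntegrable _ _)]
    ring
  rw [key]
  exact (hgc'.integral_hasStrictDerivAt 0 x).hasDerivAt.const_add _

/-- Leibniz rule for the integral of a `C¹` family over a parameter-dependent period. -/
theorem fderiv_integral_period (hD : IsOpen D) {v : E → ℝ → ℝ} {T N : E → ℝ}
    (hv : ContDiffOn ℝ 1 (fun q : E × ℝ => v q.1 q.2) (D ×ˢ univ))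
    (hT : ContDiffOn ℝ 1 T D) (hN : ContDiffOn ℝ 1 N D)
    (hNv : ∀ p ∈ D, N p = ∫ x in (0 : ℝ)..T p, v p x) {p : E} (hp : p ∈ D) (e : E) :
    fderiv ℝ N p e = v p (T p) * fderiv ℝ T p e +
      ∫ x in (0 : ℝ)..T p, fderiv ℝ (fun q : E × ℝ => v q.1 q.2) (p, x) (e, 0) := by
  set v' := fun x => fderiv ℝ (fun q : E × ℝ => v q.1 q.2) (p, x) with hv'
  have hS := isOpen_preimage_line hD p e
  have h0 : (0 : ℝ) ∈ {s : ℝ | p + s • e ∈ D} := by simpa using hp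
  have hline : ∀ {R : E → ℝ}, ContDiffOn ℝ 1 R D →
      HasDerivAt (fun s : ℝ => R (p + s • e)) (fderiv ℝ R p e) 0 := by
    intro R hR
    have h1 : HasFDerivAt R (fderiv ℝ R p) (p + (0 : ℝ) • e) := by
      simpa using ((hR.differentiableOn one_ne_zero).differentiableAt (hD.mem_nhds hp)).hasFDerivAt
    exact h1.comp_hasDerivAt 0 (hasDerivAt_line p e 0)
  have hvx : ∀ x, HasDerivAt (v p) (v' x (0, 1)) x := fun x =>
    (hasFDerivAt_family hD hv hp x).comp_hasDerivAt x
      ((hasDerivAt_const x p).prodMk (hasDerivAt_id x))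
  have hvc : Continuous (v p) := continuous_iff_continuousAt.2 fun x => (hvx x).continuousAt
  have hve := continuous_fderiv_family hD hv hp (e, 0)
  have hvxc := continuous_fderiv_family hD hv hp (0, 1)
  set τ := fderiv ℝ T p e with hτ
  have hTline : ContDiffOn ℝ 1 (fun z : ℝ × ℝ => T (p + z.1 • e))
      ({s : ℝ | p + s • e ∈ D} ×ˢ univ) :=
    hT.comp (f := fun z : ℝ × ℝ => p + z.1 • e) (by fun_prop) fun z hz => hz.1
  have hG : ContDiffOn ℝ 1
      (fun z : ℝ × ℝ => T (p + z.1 • e) * v (p + z.1 • e) (T (p + z.1 • e) * z.2))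
      ({s : ℝ | p + s • e ∈ D} ×ˢ univ) :=
    hTline.mul (hv.comp (f := fun z : ℝ × ℝ => (p + z.1 • e, T (p + z.1 • e) * z.2))
      (ContDiffOn.prodMk (by fun_prop) (hTline.mul contDiffOn_snd))
      fun z hz => ⟨hz.1, mem_univ _⟩)
  have hG' : ∀ y : ℝ, HasDerivAt
      (fun s : ℝ => T (p + s • e) * v (p + s • e) (T (p + s • e) * y))
      (τ * (1 * v p (T p * y) + y * (v' (T p * y) (0, 1) * T p)) + T p * v' (T p * y) (e, 0)) 0 := by
    intro y
    have h1 := hasFDerivAt_family hD hv hp (T p * y)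
    have h2 : HasDerivAt (fun s : ℝ => (p + s • e, T (p + s • e) * y)) (e, τ * y) 0 :=
      (hasDerivAt_line p e 0).prodMk ((hline hT).mul_const y)
    have h1' : HasFDerivAt (fun q : E × ℝ => v q.1 q.2) (v' (T p * y))
      (p + (0 : ℝ) • e, T (p + (0 : ℝ) • e) * y) := by simpa using h1
    have h3 := (hline hT).mul (h1'.comp_hasDerivAt 0 h2)
    have h4 : ((e, τ * y) : E × ℝ) = (e, 0) + (τ * y) • ((0, 1) : E × ℝ) := by simp
    refine h3.congr_deriv ?_
    rw [h4, map_add, map_smul]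
    simp only [Function.comp_apply, zero_smul, add_zero, smul_eq_mul]
    ring
  have hI := hasDerivAt_intervalIntegral_of_contDiffOn hS hG h0 hG' 0 1
  have hNI : (fun s : ℝ => N (p + s • e)) =ᶠ[𝓝 0] fun s : ℝ =>
      ∫ y in (0 : ℝ)..1, T (p + s • e) * v (p + s • e) (T (p + s • e) * y) := by
    filter_upwards [hS.mem_nhds h0] with s hs
    rw [hNv _ hs, intervalIntegral.integral_const_mul, intervalIntegral.mul_integral_comp_mul_left]
    simp
  rw [(hline hN).unique (hI.congr_of_eventuallyEq hNI)]
  have hprim : ∀ y : ℝ, HasDerivAt (fun y => y * v p (T p * y))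
      (1 * v p (T p * y) + y * (v' (T p * y) (0, 1) * T p)) y := by
    intro y
    refine ((hasDerivAt_id y).mul
      ((hvx (T p * y)).comp y ((hasDerivAt_id y).const_mul (T p)))).congr_deriv ?_
    simp
  have hc1 : Continuous fun y => 1 * v p (T p * y) + y * (v' (T p * y) (0, 1) * T p) := by
    have := hvxc.comp (continuous_const_mul (T p))
    have h2 := hvc.comp (continuous_const_mul (T p))
    simp only [Function.comp_def] at this h2
    fun_prop
  have hc2 : Continuous fun y => v' (T p * y) (e, 0) := hve.comp (continuous_const_mul (T p))
  rw [intervalIntegral.integral_add ((hc1.const_mul τ).intervalIntegrable _ _)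
      ((hc2.const_mul (T p)).intervalIntegrable _ _), intervalIntegral.integral_const_mul,
    intervalIntegral.integral_const_mul,
    intervalIntegral.integral_eq_sub_of_hasDerivAt (fun y _ => hprim y)
      (hc1.intervalIntegrable _ _),
    intervalIntegral.mul_integral_comp_mul_left (f := fun x => v' x (e, 0))]
  simp [hv', mul_comm]

end Family

theorem contDiffOn_deriv_family {E : Type*} [NormedAddCommGroup E] [NormedSpace ℝ E] {D : Set E}
    (hD : IsOpen D) {w : E → ℝ → ℝ}
    (hw : ContDiffOn ℝ 2 (fun q : E × ℝ => w q.1 q.2) (D ×ˢ univ)) :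
    ContDiffOn ℝ 1 (fun q : E × ℝ => deriv (w q.1) q.2) (D ×ˢ univ) := by
  have h1 : ContDiffOn ℝ 1 (fderiv ℝ (fun q : E × ℝ => w q.1 q.2)) (D ×ˢ univ) :=
    hw.fderiv_of_isOpen (hD.prod isOpen_univ) (by norm_num)
  refine (h1.clm_apply (contDiffOn_const (c := ((0, 1) : E × ℝ)))).congr ?_
  rintro ⟨p, x⟩ ⟨hp, -⟩
  exact ((hasFDerivAt_family hD (hw.of_le (by norm_num)) hp x).comp_hasDerivAt x
    ((hasDerivAt_const x p).prodMk (hasDerivAt_id x))).deriv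

theorem hasDerivAt_family_space {E : Type*} [NormedAddCommGroup E] [NormedSpace ℝ E] {D : Set E}
    (hD : IsOpen D) {w : E → ℝ → ℝ}
    (hw : ContDiffOn ℝ 1 (fun q : E × ℝ => w q.1 q.2) (D ×ˢ univ)) {p : E} (hp : p ∈ D) (x : ℝ) :
    HasDerivAt (w p) (deriv (w p) x) x :=
  ((hasFDerivAt_family hD hw hp x).comp_hasDerivAt x
    ((hasDerivAt_const x p).prodMk (hasDerivAt_id x))).differentiableAt.hasDerivAt

theorem deriv_add_period {v : ℝ → ℝ} {τ : ℝ} (h : ∀ x, v (x + τ) = v x) (x : ℝ) :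
    deriv v (x + τ) = deriv v x := by
  rw [← deriv_comp_add_const, funext h]

/-- The derivative of a family of periodic travelling waves in a parameter direction `e` solves
the linearized profile equation, and its data are determined by those of `T`, `M`, `P`. -/
theorem exists_variation {f F : ℝ → ℝ} (hf : ContDiff ℝ 2 f)
    (hF : ∀ x : ℝ, HasDerivAt F (f x) x)
    {D : Set (ℝ × ℝ × ℝ)} (hD : IsOpen D) {u : ℝ × ℝ × ℝ → ℝ → ℝ}
    (hu : ContDiffOn ℝ 2 (fun q : (ℝ × ℝ × ℝ) × ℝ => u q.1 q.2) (D ×ˢ (univ : Set ℝ)))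
    (hODE : ∀ p ∈ D, ∀ x : ℝ, deriv (deriv (u p)) x + f (u p x) - p.2.2 * u p x = p.1)
    (hEn : ∀ p ∈ D, ∀ x : ℝ,
      1 / 2 * (deriv (u p) x) ^ 2 + F (u p x) - p.2.2 / 2 * (u p x) ^ 2 - p.1 * u p x = p.2.1)
    (hturn : ∀ p ∈ D, deriv (u p) 0 = 0)
    {T M P : ℝ × ℝ × ℝ → ℝ} (hper : ∀ p ∈ D, ∀ x : ℝ, u p (x + T p) = u p x)
    (hM : ∀ p ∈ D, M p = ∫ x in (0 : ℝ)..T p, u p x)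
    (hP : ∀ p ∈ D, P p = ∫ x in (0 : ℝ)..T p, (u p x) ^ 2)
    (hTc : ContDiffOn ℝ 1 T D) (hMc : ContDiffOn ℝ 1 M D) (hPc : ContDiffOn ℝ 1 P D)
    {p : ℝ × ℝ × ℝ} (hp : p ∈ D) (e : ℝ × ℝ × ℝ) :
    ∃ v w : ℝ → ℝ, (∀ x, HasDerivAt v (w x) x) ∧
      (∀ x, HasDerivAt w (e.1 + (p.2.2 - deriv f (u p x)) * v x + e.2.2 * u p x) x) ∧
      (p.1 - f (u p 0) + p.2.2 * u p 0) * v 0 =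
        -(e.2.1 + e.1 * u p 0 + e.2.2 * (u p 0 ^ 2 / 2)) ∧
      w 0 = 0 ∧ w (T p) = -(p.1 - f (u p 0) + p.2.2 * u p 0) * fderiv ℝ T p e ∧
      fderiv ℝ M p e = u p 0 * fderiv ℝ T p e + ∫ x in (0 : ℝ)..T p, v x ∧
      fderiv ℝ P p e = u p 0 ^ 2 * fderiv ℝ T p e + 2 * ∫ x in (0 : ℝ)..T p, u p x * v x := by
  have hu1 := hu.of_le (m := 1) (by norm_num)
  have hux := contDiffOn_deriv_family hD hu
  have hS := isOpen_preimage_line hD p e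
  have h0 : (0 : ℝ) ∈ {s : ℝ | p + s • e ∈ D} := by simpa using hp
  have hpe : p + (0 : ℝ) • e = p := by simp
  have hfd : ∀ y, HasDerivAt f (deriv f y) y := fun y =>
    (hf.differentiable (by norm_num) y).hasDerivAt
  set v : ℝ → ℝ := fun x => fderiv ℝ (fun q : (ℝ × ℝ × ℝ) × ℝ => u q.1 q.2) (p, x) (e, 0) with hv
  set w : ℝ → ℝ := fun x =>
    fderiv ℝ (fun q : (ℝ × ℝ × ℝ) × ℝ => deriv (u q.1) q.2) (p, x) (e, 0) with hw
  have hvl : ∀ x, HasDerivAt (fun s : ℝ => u (p + s • e) x) (v x) 0 := fun x =>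
    hasDerivAt_family_line hD hu1 hp e x
  have hwl : ∀ x, HasDerivAt (fun s : ℝ => deriv (u (p + s • e)) x) (w x) 0 := fun x =>
    hasDerivAt_family_line hD (w := fun p => deriv (u p)) hux hp e x
  have he1 : HasDerivAt (fun s : ℝ => (p + s • e).1) e.1 0 := by
    simpa using ((hasDerivAt_id (0 : ℝ)).mul_const e.1).const_add p.1
  have he2 : HasDerivAt (fun s : ℝ => (p + s • e).2.1) e.2.1 0 := by
    simpa using ((hasDerivAt_id (0 : ℝ)).mul_const e.2.1).const_add p.2.1
  have he3 : HasDerivAt (fun s : ℝ => (p + s • e).2.2) e.2.2 0 := by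
    simpa using ((hasDerivAt_id (0 : ℝ)).mul_const e.2.2).const_add p.2.2
  let g : ℝ × ℝ × ℝ → ℝ → ℝ := fun q x => q.1 - f (u q x) + q.2.2 * u q x
  have hg : ContDiffOn ℝ 1 (fun q : (ℝ × ℝ × ℝ) × ℝ => g q.1 q.2) (D ×ˢ univ) :=
    ((contDiff_fst.comp contDiff_fst).contDiffOn.sub
      ((hf.of_le (m := 1) (by norm_num)).comp_contDiffOn hu1)).add
      ((contDiff_snd.comp (contDiff_snd.comp contDiff_fst)).contDiffOn.mul hu1)
  have huxx : ∀ q ∈ D, ∀ x, HasDerivAt (deriv (u q)) (q.1 - f (u q x) + q.2.2 * u q x) x := by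
    intro q hq x
    refine (hasDerivAt_family_space hD (w := fun p => deriv (u p)) hux hq x).congr_deriv ?_
    linarith [hODE q hq x]
  have huT : u p (T p) = u p 0 := by simpa using hper p hp 0
  have huxT : ∀ q ∈ D, deriv (u q) (T q) = 0 := fun q hq => by
    have := deriv_add_period (hper q hq) 0
    rw [zero_add] at this
    rw [this, hturn q hq]
  refine ⟨v, w, fun x => hasDerivAt_fderiv_family hD hu1 hux
    (fun q hq x => hasDerivAt_family_space hD hu1 hq x) hp e x, fun x => ?_, ?_, ?_, ?_, ?_, ?_⟩
  · refine (hasDerivAt_fderiv_family hD (w := fun p => deriv (u p)) (g := g) hux hg huxx hp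
      e x).congr_deriv ((hasDerivAt_family_line hD (w := g) hg hp e x).unique ?_)
    have h1 := hfd (u (p + (0 : ℝ) • e) x)
    refine ((he1.sub (h1.comp (h := fun s : ℝ => u (p + s • e) x) 0 (hvl x))).add
      (he3.mul (hvl x))).congr_deriv ?_
    rw [hpe]
    ring
  · have h1 := hF (u (p + (0 : ℝ) • e) 0)
    have h2 := ((h1.comp (h := fun s : ℝ => u (p + s • e) 0) 0 (hvl 0)).sub
      ((he3.div_const 2).mul ((hvl 0).pow 2))).sub (he1.mul (hvl 0))
    have h3 := h2.unique (he2.congr_of_eventuallyEq (by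
      filter_upwards [hS.mem_nhds h0] with s hs
      have := hEn _ hs 0
      rw [hturn _ hs] at this
      simp only [Pi.sub_apply, Pi.mul_apply, Pi.pow_apply, Function.comp_apply]
      linarith))
    simp only [hpe, Pi.pow_apply] at h3
    push_cast at h3
    linarith
  · refine (hwl 0).unique ((hasDerivAt_const 0 0).congr_of_eventuallyEq ?_)
    filter_upwards [hS.mem_nhds h0] with s hs using hturn _ hs
  · have h1 : HasFDerivAt (fun q : (ℝ × ℝ × ℝ) × ℝ => deriv (u q.1) q.2)
        (fderiv ℝ (fun q : (ℝ × ℝ × ℝ) × ℝ => deriv (u q.1) q.2) (p, T p))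
        (p + (0 : ℝ) • e, T (p + (0 : ℝ) • e)) := by
      simpa using hasFDerivAt_family hD (w := fun p => deriv (u p)) hux hp (T p)
    have hTl : HasDerivAt (fun s : ℝ => T (p + s • e)) (fderiv ℝ T p e) 0 := by
      have h1 : HasFDerivAt T (fderiv ℝ T p) (p + (0 : ℝ) • e) := by
        simpa using
          ((hTc.differentiableOn one_ne_zero).differentiableAt (hD.mem_nhds hp)).hasFDerivAt
      exact h1.comp_hasDerivAt 0 (hasDerivAt_line p e 0)
    have h2 := h1.comp_hasDerivAt 0 ((hasDerivAt_line p e 0).prodMk hTl)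
    have h3 := h2.unique ((hasDerivAt_const 0 0).congr_of_eventuallyEq (by
      filter_upwards [hS.mem_nhds h0] with s hs using huxT _ hs))
    have h4 : ((e, fderiv ℝ T p e) : (ℝ × ℝ × ℝ) × ℝ) =
        (e, 0) + (fderiv ℝ T p e) • ((0, 1) : (ℝ × ℝ × ℝ) × ℝ) := by simp
    have h5 := ((hasFDerivAt_family hD (w := fun p => deriv (u p)) hux hp (T p)).comp_hasDerivAt
      (T p) ((hasDerivAt_const (T p) p).prodMk (hasDerivAt_id (T p)))).unique (huxx p hp (T p))
    rw [h4, map_add, map_smul, h5, huT, smul_eq_mul] at h3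
    linarith
  · rw [fderiv_integral_period hD hu1 hTc hMc hM hp e, huT]
  · rw [fderiv_integral_period hD (v := fun q x => u q x ^ 2) (hu1.pow 2) hTc hPc hP hp e, huT,
      ← intervalIntegral.integral_const_mul]
    congr 1
    refine intervalIntegral.integral_congr fun x _ => ?_
    refine (hasDerivAt_family_line hD (w := fun q x => u q x ^ 2) (hu1.pow 2) hp e x).unique ?_
    refine ((hvl x).pow 2).congr_deriv ?_
    rw [hpe]
    push_cast
    ring

/-- `V` solves the first-order form of `v‴ = (-μ - q) v + r v′ + g`. -/
def IsSpectralSolution (q r : ℝ → ℝ) (μ : ℂ) (g : ℝ → ℂ) (V : ℝ → Fin 3 → ℂ) : Prop :=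
  ∀ x, HasDerivAt V ![V x 1, V x 2, (-μ - (q x : ℂ)) * V x 0 + (r x : ℂ) * V x 1 + g x] x

theorem isSpectralSolution_of_components {q r : ℝ → ℝ} {μ : ℂ} {g v₀ v₁ v₂ : ℝ → ℂ}
    (h₀ : ∀ x, HasDerivAt v₀ (v₁ x) x) (h₁ : ∀ x, HasDerivAt v₁ (v₂ x) x)
    (h₂ : ∀ x, HasDerivAt v₂ ((-μ - (q x : ℂ)) * v₀ x + (r x : ℂ) * v₁ x + g x) x) :
    IsSpectralSolution q r μ g fun x => ![v₀ x, v₁ x, v₂ x] := by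
  intro x
  rw [hasDerivAt_pi]
  intro i
  fin_cases i
  · exact h₀ x
  · exact h₁ x
  · exact h₂ x

namespace IsSpectralSolution

variable {q r : ℝ → ℝ} {μ : ℂ} {g : ℝ → ℂ} {V : ℝ → Fin 3 → ℂ}

theorem hasDerivAt_zero (h : IsSpectralSolution q r μ g V) (x : ℝ) :
    HasDerivAt (fun y => V y 0) (V x 1) x := by
  simpa using hasDerivAt_pi.1 (h x) 0

theorem hasDerivAt_one (h : IsSpectralSolution q r μ g V) (x : ℝ) :
    HasDerivAt (fun y => V y 1) (V x 2) x := by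
  simpa using hasDerivAt_pi.1 (h x) 1

theorem hasDerivAt_two (h : IsSpectralSolution q r μ g V) (x : ℝ) :
    HasDerivAt (fun y => V y 2)
      ((-μ - (q x : ℂ)) * V x 0 + (r x : ℂ) * V x 1 + g x) x := by
  simpa using hasDerivAt_pi.1 (h x) 2

theorem continuous (h : IsSpectralSolution q r μ g V) : Continuous V :=
  continuous_iff_continuousAt.2 fun x => (h x).continuousAt

theorem continuous_zero (h : IsSpectralSolution q r μ g V) : Continuous fun x => V x 0 :=
  (continuous_apply 0).comp h.continuous

theorem sub {g' : ℝ → ℂ} {W : ℝ → Fin 3 → ℂ} (h : IsSpectralSolution q r μ g V)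
    (h' : IsSpectralSolution q r μ g' W) :
    IsSpectralSolution q r μ (fun x => g x - g' x) (fun x => V x - W x) := by
  intro x
  refine ((h x).sub (h' x)).congr_deriv ?_
  funext i
  fin_cases i
  · simp
  · simp
  · simp only [Pi.sub_apply, Fin.reduceFinMk, cons_val]
    ring

/-- The integral of a solution is the increment of the first boundary form. -/
theorem integral_eq {τ : ℝ} (h : IsSpectralSolution q r μ 0 V)
    (hr : ∀ x, HasDerivAt r (-q x) x) :
    μ * ∫ x in (0 : ℝ)..τ, V x 0 =
      ((r τ : ℂ) * V τ 0 - V τ 2) - ((r 0 : ℂ) * V 0 0 - V 0 2) := by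
  rw [← intervalIntegral.integral_const_mul]
  refine intervalIntegral.integral_eq_sub_of_hasDerivAt
    (f := fun x => (r x : ℂ) * V x 0 - V x 2) (fun x _ => ?_)
    ((h.continuous_zero.const_mul μ).intervalIntegrable _ _)
  refine (((hr x).ofReal_comp.mul (h.hasDerivAt_zero x)).sub (h.hasDerivAt_two x)).congr_deriv ?_
  simp only [Pi.zero_apply]
  push_cast
  ring

/-- The moment of a solution against `U` is the increment of the second boundary form. -/
theorem integral_mul_eq {τ : ℝ} (h : IsSpectralSolution q r μ 0 V)
    (hr : ∀ x, HasDerivAt r (-q x) x) {U U₁ U₂ : ℝ → ℝ} (hU : ∀ x, HasDerivAt U (U₁ x) x)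
    (hU₁ : ∀ x, HasDerivAt U₁ (U₂ x) x) (hU₂ : ∀ x, HasDerivAt U₂ (r x * U₁ x) x) :
    μ * ∫ x in (0 : ℝ)..τ, (U x : ℂ) * V x 0 =
      ((U τ : ℂ) * ((r τ : ℂ) * V τ 0 - V τ 2) + (U₁ τ : ℂ) * V τ 1 - (U₂ τ : ℂ) * V τ 0) -
      ((U 0 : ℂ) * ((r 0 : ℂ) * V 0 0 - V 0 2) + (U₁ 0 : ℂ) * V 0 1 - (U₂ 0 : ℂ) * V 0 0) := by
  have hUc : Continuous fun x => (U x : ℂ) := Complex.continuous_ofReal.comp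
    (continuous_iff_continuousAt.2 fun x => (hU x).continuousAt)
  rw [← intervalIntegral.integral_const_mul]
  refine intervalIntegral.integral_eq_sub_of_hasDerivAt
    (f := fun x => (U x : ℂ) * ((r x : ℂ) * V x 0 - V x 2) + (U₁ x : ℂ) * V x 1
      - (U₂ x : ℂ) * V x 0) (fun x _ => ?_)
    (((hUc.mul h.continuous_zero).const_mul μ).intervalIntegrable _ _)
  refine ((((hU x).ofReal_comp.mul
    (((hr x).ofReal_comp.mul (h.hasDerivAt_zero x)).sub (h.hasDerivAt_two x))).add
    ((hU₁ x).ofReal_comp.mul (h.hasDerivAt_one x))).sub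
    ((hU₂ x).ofReal_comp.mul (h.hasDerivAt_zero x))).congr_deriv ?_
  simp only [Pi.zero_apply, Pi.sub_apply, Pi.mul_apply]
  push_cast
  ring

end IsSpectralSolution

/-- Solutions with zero initial data are bounded by their forcing, uniformly for `‖μ‖ ≤ 1`. -/
theorem exists_norm_le_of_isSpectralSolution {q r : ℝ → ℝ} (hq : Continuous q) (hr : Continuous r)
    (τ : ℝ) :
    ∃ C, 0 ≤ C ∧ ∀ (μ : ℂ) (g : ℝ → ℂ) (V : ℝ → Fin 3 → ℂ) (ε : ℝ), ‖μ‖ ≤ 1 →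
      IsSpectralSolution q r μ g V → V 0 = 0 → 0 ≤ ε → (∀ x ∈ Icc 0 τ, ‖g x‖ ≤ ε) →
      ∀ x ∈ Icc 0 τ, ‖V x‖ ≤ C * ε := by
  obtain ⟨B, hB⟩ := (isCompact_Icc (a := (0 : ℝ)) (b := τ)).exists_bound_of_continuousOn
    (hq.norm.add hr.norm).continuousOn
  set K : ℝ := 1 + |B| with hK
  have hK1 : 1 ≤ K := by simp [hK]
  refine ⟨Real.exp (K * |τ|) / K, by positivity, fun μ g V ε hμ hV h0 hε hg x hx => ?_⟩
  have hbound : ∀ x ∈ Ico 0 τ,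
      ‖![V x 1, V x 2, (-μ - (q x : ℂ)) * V x 0 + (r x : ℂ) * V x 1 + g x]‖ ≤
        K * ‖V x‖ + ε := by
    intro x hx
    have hx' := Ico_subset_Icc_self hx
    have hle : ‖V x‖ ≤ K * ‖V x‖ := le_mul_of_one_le_left (norm_nonneg _) hK1
    have hi : ∀ i, ‖V x i‖ ≤ ‖V x‖ := norm_le_pi_norm (V x)
    rw [pi_norm_le_iff_of_nonneg (by positivity)]
    intro i
    fin_cases i
    · exact (hi 1).trans (by linarith)
    · exact (hi 2).trans (by linarith)
    · have hqr : ‖q x‖ + ‖r x‖ ≤ B := (Real.le_norm_self _).trans (hB x hx')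
      have h1 : ‖(-μ - (q x : ℂ)) * V x 0‖ ≤ (1 + ‖q x‖) * ‖V x‖ := by
        rw [norm_mul]
        gcongr
        · refine (norm_sub_le _ _).trans ?_
          rw [norm_neg, Complex.norm_real]
          gcongr
        · exact hi 0
      have h2 : ‖(r x : ℂ) * V x 1‖ ≤ ‖r x‖ * ‖V x‖ := by
        rw [norm_mul, Complex.norm_real]
        gcongr
        exact hi 1
      have h3 : (1 + ‖q x‖) * ‖V x‖ + ‖r x‖ * ‖V x‖ ≤ K * ‖V x‖ := by
        rw [← add_mul]
        gcongr
        linarith [le_abs_self B]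
      exact (norm_add₃_le).trans (by linarith [hg x hx'])
  have := norm_le_gronwallBound_of_norm_deriv_right_le (δ := 0) hV.continuous.continuousOn
    (fun x _ => (hV x).hasDerivWithinAt) (by simp [h0]) hbound x hx
  refine this.trans ?_
  rw [gronwallBound_of_K_ne_0 (by positivity)]
  have hexp : Real.exp (K * (x - 0)) ≤ Real.exp (K * |τ|) := by
    gcongr
    linarith [hx.2, le_abs_self τ]
  have : ε / K * (Real.exp (K * (x - 0)) - 1) ≤ ε / K * Real.exp (K * |τ|) := by
    gcongr
    linarith
  calc _ ≤ ε / K * Real.exp (K * |τ|) := by linarith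
    _ = _ := by ring

theorem isSpectralSolution_mulVec {q r : ℝ → ℝ} {μ : ℂ} {Φ : ℝ → Matrix (Fin 3) (Fin 3) ℂ}
    (hΦ : ∀ (x : ℝ) (i j : Fin 3), HasDerivAt (fun y => Φ y i j)
      ((!![0, 1, 0; 0, 0, 1; -μ - (q x : ℂ), (r x : ℂ), 0] * Φ x) i j) x) (A : Fin 3 → ℂ) :
    IsSpectralSolution q r μ 0 fun x => Φ x *ᵥ A := by
  intro x
  rw [hasDerivAt_pi]
  intro i
  have h : HasDerivAt (fun y => ∑ j, Φ y i j * A j)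
      (∑ j, (!![0, 1, 0; 0, 0, 1; -μ - (q x : ℂ), (r x : ℂ), 0] * Φ x) i j * A j) x :=
    HasDerivAt.fun_sum fun j _ => (hΦ x i j).mul_const (A j)
  refine h.congr_deriv ?_
  fin_cases i <;> simp [Matrix.mulVec, dotProduct, Matrix.mul_apply, Fin.sum_univ_three]; ring

/-- The increments over `[0, τ]` of `v′` and of the two boundary forms, as a linear map of the
Cauchy data increment. -/
def boundaryMatrix (k u₀ κ : ℂ) : Matrix (Fin 3) (Fin 3) ℂ :=
  !![0, 1, 0; k, 0, -1; u₀ * k - κ, 0, -u₀]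

theorem det_boundaryMatrix (k u₀ κ : ℂ) : (boundaryMatrix k u₀ κ).det = κ := by
  rw [boundaryMatrix, Matrix.det_fin_three]
  simp
  ring

theorem norm_integral_sub_le {τ δ B : ℝ} (hτ : 0 ≤ τ) (hB : 0 ≤ B) {φ y z : ℝ → ℂ}
    (hφ : Continuous φ) (hy : Continuous y) (hz : Continuous z)
    (hφB : ∀ x ∈ Icc 0 τ, ‖φ x‖ ≤ B) (h : ∀ x ∈ Icc 0 τ, ‖y x - z x‖ ≤ δ) :
    ‖(∫ x in (0 : ℝ)..τ, φ x * y x) - ∫ x in (0 : ℝ)..τ, φ x * z x‖ ≤ B * δ * τ := by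
  rw [← intervalIntegral.integral_sub
    (Continuous.intervalIntegrable (by fun_prop) _ _)
    (Continuous.intervalIntegrable (by fun_prop) _ _)]
  have := intervalIntegral.norm_integral_le_of_norm_le_const (a := 0) (b := τ) (C := B * δ)
    (f := fun x => φ x * y x - φ x * z x) fun x hx => by
      rw [uIoc_of_le hτ] at hx
      have hx' := Ioc_subset_Icc_self hx
      rw [← mul_sub, norm_mul]
      exact mul_le_mul (hφB x hx') (h x hx') (norm_nonneg _) hB
  simpa [abs_of_nonneg hτ] using this

/-- Period data of a profile `U` together with the monodromy family of its linearization. -/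
structure MonodromyData (q r U U₁ U₂ : ℝ → ℝ) (τ κ : ℝ)
    (Φ : ℂ → ℝ → Matrix (Fin 3) (Fin 3) ℂ) : Prop where
  pos : 0 < τ
  ne_zero : κ ≠ 0
  continuous_q : Continuous q
  hasDerivAt_r : ∀ x, HasDerivAt r (-q x) x
  hasDerivAt_U : ∀ x, HasDerivAt U (U₁ x) x
  hasDerivAt_U₁ : ∀ x, HasDerivAt U₁ (U₂ x) x
  hasDerivAt_U₂ : ∀ x, HasDerivAt U₂ (r x * U₁ x) x
  U_period : U τ = U 0
  r_period : r τ = r 0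
  U₁_zero : U₁ 0 = 0
  U₁_period : U₁ τ = 0
  U₂_zero : U₂ 0 = κ
  U₂_period : U₂ τ = κ
  Φ_zero : ∀ μ, Φ μ 0 = 1
  hasDerivAt_Φ : ∀ (μ : ℂ) (x : ℝ) (i j : Fin 3), HasDerivAt (fun y => Φ μ y i j)
      ((!![0, 1, 0; 0, 0, 1; -μ - (q x : ℂ), (r x : ℂ), 0] * Φ μ x) i j) x

namespace MonodromyData

variable {q r U U₁ U₂ : ℝ → ℝ} {τ κ : ℝ} {Φ : ℂ → ℝ → Matrix (Fin 3) (Fin 3) ℂ}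

theorem continuous_r (h : MonodromyData q r U U₁ U₂ τ κ Φ) : Continuous r :=
  continuous_iff_continuousAt.2 fun x => (h.hasDerivAt_r x).continuousAt

theorem continuous_U (h : MonodromyData q r U U₁ U₂ τ κ Φ) : Continuous U :=
  continuous_iff_continuousAt.2 fun x => (h.hasDerivAt_U x).continuousAt

theorem continuous_U₁ (h : MonodromyData q r U U₁ U₂ τ κ Φ) : Continuous U₁ :=
  continuous_iff_continuousAt.2 fun x => (h.hasDerivAt_U₁ x).continuousAt

/-- Boundary increments of the exact solution with the same initial data as an approximate
solution `V`. -/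
theorem exists_boundary_estimate (h : MonodromyData q r U U₁ U₂ τ κ Φ) :
    ∃ C, ∀ (μ : ℂ) (g : ℝ → ℂ) (V : ℝ → Fin 3 → ℂ) (ε : ℝ), ‖μ‖ ≤ 1 →
      IsSpectralSolution q r μ g V → 0 ≤ ε → (∀ x ∈ Icc 0 τ, ‖g x‖ ≤ ε) →
      ∃ I₀ I₁ I₂ : ℂ,
        boundaryMatrix (r 0) (U 0) κ *ᵥ ((Φ μ τ - 1) *ᵥ V 0) = ![I₀, μ * I₁, μ * I₂] ∧
        ‖I₀ - (V τ 1 - V 0 1)‖ ≤ C * ε ∧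
        ‖I₁ - ∫ x in (0 : ℝ)..τ, V x 0‖ ≤ C * ε ∧
        ‖I₂ - ∫ x in (0 : ℝ)..τ, (U x : ℂ) * V x 0‖ ≤ C * ε := by
  obtain ⟨C, hC0, hC⟩ := exists_norm_le_of_isSpectralSolution h.continuous_q h.continuous_r τ
  have hUc : Continuous fun x => (U x : ℂ) := Complex.continuous_ofReal.comp h.continuous_U
  obtain ⟨B', hB'⟩ := (isCompact_Icc (a := (0 : ℝ)) (b := τ)).exists_bound_of_continuousOn
    hUc.continuousOn
  set B := max B' 1 with hBdef
  have hB1 : 1 ≤ B := le_max_right _ _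
  have hB : ∀ x ∈ Icc 0 τ, ‖(U x : ℂ)‖ ≤ B := fun x hx => (hB' x hx).trans (le_max_left _ _)
  have hτ := h.pos
  refine ⟨C * (1 + B * τ), fun μ g V ε hμ hV hε hg => ?_⟩
  set y : ℝ → Fin 3 → ℂ := fun x => Φ μ x *ᵥ V 0 with hydef
  have hy : IsSpectralSolution q r μ 0 y := isSpectralSolution_mulVec (h.hasDerivAt_Φ μ) (V 0)
  have hy0 : y 0 = V 0 := by simp [hydef, h.Φ_zero]
  have hd : ∀ x ∈ Icc 0 τ, ‖y x - V x‖ ≤ C * ε :=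
    hC μ _ (fun x => y x - V x) ε hμ (hy.sub hV) (by simp [hy0]) hε (by simpa using hg)
  have hd0 : ∀ x ∈ Icc 0 τ, ‖y x 0 - V x 0‖ ≤ C * ε := fun x hx =>
    (norm_le_pi_norm (y x - V x) 0).trans (hd x hx)
  have hCε : 0 ≤ C * ε := by positivity
  refine ⟨y τ 1 - y 0 1, ∫ x in (0 : ℝ)..τ, y x 0, ∫ x in (0 : ℝ)..τ, (U x : ℂ) * y x 0,
    ?_, ?_, ?_, ?_⟩
  · have hsub : (Φ μ τ - 1) *ᵥ V 0 = y τ - y 0 := by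
      rw [hy0, Matrix.sub_mulVec, Matrix.one_mulVec]
    rw [hsub, hy.integral_eq h.hasDerivAt_r, hy.integral_mul_eq h.hasDerivAt_r h.hasDerivAt_U
      h.hasDerivAt_U₁ h.hasDerivAt_U₂, h.U_period, h.r_period, h.U₁_zero, h.U₁_period, h.U₂_zero,
      h.U₂_period]
    funext i
    fin_cases i <;>
      simp [boundaryMatrix, Matrix.mulVec, dotProduct, Fin.sum_univ_three] <;> ring
  · have h1 : y τ 1 - y 0 1 - (V τ 1 - V 0 1) = (y τ - V τ) 1 := by
      rw [hy0, Pi.sub_apply]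
      ring
    rw [h1]
    refine (norm_le_pi_norm (y τ - V τ) 1).trans ((hd τ ⟨hτ.le, le_rfl⟩).trans ?_)
    have : 0 ≤ C * ε * (B * τ) := by positivity
    linarith
  · have h1 := norm_integral_sub_le hτ.le (zero_le_one.trans hB1) (φ := fun _ => 1)
      continuous_const hy.continuous_zero hV.continuous_zero (fun x _ => by simpa using hB1) hd0
    simp only [one_mul] at h1
    linarith
  · have h1 := norm_integral_sub_le hτ.le (zero_le_one.trans hB1) hUc
      hy.continuous_zero hV.continuous_zero hB hd0
    linarith

end MonodromyData

theorem tendsto_of_norm_sub_le_mul {h : ℂ → ℂ} {L : ℂ} (C : ℝ)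
    (hC : ∀ μ, μ ≠ 0 → ‖μ‖ ≤ 1 → ‖h μ - L‖ ≤ C * ‖μ‖) : Tendsto h (𝓝[≠] 0) (𝓝 L) := by
  rw [tendsto_iff_norm_sub_tendsto_zero]
  have h0 : Tendsto (fun μ : ℂ => C * ‖μ‖) (𝓝[≠] 0) (𝓝 0) := by
    have : Continuous fun μ : ℂ => C * ‖μ‖ := by fun_prop
    simpa using (this.tendsto 0).mono_left nhdsWithin_le_nhds
  refine squeeze_zero' (.of_forall fun _ => norm_nonneg _) ?_ h0
  filter_upwards [self_mem_nhdsWithin,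
    mem_nhdsWithin_of_mem_nhds (Metric.closedBall_mem_nhds (0 : ℂ) one_pos)] with μ hμ hμ1
  exact hC μ hμ (by simpa using hμ1)

namespace MonodromyData

variable {q r U U₁ U₂ : ℝ → ℝ} {τ κ : ℝ} {Φ : ℂ → ℝ → Matrix (Fin 3) (Fin 3) ℂ}

/-- Boundary increments along a solution of the equation at `μ = 0`. -/
theorem tendsto_boundary (h : MonodromyData q r U U₁ U₂ τ κ Φ) {v w : ℝ → ℝ} {α : ℝ}
    (hv : ∀ x, HasDerivAt v (w x) x) (hw : ∀ x, HasDerivAt w (α + r x * v x) x) (hw0 : w 0 = 0)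
    {N : ℂ → Fin 3 → ℂ} (hN : ∀ μ, N μ = boundaryMatrix (r 0) (U 0) κ *ᵥ
      ((Φ μ τ - 1) *ᵥ ![(v 0 : ℂ), 0, α + r 0 * v 0])) :
    Tendsto (fun μ => N μ 0) (𝓝[≠] 0) (𝓝 (w τ : ℂ)) ∧
    Tendsto (fun μ => N μ 1 / μ) (𝓝[≠] 0) (𝓝 ((∫ x in (0 : ℝ)..τ, v x : ℝ) : ℂ)) ∧
    Tendsto (fun μ => N μ 2 / μ) (𝓝[≠] 0) (𝓝 ((∫ x in (0 : ℝ)..τ, U x * v x : ℝ) : ℂ)) := by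
  obtain ⟨C, hC⟩ := h.exists_boundary_estimate
  have hvc : Continuous v := continuous_iff_continuousAt.2 fun x => (hv x).continuousAt
  obtain ⟨B', hB'⟩ := (isCompact_Icc (a := (0 : ℝ)) (b := τ)).exists_bound_of_continuousOn
    hvc.continuousOn
  have hB : ∀ x ∈ Icc 0 τ, ‖v x‖ ≤ |B'| := fun x hx => (hB' x hx).trans (le_abs_self _)
  have hV : ∀ μ : ℂ, IsSpectralSolution q r μ (fun x => μ * v x)
      (fun x => ![(v x : ℂ), w x, α + r x * v x]) := by
    refine fun μ => isSpectralSolution_of_components (fun x => (hv x).ofReal_comp)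
      (fun x => ?_) (fun x => ?_)
    · simpa using (hw x).ofReal_comp
    · have := (((h.hasDerivAt_r x).mul (hv x)).const_add α).ofReal_comp
      simp only [Pi.mul_apply, Complex.ofReal_add, Complex.ofReal_mul, Complex.ofReal_neg] at this
      refine this.congr_deriv ?_
      ring
  have main : ∀ μ : ℂ, μ ≠ 0 → ‖μ‖ ≤ 1 → ‖N μ 0 - w τ‖ ≤ C * |B'| * ‖μ‖ ∧
      ‖N μ 1 / μ - (∫ x in (0 : ℝ)..τ, v x : ℝ)‖ ≤ C * |B'| * ‖μ‖ ∧
      ‖N μ 2 / μ - (∫ x in (0 : ℝ)..τ, U x * v x : ℝ)‖ ≤ C * |B'| * ‖μ‖ := by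
    intro μ hμ hμ1
    obtain ⟨I₀, I₁, I₂, hI, h0, h1, h2⟩ := hC μ _ _ (|B'| * ‖μ‖) hμ1 (hV μ) (by positivity) (by
      intro x hx
      rw [norm_mul, Complex.norm_real, mul_comm]
      gcongr
      exact hB x hx)
    simp only [hw0, Complex.ofReal_zero] at hI
    simp only [cons_val_zero, cons_val_one, hw0, Complex.ofReal_zero, sub_zero,
      ← Complex.ofReal_mul, intervalIntegral.integral_ofReal] at h0 h1 h2
    rw [hN, hI]
    simp only [cons_val_zero, cons_val_one, cons_val, mul_div_cancel_left₀ _ hμ, mul_assoc]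
    exact ⟨h0, h1, h2⟩
  exact ⟨tendsto_of_norm_sub_le_mul _ fun μ hμ hμ1 => (main μ hμ hμ1).1,
    tendsto_of_norm_sub_le_mul _ fun μ hμ hμ1 => (main μ hμ hμ1).2.1,
    tendsto_of_norm_sub_le_mul _ fun μ hμ hμ1 => (main μ hμ hμ1).2.2⟩

/-- Boundary increments along the first-order corrected translation mode `U′ - μ v`. -/
theorem tendsto_boundary_translation (h : MonodromyData q r U U₁ U₂ τ κ Φ) {v w : ℝ → ℝ}
    (hv : ∀ x, HasDerivAt v (w x) x) (hw : ∀ x, HasDerivAt w (r x * v x + U x) x) (hw0 : w 0 = 0)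
    {N : ℂ → Fin 3 → ℂ} (hN : ∀ μ, N μ = boundaryMatrix (r 0) (U 0) κ *ᵥ
      ((Φ μ τ - 1) *ᵥ ![-(μ * v 0), (κ : ℂ), -(μ * (r 0 * v 0 + U 0))])) :
    Tendsto (fun μ => N μ 0 / μ) (𝓝[≠] 0) (𝓝 (-(w τ : ℂ))) ∧
    Tendsto (fun μ => N μ 1 / μ ^ 2) (𝓝[≠] 0) (𝓝 (-((∫ x in (0 : ℝ)..τ, v x : ℝ) : ℂ))) ∧
    Tendsto (fun μ => N μ 2 / μ ^ 2) (𝓝[≠] 0)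
      (𝓝 (-((∫ x in (0 : ℝ)..τ, U x * v x : ℝ) : ℂ))) := by
  obtain ⟨C, hC⟩ := h.exists_boundary_estimate
  have hvc : Continuous v := continuous_iff_continuousAt.2 fun x => (hv x).continuousAt
  have hUc := h.continuous_U
  have hU₁c := h.continuous_U₁
  obtain ⟨B', hB'⟩ := (isCompact_Icc (a := (0 : ℝ)) (b := τ)).exists_bound_of_continuousOn
    hvc.continuousOn
  have hB : ∀ x ∈ Icc 0 τ, ‖v x‖ ≤ |B'| := fun x hx => (hB' x hx).trans (le_abs_self _)
  have hV : ∀ μ : ℂ, IsSpectralSolution q r μ (fun x => -(μ ^ 2 * v x))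
      (fun x => ![(U₁ x : ℂ) - μ * v x, U₂ x - μ * w x,
        r x * U₁ x - μ * (r x * v x + U x)]) := by
    refine fun μ => isSpectralSolution_of_components
      (fun x => (h.hasDerivAt_U₁ x).ofReal_comp.sub ((hv x).ofReal_comp.const_mul μ))
      (fun x => ?_) (fun x => ?_)
    · refine ((h.hasDerivAt_U₂ x).ofReal_comp.sub ((hw x).ofReal_comp.const_mul μ)).congr_deriv ?_
      push_cast
      rfl
    · have := ((h.hasDerivAt_r x).ofReal_comp.mul (h.hasDerivAt_U₁ x).ofReal_comp).sub
        ((((h.hasDerivAt_r x).ofReal_comp.mul (hv x).ofReal_comp).add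
          (h.hasDerivAt_U x).ofReal_comp).const_mul μ)
      refine this.congr_deriv ?_
      push_cast
      ring
  have hint0 : ∀ μ : ℂ, ∫ x in (0 : ℝ)..τ, ((U₁ x : ℂ) - μ * v x) =
      -(μ * (∫ x in (0 : ℝ)..τ, v x : ℝ)) := by
    intro μ
    rw [intervalIntegral.integral_sub (Continuous.intervalIntegrable (by fun_prop) _ _)
      (Continuous.intervalIntegrable (by fun_prop) _ _), intervalIntegral.integral_const_mul,
      intervalIntegral.integral_ofReal, intervalIntegral.integral_ofReal,
      intervalIntegral.integral_eq_sub_of_hasDerivAt (fun x _ => h.hasDerivAt_U x)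
        (hU₁c.intervalIntegrable _ _), h.U_period]
    simp
  have hint1 : ∀ μ : ℂ, ∫ x in (0 : ℝ)..τ, (U x : ℂ) * ((U₁ x : ℂ) - μ * v x) =
      -(μ * (∫ x in (0 : ℝ)..τ, U x * v x : ℝ)) := by
    intro μ
    have hsq : ∀ x, HasDerivAt (fun x => U x ^ 2 / 2) (U x * U₁ x) x := fun x => by
      refine (((h.hasDerivAt_U x).pow 2).div_const 2).congr_deriv ?_
      push_cast
      ring
    have hsplit : ∀ x, (U x : ℂ) * ((U₁ x : ℂ) - μ * v x) =
        ((U x * U₁ x : ℝ) : ℂ) - μ * ((U x * v x : ℝ) : ℂ) := fun x => by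
      push_cast
      ring
    simp only [hsplit]
    rw [intervalIntegral.integral_sub (Continuous.intervalIntegrable (by fun_prop) _ _)
      (Continuous.intervalIntegrable (by fun_prop) _ _), intervalIntegral.integral_const_mul,
      intervalIntegral.integral_ofReal, intervalIntegral.integral_ofReal,
      intervalIntegral.integral_eq_sub_of_hasDerivAt (fun x _ => hsq x)
        ((hUc.mul hU₁c).intervalIntegrable _ _), h.U_period]
    simp
  have main : ∀ μ : ℂ, μ ≠ 0 → ‖μ‖ ≤ 1 → ‖N μ 0 / μ - -(w τ : ℂ)‖ ≤ C * |B'| * ‖μ‖ ∧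
      ‖N μ 1 / μ ^ 2 - -((∫ x in (0 : ℝ)..τ, v x : ℝ) : ℂ)‖ ≤ C * |B'| * ‖μ‖ ∧
      ‖N μ 2 / μ ^ 2 - -((∫ x in (0 : ℝ)..τ, U x * v x : ℝ) : ℂ)‖ ≤ C * |B'| * ‖μ‖ := by
    intro μ hμ hμ1
    obtain ⟨I₀, I₁, I₂, hI, h0, h1, h2⟩ := hC μ _ _ (|B'| * ‖μ‖ ^ 2) hμ1 (hV μ)
      (by positivity) (by
        intro x hx
        rw [norm_neg, norm_mul, norm_pow, Complex.norm_real, mul_comm]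
        gcongr
        exact hB x hx)
    simp only [hw0, h.U₁_zero, h.U₂_zero, Complex.ofReal_zero, mul_zero, sub_zero, zero_sub] at hI
    simp only [cons_val_zero, cons_val_one, hw0, h.U₂_zero, h.U₂_period, Complex.ofReal_zero,
      mul_zero, sub_zero, hint0, hint1] at h0 h1 h2
    rw [hN, hI]
    have hdiv : ∀ I L : ℂ, ‖I - -(μ * L)‖ ≤ C * (|B'| * ‖μ‖ ^ 2) →
        ‖I / μ - -L‖ ≤ C * |B'| * ‖μ‖ := by
      intro I L hIL
      have hn : 0 < ‖μ‖ := norm_pos_iff.2 hμ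
      have : I / μ - -L = (I - -(μ * L)) / μ := by field_simp
      rw [this, norm_div, div_le_iff₀ hn]
      linarith
    have hsq : ∀ I : ℂ, μ * I / μ ^ 2 = I / μ := fun I => by field_simp
    simp only [cons_val_zero, cons_val_one, cons_val, hsq]
    refine ⟨hdiv _ _ ?_, hdiv _ _ h1, hdiv _ _ h2⟩
    have : (κ : ℂ) - μ * w τ - κ = -(μ * w τ) := by ring
    rwa [this] at h0
  exact ⟨tendsto_of_norm_sub_le_mul _ fun μ hμ hμ1 => (main μ hμ hμ1).1,
    tendsto_of_norm_sub_le_mul _ fun μ hμ hμ1 => (main μ hμ hμ1).2.1,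
    tendsto_of_norm_sub_le_mul _ fun μ hμ hμ1 => (main μ hμ hμ1).2.2⟩

/-- Leading order of `det (Φ(τ; μ) - 1)` as `μ → 0`, in terms of the three variations. -/
theorem tendsto_det_div (h : MonodromyData q r U U₁ U₂ τ κ Φ) {va wa vE wE vc wc : ℝ → ℝ}
    (hva : ∀ x, HasDerivAt va (wa x) x) (hwa : ∀ x, HasDerivAt wa (1 + r x * va x) x)
    (hvE : ∀ x, HasDerivAt vE (wE x) x) (hwE : ∀ x, HasDerivAt wE (r x * vE x) x)
    (hvc : ∀ x, HasDerivAt vc (wc x) x) (hwc : ∀ x, HasDerivAt wc (r x * vc x + U x) x)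
    (hwa0 : wa 0 = 0) (hwE0 : wE 0 = 0) (hwc0 : wc 0 = 0) (hvE0 : κ * vE 0 = -1) :
    Tendsto (fun μ => (Φ μ τ - 1).det / μ ^ 3) (𝓝[≠] 0)
      (𝓝 ((κ⁻¹ * Matrix.det !![-wc τ, wE τ, wa τ;
        -∫ x in (0 : ℝ)..τ, vc x, ∫ x in (0 : ℝ)..τ, vE x, ∫ x in (0 : ℝ)..τ, va x;
        -∫ x in (0 : ℝ)..τ, U x * vc x, ∫ x in (0 : ℝ)..τ, U x * vE x,
          ∫ x in (0 : ℝ)..τ, U x * va x] : ℝ) : ℂ)) := by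
  set R := boundaryMatrix (r 0) (U 0) κ with hR
  set Nc : ℂ → Fin 3 → ℂ := fun μ => R *ᵥ
    ((Φ μ τ - 1) *ᵥ ![-(μ * vc 0), (κ : ℂ), -(μ * (r 0 * vc 0 + U 0))]) with hNc
  set NE : ℂ → Fin 3 → ℂ := fun μ => R *ᵥ
    ((Φ μ τ - 1) *ᵥ ![(vE 0 : ℂ), 0, (0 : ℝ) + r 0 * vE 0]) with hNE
  set Na : ℂ → Fin 3 → ℂ := fun μ => R *ᵥ
    ((Φ μ τ - 1) *ᵥ ![(va 0 : ℂ), 0, (1 : ℝ) + r 0 * va 0]) with hNa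
  obtain ⟨c0, c1, c2⟩ := h.tendsto_boundary_translation hvc hwc hwc0 (N := Nc) fun _ => rfl
  obtain ⟨e0, e1, e2⟩ := h.tendsto_boundary hvE (α := 0) (by simpa using hwE) hwE0 (N := NE)
    fun _ => rfl
  obtain ⟨a0, a1, a2⟩ := h.tendsto_boundary hva hwa hwa0 (N := Na) fun _ => rfl
  have hκ : (κ : ℂ) ≠ 0 := Complex.ofReal_ne_zero.2 h.ne_zero
  set S : ℂ → Matrix (Fin 3) (Fin 3) ℂ := fun μ => !![Nc μ 0 / μ, NE μ 0, Na μ 0;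
    Nc μ 1 / μ ^ 2, NE μ 1 / μ, Na μ 1 / μ; Nc μ 2 / μ ^ 2, NE μ 2 / μ, Na μ 2 / μ] with hS
  have hdet : ∀ μ : ℂ, μ ≠ 0 → (Φ μ τ - 1).det / μ ^ 3 = (κ : ℂ)⁻¹ * (S μ).det := by
    intro μ hμ
    set Y : Matrix (Fin 3) (Fin 3) ℂ := !![-(μ * vc 0), vE 0, va 0; (κ : ℂ), 0, 0;
      -(μ * (r 0 * vc 0 + U 0)), (0 : ℝ) + r 0 * vE 0, (1 : ℝ) + r 0 * va 0] with hY
    have hYdet : Y.det = 1 := by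
      have hE : (κ : ℂ) * vE 0 = -1 := by exact_mod_cast hvE0
      rw [hY, Matrix.det_fin_three]
      simp
      linear_combination -hE
    have hprod : R * ((Φ μ τ - 1) * Y) = !![Nc μ 0, NE μ 0, Na μ 0;
        Nc μ 1, NE μ 1, Na μ 1; Nc μ 2, NE μ 2, Na μ 2] := by
      ext i j
      fin_cases i <;> fin_cases j <;>
        simp [hNc, hNE, hNa, hY, Matrix.mulVec, dotProduct, Matrix.mul_apply, Fin.sum_univ_three] <;>
        ring
    have hd : (κ : ℂ) * (Φ μ τ - 1).det = (!![Nc μ 0, NE μ 0, Na μ 0;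
        Nc μ 1, NE μ 1, Na μ 1; Nc μ 2, NE μ 2, Na μ 2] : Matrix (Fin 3) (Fin 3) ℂ).det := by
      rw [← hprod, Matrix.det_mul, Matrix.det_mul, hYdet, hR, det_boundaryMatrix, mul_one]
    have hd' : (Φ μ τ - 1).det = (κ : ℂ)⁻¹ * (!![Nc μ 0, NE μ 0, Na μ 0;
        Nc μ 1, NE μ 1, Na μ 1; Nc μ 2, NE μ 2, Na μ 2] : Matrix (Fin 3) (Fin 3) ℂ).det := by
      rw [← hd, inv_mul_cancel_left₀ hκ]
    rw [hd', hS, Matrix.det_fin_three, Matrix.det_fin_three]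
    simp only [of_apply, cons_val', cons_val_zero, cons_val_one, cons_val]
    field_simp
  have hlim : Tendsto S (𝓝[≠] 0) (𝓝 ((!![-wc τ, wE τ, wa τ;
        -∫ x in (0 : ℝ)..τ, vc x, ∫ x in (0 : ℝ)..τ, vE x, ∫ x in (0 : ℝ)..τ, va x;
        -∫ x in (0 : ℝ)..τ, U x * vc x, ∫ x in (0 : ℝ)..τ, U x * vE x,
          ∫ x in (0 : ℝ)..τ, U x * va x] : Matrix (Fin 3) (Fin 3) ℝ).map Complex.ofReal)) := by
    refine tendsto_pi_nhds.2 fun i => tendsto_pi_nhds.2 fun j => ?_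
    fin_cases i <;> fin_cases j
    · simpa [hS] using c0
    · simpa [hS] using e0
    · simpa [hS] using a0
    · simpa [hS] using c1
    · simpa [hS] using e1
    · simpa [hS] using a1
    · simpa [hS] using c2
    · simpa [hS] using e2
    · simpa [hS] using a2
  have hcd : Continuous fun A : Matrix (Fin 3) (Fin 3) ℂ => (κ : ℂ)⁻¹ * A.det :=
    continuous_const.mul continuous_id.matrix_det
  have := (hcd.tendsto _).comp hlim
  rw [Complex.ofReal_mul, Complex.ofReal_inv]
  have hmap := RingHom.map_det Complex.ofRealHom (!![-wc τ, wE τ, wa τ;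
        -∫ x in (0 : ℝ)..τ, vc x, ∫ x in (0 : ℝ)..τ, vE x, ∫ x in (0 : ℝ)..τ, va x;
        -∫ x in (0 : ℝ)..τ, U x * vc x, ∫ x in (0 : ℝ)..τ, U x * vE x,
          ∫ x in (0 : ℝ)..τ, U x * va x] : Matrix (Fin 3) (Fin 3) ℝ)
  rw [Complex.ofRealHom_eq_coe] at hmap
  rw [hmap]
  refine this.congr' ?_
  filter_upwards [self_mem_nhdsWithin] with μ hμ using (hdet μ hμ).symm

end MonodromyData

/-- An analytic function with `f μ / μ ^ 3 → L` has a zero of order three with `f‴(0) = 6 L`. -/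
theorem iteratedDeriv_of_tendsto_div_pow_three {f : ℂ → ℂ} {L : ℂ} (hf : AnalyticAt ℂ f 0)
    (hL : Tendsto (fun μ => f μ / μ ^ 3) (𝓝[≠] 0) (𝓝 L)) :
    f 0 = 0 ∧ deriv f 0 = 0 ∧ iteratedDeriv 2 f 0 = 0 ∧ iteratedDeriv 3 f 0 = 6 * L := by
  have hO := hf.hasFPowerSeriesAt.isBigO_sub_partialSum_pow 4
  set c : ℕ → ℂ := fun n => iteratedDeriv n f 0 / n.factorial with hc
  have hpoly : (fun y => f (0 + y) -
      (FormalMultilinearSeries.ofScalars ℂ c).partialSum 4 y) =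
      fun y => f y - (c 0 + c 1 * y + c 2 * y ^ 2 + c 3 * y ^ 3) := by
    funext y
    simp [FormalMultilinearSeries.partialSum, Finset.sum_range_succ]
    ring
  rw [hpoly] at hO
  have ho : Tendsto (fun y => (f y - (c 0 + c 1 * y + c 2 * y ^ 2 + c 3 * y ^ 3)) / y ^ 3)
      (𝓝[≠] 0) (𝓝 0) := by
    have h1 : (fun y : ℂ => ‖y‖ ^ 4) =o[𝓝 0] fun y : ℂ => y ^ 3 := by
      have := (Asymptotics.isLittleO_pow_pow (𝕜 := ℂ) (m := 3) (n := 4) (by norm_num)).norm_left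
      simpa using this
    exact (hO.trans_isLittleO h1).tendsto_div_nhds_zero.mono_left nhdsWithin_le_nhds
  have hP : Tendsto (fun y => (c 0 + c 1 * y + c 2 * y ^ 2 + c 3 * y ^ 3) / y ^ 3)
      (𝓝[≠] 0) (𝓝 L) := by
    have := hL.sub ho
    rw [sub_zero] at this
    exact this.congr fun y => by ring
  have hpow : ∀ k, k ≠ 0 → Tendsto (fun y : ℂ => y ^ k) (𝓝[≠] 0) (𝓝 0) := fun k hk => by
    have : Continuous fun y : ℂ => y ^ k := by fun_prop
    simpa [hk] using (this.tendsto 0).mono_left nhdsWithin_le_nhds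
  have hpol : ∀ a b d e : ℂ,
      Tendsto (fun y : ℂ => a + b * y + d * y ^ 2 + e * y ^ 3) (𝓝[≠] 0) (𝓝 a) := fun a b d e => by
    have : Continuous fun y : ℂ => a + b * y + d * y ^ 2 + e * y ^ 3 := by fun_prop
    simpa using (this.tendsto 0).mono_left nhdsWithin_le_nhds
  have hc0 : c 0 = 0 := by
    refine tendsto_nhds_unique (hpol (c 0) (c 1) (c 2) (c 3)) ?_
    have h := hP.mul (hpow 3 (by norm_num))
    rw [mul_zero] at h
    refine h.congr' ?_
    filter_upwards [self_mem_nhdsWithin] with y (hy : y ≠ 0)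
    field_simp
  have hc1 : c 1 = 0 := by
    refine tendsto_nhds_unique (hpol (c 1) (c 2) (c 3) 0) ?_
    have h := hP.mul (hpow 2 (by norm_num))
    rw [mul_zero] at h
    refine h.congr' ?_
    filter_upwards [self_mem_nhdsWithin] with y (hy : y ≠ 0)
    rw [hc0]
    field_simp
    ring
  have hc2 : c 2 = 0 := by
    refine tendsto_nhds_unique (hpol (c 2) (c 3) 0 0) ?_
    have h := hP.mul (hpow 1 (by norm_num))
    rw [mul_zero] at h
    refine h.congr' ?_
    filter_upwards [self_mem_nhdsWithin] with y (hy : y ≠ 0)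
    rw [hc0, hc1]
    field_simp
    ring
  have hc3 : c 3 = L := by
    refine tendsto_nhds_unique (hpol (c 3) 0 0 0) (hP.congr' ?_)
    filter_upwards [self_mem_nhdsWithin] with y (hy : y ≠ 0)
    rw [hc0, hc1, hc2]
    field_simp
    ring
  refine ⟨by simpa [hc] using hc0, by simpa [hc] using hc1, by simpa [hc] using hc2, ?_⟩
  rw [← hc3, hc]
  simp [Nat.factorial]
  field_simp

theorem monodromyData_family {f : ℝ → ℝ} (hf : ContDiff ℝ 2 f) {D : Set (ℝ × ℝ × ℝ)}
    (hD : IsOpen D) {u : ℝ × ℝ × ℝ → ℝ → ℝ}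
    (hu : ContDiffOn ℝ 2 (fun q : (ℝ × ℝ × ℝ) × ℝ => u q.1 q.2) (D ×ˢ (univ : Set ℝ)))
    (hODE : ∀ p ∈ D, ∀ x : ℝ, deriv (deriv (u p)) x + f (u p x) - p.2.2 * u p x = p.1)
    {p : ℝ × ℝ × ℝ} (hp : p ∈ D) {τ : ℝ} (hτ : 0 < τ) (hper : ∀ x, u p (x + τ) = u p x)
    (h0 : deriv (u p) 0 = 0) (hκ : p.1 - f (u p 0) + p.2.2 * u p 0 ≠ 0)
    {Φ : ℂ → ℝ → Matrix (Fin 3) (Fin 3) ℂ} (hΦ0 : ∀ μ, Φ μ 0 = 1)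
    (hΦ : ∀ (μ : ℂ) (x : ℝ) (i j : Fin 3), HasDerivAt (fun y => Φ μ y i j)
      ((!![0, 1, 0; 0, 0, 1; -μ - ((deriv (deriv f) (u p x) * deriv (u p) x : ℝ) : ℂ),
        ((p.2.2 - deriv f (u p x) : ℝ) : ℂ), 0] * Φ μ x) i j) x) :
    MonodromyData (fun x => deriv (deriv f) (u p x) * deriv (u p) x)
      (fun x => p.2.2 - deriv f (u p x)) (u p) (deriv (u p))
      (fun x => p.1 - f (u p x) + p.2.2 * u p x) τ (p.1 - f (u p 0) + p.2.2 * u p 0) Φ := by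
  have hU : ∀ x, HasDerivAt (u p) (deriv (u p) x) x :=
    hasDerivAt_family_space hD (hu.of_le (by norm_num)) hp
  have hU₁ : ∀ x, HasDerivAt (deriv (u p)) (deriv (deriv (u p)) x) x :=
    hasDerivAt_family_space (w := fun p => deriv (u p)) hD (contDiffOn_deriv_family hD hu) hp
  have hUc : Continuous (u p) := continuous_iff_continuousAt.2 fun x => (hU x).continuousAt
  have hU₁c : Continuous (deriv (u p)) :=
    continuous_iff_continuousAt.2 fun x => (hU₁ x).continuousAt
  have hf1 : ContDiff ℝ 1 (deriv f) := ((contDiff_succ_iff_deriv (n := 1)).1 hf).2.2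
  have hfd : ∀ y, HasDerivAt f (deriv f y) y := fun y =>
    (hf.differentiable two_ne_zero y).hasDerivAt
  have hfd' : ∀ y, HasDerivAt (deriv f) (deriv (deriv f) y) y := fun y =>
    (hf1.differentiable one_ne_zero y).hasDerivAt
  have hτ0 : u p τ = u p 0 := by simpa using hper 0
  exact {
    pos := hτ
    ne_zero := hκ
    continuous_q := ((hf1.continuous_deriv le_rfl).comp hUc).mul hU₁c
    hasDerivAt_r := fun x => ((hfd' _).comp x (hU x)).const_sub _
    hasDerivAt_U := hU
    hasDerivAt_U₁ := fun x => (hU₁ x).congr_deriv (by linarith [hODE p hp x])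
    hasDerivAt_U₂ := fun x => ((((hfd _).comp x (hU x)).const_sub p.1).add
      ((hU x).const_mul p.2.2)).congr_deriv (by ring)
    U_period := hτ0
    r_period := by simp only [hτ0]
    U₁_zero := h0
    U₁_period := by simpa [h0] using deriv_add_period hper 0
    U₂_zero := rfl
    U₂_period := by simp only [hτ0]
    Φ_zero := hΦ0
    hasDerivAt_Φ := hΦ }

theorem deriv_slices_eq_fderiv {R : ℝ × ℝ × ℝ → ℝ} {p : ℝ × ℝ × ℝ} (hR : DifferentiableAt ℝ R p) :
    deriv (fun a => R (a, p.2.1, p.2.2)) p.1 = fderiv ℝ R p (1, 0, 0) ∧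
    deriv (fun E => R (p.1, E, p.2.2)) p.2.1 = fderiv ℝ R p (0, 1, 0) ∧
    deriv (fun c => R (p.1, p.2.1, c)) p.2.2 = fderiv ℝ R p (0, 0, 1) := by
  have h : HasFDerivAt R (fderiv ℝ R p) (p.1, p.2.1, p.2.2) := hR.hasFDerivAt
  refine ⟨?_, ?_, ?_⟩
  · exact (h.comp_hasDerivAt p.1 ((hasDerivAt_id p.1).prodMk
      (hasDerivAt_const p.1 (p.2.1, p.2.2)))).deriv
  · exact (h.comp_hasDerivAt p.2.1 ((hasDerivAt_const p.2.1 p.1).prodMk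
      ((hasDerivAt_id p.2.1).prodMk (hasDerivAt_const p.2.1 p.2.2)))).deriv
  · exact (h.comp_hasDerivAt p.2.2 ((hasDerivAt_const p.2.2 p.1).prodMk
      ((hasDerivAt_const p.2.2 p.2.1).prodMk (hasDerivAt_id p.2.2)))).deriv

theorem analyticAt_det_sub_one {A : ℂ → Matrix (Fin 3) (Fin 3) ℂ} {z : ℂ}
    (hA : ∀ i j, AnalyticAt ℂ (fun μ => A μ i j) z) :
    AnalyticAt ℂ (fun μ => (A μ - 1).det) z := by
  have h : ∀ i j, AnalyticAt ℂ (fun μ => (A μ - 1) i j) z := fun i j =>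
    (hA i j).sub analyticAt_const
  simp only [Matrix.det_fin_three]
  have h' := fun i j k l m n => ((h i j).mul (h k l)).mul (h m n)
  exact (((((h' _ _ _ _ _ _).sub (h' _ _ _ _ _ _)).sub (h' _ _ _ _ _ _)).add
    (h' _ _ _ _ _ _)).add (h' _ _ _ _ _ _)).sub (h' _ _ _ _ _ _)

theorem inv_mul_det_variations {κ : ℝ} (hκ : κ ≠ 0) (y Ta TE Tc a₁ a₂ e₁ e₂ c₁ c₂ : ℝ) :
    6 * (κ⁻¹ * Matrix.det !![-(-κ * Tc), -κ * TE, -κ * Ta; -c₁, e₁, a₁; -c₂, e₂, a₂]) =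
      -3 * Matrix.det !![Ta, y * Ta + a₁, y ^ 2 * Ta + 2 * a₂;
        TE, y * TE + e₁, y ^ 2 * TE + 2 * e₂; Tc, y * Tc + c₁, y ^ 2 * Tc + 2 * c₂] := by
  simp only [Matrix.det_fin_three, of_apply, cons_val', cons_val_zero, cons_val_one, cons_val]
  field_simp
  ring

/-- The periodic Evans function `d(μ) = det(Φ(T; μ) - I)` at Floquet multiplier `1`, for
the monodromy `Φ` of the linearized gKdV spectral problem about a periodic traveling
wave `u(·; a, E, c)` (solving `u″ + f(u) - cu = a` with energy `E`, turning-point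
initial data, period `T`, mass `M` and momentum `P`), vanishes to third order at
`μ = 0` with `d‴(0) = -3 det J`, where `J` is the Jacobian of `(T, M, P)` with respect
to `(a, E, c)`.  Parameters: `p = (a, E, c)` with `a = p.1`, `E = p.2.1`, `c = p.2.2`. -/
theorem stmt_17 (f F : ℝ → ℝ) (hf : ContDiff ℝ 2 f)
    (hF : ∀ x : ℝ, HasDerivAt F (f x) x)
    (D : Set (ℝ × ℝ × ℝ)) (hD : IsOpen D)
    (u : ℝ × ℝ × ℝ → ℝ → ℝ)
    (hu : ContDiffOn ℝ 2 (fun q : (ℝ × ℝ × ℝ) × ℝ => u q.1 q.2)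
      (D ×ˢ (univ : Set ℝ)))
    (hODE : ∀ p ∈ D, ∀ x : ℝ,
      deriv (deriv (u p)) x + f (u p x) - p.2.2 * u p x = p.1)
    (hEn : ∀ p ∈ D, ∀ x : ℝ,
      1 / 2 * (deriv (u p) x) ^ 2 + F (u p x) - p.2.2 / 2 * (u p x) ^ 2
        - p.1 * u p x = p.2.1)
    (hturn : ∀ p ∈ D,
      deriv (u p) 0 = 0 ∧ f (u p 0) - p.2.2 * u p 0 - p.1 < 0)
    (T M P : ℝ × ℝ × ℝ → ℝ)
    (hTpos : ∀ p ∈ D, 0 < T p)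
    (hper : ∀ p ∈ D, ∀ x : ℝ, u p (x + T p) = u p x)
    (hM : ∀ p ∈ D, M p = ∫ x in (0 : ℝ)..T p, u p x)
    (hP : ∀ p ∈ D, P p = ∫ x in (0 : ℝ)..T p, (u p x) ^ 2)
    (hTc : ContDiffOn ℝ 1 T D) (hMc : ContDiffOn ℝ 1 M D)
    (hPc : ContDiffOn ℝ 1 P D)
    (Φ : ℝ × ℝ × ℝ → ℂ → ℝ → Matrix (Fin 3) (Fin 3) ℂ)
    (hΦ0 : ∀ p ∈ D, ∀ μ : ℂ, Φ p μ 0 = 1)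
    (hΦ : ∀ p ∈ D, ∀ (μ : ℂ) (x : ℝ) (i j : Fin 3),
      HasDerivAt (fun y => Φ p μ y i j)
        ((!![0, 1, 0;
             0, 0, 1;
             -μ - ((deriv (deriv f) (u p x) * deriv (u p) x : ℝ) : ℂ),
               ((p.2.2 - deriv f (u p x) : ℝ) : ℂ), 0] * Φ p μ x) i j) x)
    (hana : ∀ p ∈ D, ∀ (x : ℝ) (i j : Fin 3),
      AnalyticAt ℂ (fun μ => Φ p μ x i j) 0) :
    ∀ p ∈ D,
      (Φ p 0 (T p) - 1).det = 0 ∧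
      deriv (fun μ => (Φ p μ (T p) - 1).det) 0 = 0 ∧
      iteratedDeriv 2 (fun μ => (Φ p μ (T p) - 1).det) 0 = 0 ∧
      iteratedDeriv 3 (fun μ => (Φ p μ (T p) - 1).det) 0 =
        -3 * ((Matrix.det
          !![deriv (fun a => T (a, p.2.1, p.2.2)) p.1,
               deriv (fun a => M (a, p.2.1, p.2.2)) p.1,
               deriv (fun a => P (a, p.2.1, p.2.2)) p.1;
             deriv (fun E => T (p.1, E, p.2.2)) p.2.1,
               deriv (fun E => M (p.1, E, p.2.2)) p.2.1,
               deriv (fun E => P (p.1, E, p.2.2)) p.2.1;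
             deriv (fun c => T (p.1, p.2.1, c)) p.2.2,
               deriv (fun c => M (p.1, p.2.1, c)) p.2.2,
               deriv (fun c => P (p.1, p.2.1, c)) p.2.2] : ℝ) : ℂ) := by
  intro p hp
  have hκ : p.1 - f (u p 0) + p.2.2 * u p 0 ≠ 0 := ne_of_gt (by linarith [(hturn p hp).2])
  have hvar := exists_variation hf hF hD hu hODE hEn (fun p hp => (hturn p hp).1) hper hM hP
    hTc hMc hPc hp
  obtain ⟨va, wa, hva, hwa, -, hwa0, hTa, hMa, hPa⟩ := hvar (1, 0, 0)
  obtain ⟨vE, wE, hvE, hwE, hvE0, hwE0, hTE, hME, hPE⟩ := hvar (0, 1, 0)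
  obtain ⟨vc, wc, hvc, hwc, -, hwc0, hTc', hMc', hPc'⟩ := hvar (0, 0, 1)
  have data := monodromyData_family hf hD hu hODE hp (hTpos p hp) (hper p hp) (hturn p hp).1 hκ
    (hΦ0 p hp) (hΦ p hp)
  have hlim := data.tendsto_det_div hva (fun x => (hwa x).congr_deriv (by simp)) hvE
    (fun x => (hwE x).congr_deriv (by simp)) hvc (fun x => (hwc x).congr_deriv (by simp))
    hwa0 hwE0 hwc0 (by simpa using hvE0)
  have hdiff : ∀ {R : ℝ × ℝ × ℝ → ℝ}, ContDiffOn ℝ 1 R D → DifferentiableAt ℝ R p := fun hR =>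
    (hR.differentiableOn one_ne_zero).differentiableAt (hD.mem_nhds hp)
  obtain ⟨h1, h2, h3⟩ := deriv_slices_eq_fderiv (hdiff hTc)
  obtain ⟨h4, h5, h6⟩ := deriv_slices_eq_fderiv (hdiff hMc)
  obtain ⟨h7, h8, h9⟩ := deriv_slices_eq_fderiv (hdiff hPc)
  obtain ⟨r0, r1, r2, r3⟩ := iteratedDeriv_of_tendsto_div_pow_three
    (analyticAt_det_sub_one (hana p hp (T p))) hlim
  refine ⟨r0, r1, r2, r3.trans ?_⟩
  rw [h1, h2, h3, h4, h5, h6, h7, h8, h9, hMa, hPa, hME, hPE, hMc', hPc', hTa, hTE, hTc']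
  exact_mod_cast congrArg Complex.ofReal (inv_mul_det_variations hκ (u p 0) _ _ _ _ _ _ _ _ _)
end

section
/- In the same setting — f : ℝ → ℝ C², u(·;a,E,c) a C² family of periodic solutions of u″ + f(u) − c·u = a with energy E, turning-point initial data u(0) = u₋, u′(0) = 0, period T(a,E,c), mass M = ∫₀^T u dx and momentum P = ∫₀^T u² dx all C¹ in the parameters, and Φ(·;μ) the solution of Φ′ = H(x;μ)Φ, Φ(0;μ) = I with H(x;μ) having rows (0,1,0), (0,0,1), (−μ − f″(u)·u′, c − f′(u), 0) — the trace of the monodromy a(μ) = tr Φ(T;μ) is twice differentiable at μ = 0 with a″(0) = (∂_ET·∂_cP − ∂_cT·∂_EP) + 2(∂_aM·∂_EP − ∂_EM·∂_aP); that is, tr(M_{μμ}(0)) = {T,P}_{E,c} + 2{M,P}_{a,E}. -/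
open Set Matrix MeasureTheory

section PicardExpansion

attribute [local instance] Matrix.linftyOpNormedRing
  Matrix.linftyOpNormedAlgebra

/-- Second-order Picard expansion of the solution of `Z' = μ B Z`, `Z 0 = 1`. -/
lemma exists_picard_remainder_le {n : Type*} [Fintype n] [DecidableEq n]
    {B K J : ℝ → Matrix n n ℂ} (hB : Continuous B)
    (hK : ∀ x, HasDerivAt K (B x) x) (hK0 : K 0 = 0)
    (hJ : ∀ x, HasDerivAt J (B x * K x) x) (hJ0 : J 0 = 0)
    {Z : ℂ → ℝ → Matrix n n ℂ}
    (hZ : ∀ μ x, HasDerivAt (Z μ) (μ • (B x * Z μ x)) x) (hZ0 : ∀ μ, Z μ 0 = 1)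
    {T : ℝ} (hT : 0 ≤ T) :
    ∃ C : ℝ, ∀ μ : ℂ, ‖μ‖ ≤ 1 →
      ‖Z μ T - (1 + μ • K T + μ ^ 2 • J T)‖ ≤ C * ‖μ‖ ^ 3 := by
  obtain ⟨b, hb⟩ := (isCompact_Icc (a := (0 : ℝ)) (b := T)).exists_bound_of_continuousOn
    hB.continuousOn
  have hb0 : 0 ≤ b := (norm_nonneg _).trans (hb 0 (left_mem_Icc.2 hT))
  have step : ∀ (μ : ℂ) (Y Y' : ℝ → Matrix n n ℂ) (c : ℝ), Y 0 = 0 →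
      (∀ x, HasDerivAt Y (μ • (B x * Y' x)) x) → (∀ x ∈ Icc 0 T, ‖Y' x‖ ≤ c) →
      ∀ x ∈ Icc 0 T, ‖Y x‖ ≤ ‖μ‖ * (b * c) * T := by
    intro μ Y Y' c hY0 hY hc x hx
    have hc0 : 0 ≤ c := (norm_nonneg _).trans (hc 0 (left_mem_Icc.2 hT))
    have := norm_image_sub_le_of_norm_deriv_le_segment' (C := ‖μ‖ * (b * c))
      (fun y _ => (hY y).hasDerivWithinAt) (fun y hy => by
        rw [norm_smul]
        gcongr
        exact (norm_mul_le _ _).trans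
          (mul_le_mul (hb y (Ico_subset_Icc_self hy)) (hc y (Ico_subset_Icc_self hy))
            (norm_nonneg _) hb0)) x hx
    rw [hY0, sub_zero, sub_zero] at this
    refine this.trans ?_
    gcongr
    exact hx.2
  obtain ⟨c, hc⟩ : ∃ c : ℝ, ∀ μ : ℂ, ‖μ‖ ≤ 1 → ∀ x ∈ Icc 0 T, ‖Z μ x‖ ≤ c := by
    refine ⟨gronwallBound ‖(1 : Matrix n n ℂ)‖ b 0 T, fun μ hμ x hx => ?_⟩
    have := norm_le_gronwallBound_of_norm_deriv_right_le (f := Z μ)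
      (f' := fun x => μ • (B x * Z μ x)) (δ := ‖(1 : Matrix n n ℂ)‖) (K := b) (ε := 0)
      (a := 0) (b := T)
      (fun y _ => (hZ μ y).continuousAt.continuousWithinAt)
      (fun y _ => (hZ μ y).hasDerivWithinAt) (by rw [hZ0]) (fun y hy => by
        rw [norm_smul, add_zero]
        calc ‖μ‖ * ‖B y * Z μ y‖ ≤ 1 * (‖B y‖ * ‖Z μ y‖) := by
              gcongr
              exact norm_mul_le _ _
          _ ≤ b * ‖Z μ y‖ := by
              rw [one_mul]
              gcongr
              exact hb y (Ico_subset_Icc_self hy)) x hx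
    refine this.trans ?_
    exact gronwallBound_mono (norm_nonneg _) le_rfl hb0 (by simpa using hx.2)
  refine ⟨b * (b * (b * c * T) * T) * T, fun μ hμ => ?_⟩
  have h1 := step μ (fun x => Z μ x - 1) (Z μ) c (by simp [hZ0])
    (fun x => (hZ μ x).sub_const 1) (hc μ hμ)
  have h2 := step μ (fun x => Z μ x - 1 - μ • K x) (fun x => Z μ x - 1) _ (by simp [hZ0, hK0])
    (fun x => by
      refine (((hZ μ x).sub_const 1).sub ((hK x).const_smul μ)).congr_deriv ?_
      rw [mul_sub, mul_one, smul_sub]) h1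
  have h3 := step μ (fun x => Z μ x - 1 - μ • K x - μ ^ 2 • J x)
    (fun x => Z μ x - 1 - μ • K x) _ (by simp [hZ0, hK0, hJ0])
    (fun x => by
      refine ((((hZ μ x).sub_const 1).sub ((hK x).const_smul μ)).sub
        ((hJ x).const_smul (μ ^ 2))).congr_deriv ?_
      simp only [mul_sub, mul_one, smul_sub, mul_smul_comm, smul_smul, sq]) h2
  have h4 := h3 T (right_mem_Icc.2 hT)
  calc _ = ‖Z μ T - 1 - μ • K T - μ ^ 2 • J T‖ := by
        congr 1
        abel
    _ ≤ _ := h4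
    _ = _ := by ring

end PicardExpansion

section CubicRemainder

open Filter Topology

/-- The second Taylor coefficient of an analytic function, read off from a cubic remainder. -/
lemma iteratedDeriv_two_of_cubic_remainder {g : ℂ → ℂ} (hg : AnalyticAt ℂ g 0) {α β γ : ℂ}
    {r : ℝ} (h : ∀ μ : ℂ, ‖μ‖ ≤ 1 → ‖g μ - (α + μ * β + μ ^ 2 * γ)‖ ≤ r * ‖μ‖ ^ 3) :
    iteratedDeriv 2 g 0 = 2 * γ := by
  set p : ℂ → ℂ := fun μ => α + μ * β + μ ^ 2 * γ with hp
  have hpa : AnalyticAt ℂ p 0 := by fun_prop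
  have hord : (3 : ℕ) ≤ analyticOrderAt (fun μ => g μ - p μ) 0 := by
    by_contra! hlt
    obtain ⟨n, hn⟩ := ENat.ne_top_iff_exists.1 (ne_top_of_lt hlt)
    rw [← hn] at hlt
    have hn3 : n < 3 := by exact_mod_cast hlt
    obtain ⟨k, hk, hk0, hgk⟩ := ((hg.fun_sub hpa).analyticOrderAt_eq_natCast).1 hn.symm
    have hle : ∀ᶠ z in 𝓝[≠] (0 : ℂ), ‖k z‖ ≤ r * ‖z‖ ^ (3 - n) := by
      filter_upwards [hgk.filter_mono nhdsWithin_le_nhds, self_mem_nhdsWithin,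
        nhdsWithin_le_nhds (Metric.closedBall_mem_nhds (0 : ℂ) one_pos)] with z hz hz0 hz1
      have h1 := h z (by simpa using hz1)
      rw [hz, sub_zero, norm_smul, norm_pow] at h1
      have hzp : 0 < ‖z‖ ^ n := pow_pos (norm_pos_iff.2 hz0) n
      refine le_of_mul_le_mul_left (h1.trans_eq ?_) hzp
      rw [mul_left_comm, ← pow_add, Nat.add_sub_of_le hn3.le]
    have hlim : Tendsto (fun z : ℂ => r * ‖z‖ ^ (3 - n)) (𝓝[≠] 0) (𝓝 0) := by
      have : Continuous fun z : ℂ => r * ‖z‖ ^ (3 - n) := by fun_prop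
      have h2 := (this.tendsto 0).mono_left (nhdsWithin_le_nhds (s := {0}ᶜ))
      simpa [Nat.sub_ne_zero_of_lt hn3] using h2
    have := le_of_tendsto_of_tendsto
      ((hk.continuousAt.norm.tendsto).mono_left nhdsWithin_le_nhds) hlim hle
    exact hk0 (norm_le_zero_iff.1 this)
  have h0 := (natCast_le_analyticOrderAt_iff_iteratedDeriv_eq_zero (hg.fun_sub hpa)).1 hord 2
    (by norm_num)
  have hp2 : iteratedDeriv 2 p 0 = 2 * γ := by
    have h1 : deriv p = fun μ => β + μ * (2 * γ) := by
      funext μ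
      have := (((hasDerivAt_id μ).mul_const β).const_add α).add
        (((hasDerivAt_id μ).pow 2).mul_const γ)
      refine (this.congr_deriv ?_).deriv
      simp
      ring
    rw [iteratedDeriv_succ, iteratedDeriv_one, h1]
    refine ((((hasDerivAt_id (0 : ℂ)).mul_const (2 * γ)).const_add β).congr_deriv ?_).deriv
    simp
  rw [iteratedDeriv_fun_sub hg.contDiffAt hpa.contDiffAt, hp2] at h0
  exact sub_eq_zero.1 h0

end CubicRemainder

lemma hasDerivAt_integral_of_continuous {φ : ℝ → ℝ} (hφ : Continuous φ) (x : ℝ) :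
    HasDerivAt (fun x => ∫ t in (0 : ℝ)..x, φ t) (φ x) x :=
  intervalIntegral.integral_hasDerivAt_right (hφ.intervalIntegrable _ _)
    (hφ.stronglyMeasurableAtFilter _ _) hφ.continuousAt

lemma eq_of_hasDerivAt_of_zero {f g f' : ℝ → ℝ} (hf : ∀ x, HasDerivAt f (f' x) x)
    (hg : ∀ x, HasDerivAt g (f' x) x) (h0 : f 0 = g 0) (x : ℝ) : f x = g x := by
  have hd : ∀ x, HasDerivAt (fun x => f x - g x) 0 x := fun x =>
    ((hf x).sub (hg x)).congr_deriv (sub_self _)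
  have := is_const_of_deriv_eq_zero (fun x => (hd x).differentiableAt) (fun x => (hd x).deriv) x 0
  linarith

/-- A `T`-periodic profile `u` with `u' = y`, `u'' = s`, `u''' = g u'` and `g' = -h`, started at
a nondegenerate critical point. -/
structure IsPeriodicProfile (u y s g h : ℝ → ℝ) (T : ℝ) : Prop where
  deriv_u : ∀ x, HasDerivAt u (y x) x
  deriv_y : ∀ x, HasDerivAt y (s x) x
  deriv_s : ∀ x, HasDerivAt s (g x * y x) x
  deriv_g : ∀ x, HasDerivAt g (-h x) x
  y_zero : y 0 = 0
  s_zero : s 0 ≠ 0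
  u_period : u T = u 0
  y_period : y T = 0
  s_period : s T = s 0
  g_period : g T = g 0

/-- The variation `e`, with `e' = e₁`, of a periodic profile in the parameter direction
`(va, vE, vc)`, along which the period, mass and momentum have derivatives `dT`, `dM`, `dP`. -/
structure IsVariation (u y s g : ℝ → ℝ) (T va vE vc dT dM dP : ℝ) (e e₁ : ℝ → ℝ) : Prop where
  deriv : ∀ x, HasDerivAt e (e₁ x) x
  deriv₁ : ∀ x, HasDerivAt e₁ (va + vc * u x + g x * e x) x
  energy : ∀ x, y x * e₁ x - s x * e x = vE + va * u x + vc * (u x ^ 2 / 2)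
  zero₁ : e₁ 0 = 0
  period : e T = e 0
  period₁ : e₁ T = -dT * s 0
  mass : ∫ x in (0 : ℝ)..T, e x = dM - dT * u 0
  momentum : ∫ x in (0 : ℝ)..T, u x * e x = (dP - dT * u 0 ^ 2) / 2

section SecondOrder

variable {u y s g h e e₁ a a₁ k k₁ : ℝ → ℝ} {T TE ME PE Ta Ma Pa Tc Mc Pc : ℝ}

lemma IsVariation.continuous {va vE vc dT dM dP : ℝ}
    (he : IsVariation u y s g T va vE vc dT dM dP e e₁) : Continuous e :=
  continuous_iff_continuousAt.2 fun x => (he.deriv x).continuousAt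

lemma IsPeriodicProfile.continuous (hu : IsPeriodicProfile u y s g h T) : Continuous u :=
  continuous_iff_continuousAt.2 fun x => (hu.deriv_u x).continuousAt

/-- `e a' - e' a` is an antiderivative of `e`. -/
lemma hasDerivAt_wronskian_energy_flux (he : IsVariation u y s g T 0 1 0 TE ME PE e e₁)
    (ha : IsVariation u y s g T 1 0 0 Ta Ma Pa a a₁) (x : ℝ) :
    HasDerivAt (fun x => e x * a₁ x - e₁ x * a x) (e x) x := by
  refine (((he.deriv x).mul (ha.deriv₁ x)).sub ((he.deriv₁ x).mul (ha.deriv x))).congr_deriv ?_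
  ring

lemma hasDerivAt_wronskian_energy_speed (he : IsVariation u y s g T 0 1 0 TE ME PE e e₁)
    (hk : IsVariation u y s g T 0 0 1 Tc Mc Pc k k₁) (x : ℝ) :
    HasDerivAt (fun x => e x * k₁ x - e₁ x * k x) (u x * e x) x := by
  refine (((he.deriv x).mul (hk.deriv₁ x)).sub ((he.deriv₁ x).mul (hk.deriv x))).congr_deriv ?_
  ring

lemma hasDerivAt_wronskian_flux_speed (ha : IsVariation u y s g T 1 0 0 Ta Ma Pa a a₁)
    (hk : IsVariation u y s g T 0 0 1 Tc Mc Pc k k₁) (x : ℝ) :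
    HasDerivAt (fun x => a x * k₁ x - a₁ x * k x) (u x * a x - k x) x := by
  refine (((ha.deriv x).mul (hk.deriv₁ x)).sub ((ha.deriv₁ x).mul (hk.deriv x))).congr_deriv ?_
  ring

lemma IsVariation.energy_zero {va vE vc dT dM dP : ℝ} (hu : IsPeriodicProfile u y s g h T)
    (he : IsVariation u y s g T va vE vc dT dM dP e e₁) :
    s 0 * e 0 = -(vE + va * u 0 + vc * (u 0 ^ 2 / 2)) := by
  have := he.energy 0
  rw [hu.y_zero] at this
  linarith

lemma intervalIntegral_eq_of_hasDerivAt {φ ψ : ℝ → ℝ} (h : ∀ x, HasDerivAt φ (ψ x) x)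
    (hψ : Continuous ψ) (T : ℝ) : ∫ x in (0 : ℝ)..T, ψ x = φ T - φ 0 :=
  intervalIntegral.integral_eq_sub_of_hasDerivAt (fun x _ => h x) (hψ.intervalIntegrable _ _)

/-- The Maxwell-type relation `∂_E M = ∂_a T`. -/
lemma mass_energy_eq_period_flux (hu : IsPeriodicProfile u y s g h T)
    (he : IsVariation u y s g T 0 1 0 TE ME PE e e₁)
    (ha : IsVariation u y s g T 1 0 0 Ta Ma Pa a a₁) : ME = Ta := by
  have h1 := intervalIntegral_eq_of_hasDerivAt (hasDerivAt_wronskian_energy_flux he ha)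
    he.continuous T
  rw [he.mass, he.period, ha.period, he.period₁, ha.period₁, he.zero₁, ha.zero₁] at h1
  have h2 := he.energy_zero hu
  have h3 := ha.energy_zero hu
  linear_combination h1 - Ta * h2 + TE * h3

/-- The Maxwell-type relation `∂_E P = 2 ∂_c T`. -/
lemma momentum_energy_eq_period_speed (hu : IsPeriodicProfile u y s g h T)
    (he : IsVariation u y s g T 0 1 0 TE ME PE e e₁)
    (hk : IsVariation u y s g T 0 0 1 Tc Mc Pc k k₁) : PE = 2 * Tc := by
  have h1 := intervalIntegral_eq_of_hasDerivAt (hasDerivAt_wronskian_energy_speed he hk)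
    (hu.continuous.mul he.continuous) T
  rw [he.momentum, he.period, hk.period, he.period₁, hk.period₁, he.zero₁, hk.zero₁] at h1
  have h2 := he.energy_zero hu
  have h3 := hk.energy_zero hu
  linear_combination 2 * h1 - 2 * Tc * h2 + 2 * TE * h3

/-- The Maxwell-type relation `∂_a P = 2 ∂_c M`. -/
lemma momentum_flux_eq_mass_speed (hu : IsPeriodicProfile u y s g h T)
    (ha : IsVariation u y s g T 1 0 0 Ta Ma Pa a a₁)
    (hk : IsVariation u y s g T 0 0 1 Tc Mc Pc k k₁) : Pa = 2 * Mc := by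
  have hua : Continuous fun x => u x * a x := hu.continuous.mul ha.continuous
  have h1 := intervalIntegral_eq_of_hasDerivAt (hasDerivAt_wronskian_flux_speed ha hk)
    (hua.sub hk.continuous) T
  rw [intervalIntegral.integral_sub (hua.intervalIntegrable _ _)
    (hk.continuous.intervalIntegrable _ _), ha.momentum, hk.mass, ha.period, hk.period,
    ha.period₁, hk.period₁, ha.zero₁, hk.zero₁] at h1
  have h2 := ha.energy_zero hu
  have h3 := hk.energy_zero hu
  linear_combination 2 * h1 - 2 * Tc * h2 + 2 * Ta * h3

/-- `y q - e u + a = 0`, where `q = e a' - e' a`. -/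
lemma profile_pairing_eq_zero (he : IsVariation u y s g T 0 1 0 TE ME PE e e₁)
    (ha : IsVariation u y s g T 1 0 0 Ta Ma Pa a a₁) (x : ℝ) :
    y x * (e x * a₁ x - e₁ x * a x) - e x * u x + a x = 0 := by
  linear_combination e x * ha.energy x - a x * he.energy x

/-- The relation `∂_a M = ∂_E P`. -/
lemma mass_flux_eq_momentum_energy (hu : IsPeriodicProfile u y s g h T)
    (he : IsVariation u y s g T 0 1 0 TE ME PE e e₁)
    (ha : IsVariation u y s g T 1 0 0 Ta Ma Pa a a₁) : Ma = PE := by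
  have hd : ∀ x, HasDerivAt (fun x => (e x * a₁ x - e₁ x * a x) * u x) (2 * (u x * e x) - a x) x :=
    fun x => by
      refine ((hasDerivAt_wronskian_energy_flux he ha x).mul (hu.deriv_u x)).congr_deriv ?_
      linear_combination profile_pairing_eq_zero he ha x
  have hue : Continuous fun x => u x * e x := hu.continuous.mul he.continuous
  have h1 := intervalIntegral_eq_of_hasDerivAt hd ((hue.const_mul 2).sub ha.continuous) T
  rw [intervalIntegral.integral_sub ((hue.const_mul 2).intervalIntegrable _ _)
    (ha.continuous.intervalIntegrable _ _), intervalIntegral.integral_const_mul, he.momentum,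
    ha.mass, he.period, ha.period,
    he.period₁, ha.period₁, he.zero₁, ha.zero₁, hu.u_period] at h1
  have h2 := he.energy_zero hu
  have h3 := ha.energy_zero hu
  linear_combination -h1 + u 0 * Ta * h2 - u 0 * TE * h3

/-- The coefficient matrix of the `μ`-dependent part of the system in the frame of variations. -/
def variationMatrix (u y e e₁ a a₁ : ℝ → ℝ) (x : ℝ) : Matrix (Fin 3) (Fin 3) ℝ :=
  -vecMulVec ![e x * a₁ x - e₁ x * a x, -u x, 1] ![y x, e x, a x]

/-- Evaluation of the second-order term of the monodromy trace. -/
lemma trace_second_order (hu : IsPeriodicProfile u y s g h T)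
    (he : IsVariation u y s g T 0 1 0 TE ME PE e e₁)
    (ha : IsVariation u y s g T 1 0 0 Ta Ma Pa a a₁)
    (hk : IsVariation u y s g T 0 0 1 Tc Mc Pc k k₁)
    {K J : ℝ → Matrix (Fin 3) (Fin 3) ℝ}
    (hK : ∀ x i j, HasDerivAt (fun x => K x i j) (variationMatrix u y e e₁ a a₁ x i j) x)
    (hK0 : K 0 = 0)
    (hJ : ∀ x i j, HasDerivAt (fun x => J x i j) ((variationMatrix u y e e₁ a a₁ x * K x) i j) x)
    (hJ0 : J 0 = 0) :
    2 * (!![1, -TE, -Ta; 0, 1, 0; 0, 0, 1] * J T).trace =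
      (TE * Pc - Tc * PE) + 2 * (Ma * PE - ME * Pa) := by
  have K0 : ∀ i j, K 0 i j = 0 := by simp [hK0]
  have J0 : ∀ i j, J 0 i j = 0 := by simp [hJ0]
  have cu := hu.continuous
  have ce := he.continuous
  have ca := ha.continuous
  have ck := hk.continuous
  simp only [variationMatrix, Matrix.mul_apply, Fin.sum_univ_three, Matrix.neg_apply,
    vecMulVec_apply] at hK hJ
  have K10 : ∀ x, K x 1 0 = (u x ^ 2 - u 0 ^ 2) / 2 := by
    refine eq_of_hasDerivAt_of_zero (fun x => hK x 1 0) (fun x => ?_) (by simp [K0])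
    refine ((((hu.deriv_u x).pow 2).sub_const _).div_const 2).congr_deriv ?_
    simp
    ring
  have K20 : ∀ x, K x 2 0 = u 0 - u x := by
    refine eq_of_hasDerivAt_of_zero (fun x => hK x 2 0) (fun x => ?_) (by simp [K0])
    refine ((hu.deriv_u x).const_sub _).congr_deriv ?_
    simp
  have K00 : ∀ x, K x 0 0 = (e x * k₁ x - e₁ x * k x) - (e x * a₁ x - e₁ x * a x) * u x := by
    refine eq_of_hasDerivAt_of_zero (fun x => hK x 0 0) (fun x => ?_)
      (by simp [K0, he.zero₁, ha.zero₁, hk.zero₁])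
    refine ((hasDerivAt_wronskian_energy_speed he hk x).sub
      ((hasDerivAt_wronskian_energy_flux he ha x).mul (hu.deriv_u x))).congr_deriv ?_
    simp
    ring
  have hcol : ∀ x, y x * K x 0 0 + e x * K x 1 0 + a x * K x 2 0 =
      -(k x + u 0 ^ 2 / 2 * e x - u 0 * a x) := fun x => by
    rw [K00, K10, K20]
    linear_combination e x * hk.energy x - k x * he.energy x
      - u x * profile_pairing_eq_zero he ha x
  have hKE : K T 2 1 = -(ME - TE * u 0) := by
    rw [← he.mass]
    refine eq_of_hasDerivAt_of_zero (fun x => hK x 2 1)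
      (fun x => (hasDerivAt_integral_of_continuous ce x).neg.congr_deriv ?_) (by simp [K0]) T
    simp
  have hKa : K T 2 2 = -(Ma - Ta * u 0) := by
    rw [← ha.mass]
    refine eq_of_hasDerivAt_of_zero (fun x => hK x 2 2)
      (fun x => (hasDerivAt_integral_of_continuous ca x).neg.congr_deriv ?_) (by simp [K0]) T
    simp
  have hKuE : K T 1 1 = (PE - TE * u 0 ^ 2) / 2 := by
    rw [← he.momentum]
    refine eq_of_hasDerivAt_of_zero (fun x => hK x 1 1)
      (fun x => (hasDerivAt_integral_of_continuous (cu.mul ce) x).congr_deriv ?_) (by simp [K0]) T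
    simp
  have hKua : K T 1 2 = (Pa - Ta * u 0 ^ 2) / 2 := by
    rw [← ha.momentum]
    refine eq_of_hasDerivAt_of_zero (fun x => hK x 1 2)
      (fun x => (hasDerivAt_integral_of_continuous (cu.mul ca) x).congr_deriv ?_) (by simp [K0]) T
    simp
  have hK00 : K T 0 0 = -K T 1 1 - K T 2 2 := by
    refine eq_of_hasDerivAt_of_zero (fun x => hK x 0 0)
      (fun x => ((hK x 1 1).neg.sub (hK x 2 2)).congr_deriv ?_) (by simp [K0]) T
    simp
    linear_combination profile_pairing_eq_zero he ha x
  have hJ20 : J T 2 0 = (Mc - Tc * u 0) + u 0 ^ 2 / 2 * (ME - TE * u 0)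
      - u 0 * (Ma - Ta * u 0) := by
    rw [← hk.mass, ← he.mass, ← ha.mass]
    refine eq_of_hasDerivAt_of_zero (fun x => hJ x 2 0)
      (fun x => (((hasDerivAt_integral_of_continuous ck x).add
        ((hasDerivAt_integral_of_continuous ce x).const_mul _)).sub
        ((hasDerivAt_integral_of_continuous ca x).const_mul _)).congr_deriv ?_) (by simp [J0]) T
    simp
    linear_combination hcol x
  have hJ10 : J T 1 0 = -((Pc - Tc * u 0 ^ 2) / 2 + u 0 ^ 2 / 2 * ((PE - TE * u 0 ^ 2) / 2)
      - u 0 * ((Pa - Ta * u 0 ^ 2) / 2)) := by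
    rw [← hk.momentum, ← he.momentum, ← ha.momentum]
    refine eq_of_hasDerivAt_of_zero (fun x => hJ x 1 0)
      (fun x => (((hasDerivAt_integral_of_continuous (cu.mul ck) x).add
        ((hasDerivAt_integral_of_continuous (cu.mul ce) x).const_mul _)).sub
        ((hasDerivAt_integral_of_continuous (cu.mul ca) x).const_mul _)).neg.congr_deriv ?_)
      (by simp [J0]) T
    simp
    linear_combination -u x * hcol x
  have htr : J T 0 0 + J T 1 1 + J T 2 2 = (K T 0 0 ^ 2 + K T 1 1 ^ 2 + K T 2 2 ^ 2) / 2
      + K T 0 1 * K T 1 0 + K T 0 2 * K T 2 0 + K T 1 2 * K T 2 1 := by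
    refine eq_of_hasDerivAt_of_zero (fun x => ((hJ x 0 0).add (hJ x 1 1)).add (hJ x 2 2))
      (fun x => (((((((hK x 0 0).pow 2).add ((hK x 1 1).pow 2)).add
        ((hK x 2 2).pow 2)).div_const 2).add ((hK x 0 1).mul (hK x 1 0))).add
        ((hK x 0 2).mul (hK x 2 0))).add ((hK x 1 2).mul (hK x 2 1)) |>.congr_deriv ?_)
      (by simp [K0, J0]) T
    simp
    ring
  have hN : (!![1, -TE, -Ta; 0, 1, 0; 0, 0, 1] * J T).trace =
      (J T 0 0 + J T 1 1 + J T 2 2) - TE * J T 1 0 - Ta * J T 2 0 := by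
    simp [Matrix.trace, Fin.sum_univ_three, Matrix.vecMul, dotProduct]
    ring
  rw [hN, htr, hJ10, hJ20, hK00, hKE, hKa, hKuE, hKua, K10, K20, hu.u_period,
    mass_flux_eq_momentum_energy hu he ha, mass_energy_eq_period_flux hu he ha,
    momentum_flux_eq_mass_speed hu ha hk, momentum_energy_eq_period_speed hu he hk]
  ring

end SecondOrder

section Monodromy

attribute [local instance] Matrix.linftyOpNormedRing Matrix.linftyOpNormedAlgebra

lemma exists_norm_le_of_linearMap {E : Type*} [NormedAddCommGroup E] [NormedSpace ℂ E]
    [FiniteDimensional ℂ E] (ℓ : E →ₗ[ℂ] ℂ) : ∃ r : ℝ, 0 ≤ r ∧ ∀ X, ‖ℓ X‖ ≤ r * ‖X‖ :=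
  ⟨‖LinearMap.toContinuousLinearMap ℓ‖, norm_nonneg _,
    fun X => (LinearMap.toContinuousLinearMap ℓ).le_opNorm X⟩

lemma hasDerivAt_matrix_of_entries {A : ℝ → Matrix (Fin 3) (Fin 3) ℂ}
    {A' : Matrix (Fin 3) (Fin 3) ℂ} {x : ℝ}
    (h : ∀ i j, HasDerivAt (fun x => A x i j) (A' i j) x) : HasDerivAt A A' x :=
  hasDerivAt_pi.2 fun i => hasDerivAt_pi.2 fun j => h i j

lemma hasDerivAt_mapMatrix_ofReal {A : ℝ → Matrix (Fin 3) (Fin 3) ℝ}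
    {A' : Matrix (Fin 3) (Fin 3) ℝ} {x : ℝ}
    (h : ∀ i j, HasDerivAt (fun x => A x i j) (A' i j) x) :
    HasDerivAt (fun x => Complex.ofRealHom.mapMatrix (A x)) (Complex.ofRealHom.mapMatrix A') x :=
  hasDerivAt_matrix_of_entries fun i j => (h i j).ofReal_comp

/-- The frame of solutions `y = u'`, `e`, `a` of the problem at `μ = 0`. -/
def variationFrame (y s g e e₁ a a₁ : ℝ → ℝ) (x : ℝ) : Matrix (Fin 3) (Fin 3) ℝ :=
  !![y x, e x, a x; s x, e₁ x, a₁ x; g x * y x, g x * e x, 1 + g x * a x]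

/-- The inverse of `variationFrame`, whose rows solve the adjoint problem at `μ = 0`. -/
def variationCoframe (u y s g e e₁ a a₁ : ℝ → ℝ) (x : ℝ) : Matrix (Fin 3) (Fin 3) ℝ :=
  !![e₁ x - (e x * a₁ x - e₁ x * a x) * g x, -e x, e x * a₁ x - e₁ x * a x;
     -s x + u x * g x, y x, -u x;
     -g x, 0, 1]

variable {u y s g h e e₁ a a₁ k k₁ : ℝ → ℝ} {T TE ME PE Ta Ma Pa Tc Mc Pc : ℝ}

lemma variationCoframe_mul_variationFrame (he : IsVariation u y s g T 0 1 0 TE ME PE e e₁)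
    (ha : IsVariation u y s g T 1 0 0 Ta Ma Pa a a₁) (x : ℝ) :
    variationCoframe u y s g e e₁ a a₁ x * variationFrame y s g e e₁ a a₁ x = 1 := by
  have h1 := he.energy x
  have h2 := ha.energy x
  ext i j
  fin_cases i <;> fin_cases j <;>
    simp [variationCoframe, variationFrame, Matrix.mul_apply, Fin.sum_univ_three] <;>
    linarith

lemma hasDerivAt_variationCoframe (hu : IsPeriodicProfile u y s g h T)
    (he : IsVariation u y s g T 0 1 0 TE ME PE e e₁)
    (ha : IsVariation u y s g T 1 0 0 Ta Ma Pa a a₁) (x : ℝ) (i j : Fin 3) :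
    HasDerivAt (fun x => variationCoframe u y s g e e₁ a a₁ x i j)
      ((-(variationCoframe u y s g e e₁ a a₁ x * !![0, 1, 0; 0, 0, 1; -h x, g x, 0])) i j) x := by
  have hq := hasDerivAt_wronskian_energy_flux he ha x
  fin_cases i <;> fin_cases j <;>
    simp [variationCoframe]
  · refine ((he.deriv₁ x).sub (hq.mul (hu.deriv_g x))).congr_deriv ?_
    ring
  · refine (he.deriv x).neg.congr_deriv ?_
    ring
  · exact hq
  · refine ((hu.deriv_s x).neg.add ((hu.deriv_u x).mul (hu.deriv_g x))).congr_deriv ?_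
    ring
  · refine (hu.deriv_y x).congr_deriv ?_
    ring
  · exact (hu.deriv_u x).neg
  · exact (hu.deriv_g x).neg.congr_deriv (by ring)
  · exact (hasDerivAt_const x 0).congr_deriv (by ring)
  · exact hasDerivAt_const x 1

lemma variationCoframe_mul_perturbation (he : IsVariation u y s g T 0 1 0 TE ME PE e e₁)
    (ha : IsVariation u y s g T 1 0 0 Ta Ma Pa a a₁) (x : ℝ) :
    variationCoframe u y s g e e₁ a a₁ x * !![0, 0, 0; 0, 0, 0; -1, 0, 0] =
      variationMatrix u y e e₁ a a₁ x * variationCoframe u y s g e e₁ a a₁ x := by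
  have hVW := variationCoframe_mul_variationFrame he ha x
  have : variationCoframe u y s g e e₁ a a₁ x * !![0, 0, 0; 0, 0, 0; -1, 0, 0] *
      variationFrame y s g e e₁ a a₁ x = variationMatrix u y e e₁ a a₁ x := by
    ext i j
    fin_cases i <;> fin_cases j <;>
      simp [variationCoframe, variationFrame, variationMatrix, Matrix.mul_apply,
        Fin.sum_univ_three] <;> ring
  rw [← this, Matrix.mul_assoc _ (variationFrame _ _ _ _ _ _ _ x), mul_eq_one_comm.1 hVW,
    Matrix.mul_one]

lemma variationCoframe_zero_mul_variationFrame (hu : IsPeriodicProfile u y s g h T)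
    (he : IsVariation u y s g T 0 1 0 TE ME PE e e₁)
    (ha : IsVariation u y s g T 1 0 0 Ta Ma Pa a a₁) :
    variationCoframe u y s g e e₁ a a₁ 0 * variationFrame y s g e e₁ a a₁ T =
      !![1, -TE, -Ta; 0, 1, 0; 0, 0, 1] := by
  have h1 := he.energy_zero hu
  have h2 := ha.energy_zero hu
  ext i j
  fin_cases i <;> fin_cases j <;>
    simp [variationCoframe, variationFrame, Matrix.mul_apply, Fin.sum_univ_three, hu.y_zero,
      hu.y_period, hu.s_period, hu.g_period, he.zero₁, ha.zero₁, he.period, ha.period,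
      he.period₁, ha.period₁]
  · linear_combination -h1
  · linear_combination TE * h1
  · linear_combination Ta * h1
  · linear_combination -h1
  · linear_combination -h2

/-- The second derivative at `μ = 0` of the monodromy trace of the linearized problem about a
periodic profile, in terms of the variations of the profile. -/
lemma iteratedDeriv_two_trace_monodromy (hT : 0 ≤ T) (hu : IsPeriodicProfile u y s g h T)
    (he : IsVariation u y s g T 0 1 0 TE ME PE e e₁)
    (ha : IsVariation u y s g T 1 0 0 Ta Ma Pa a a₁)
    (hk : IsVariation u y s g T 0 0 1 Tc Mc Pc k k₁)
    {Φ : ℂ → ℝ → Matrix (Fin 3) (Fin 3) ℂ} (hΦ0 : ∀ μ, Φ μ 0 = 1)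
    (hΦ : ∀ (μ : ℂ) (x : ℝ) (i j : Fin 3), HasDerivAt (fun x => Φ μ x i j)
      ((!![0, 1, 0; 0, 0, 1; -μ - (h x : ℂ), (g x : ℂ), 0] * Φ μ x) i j) x)
    (hana : AnalyticAt ℂ (fun μ => (Φ μ T).trace) 0) :
    iteratedDeriv 2 (fun μ => (Φ μ T).trace) 0 =
      (((TE * Pc - Tc * PE) + 2 * (Ma * PE - ME * Pa) : ℝ) : ℂ) := by
  set c : Matrix (Fin 3) (Fin 3) ℝ →+* Matrix (Fin 3) (Fin 3) ℂ :=
    Complex.ofRealHom.mapMatrix with hc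
  set V := variationCoframe u y s g e e₁ a a₁ with hV
  set W := variationFrame y s g e e₁ a a₁ with hW
  set B := variationMatrix u y e e₁ a a₁ with hB
  have hVW : ∀ x, V x * W x = 1 := variationCoframe_mul_variationFrame he ha
  have hWV : ∀ x, W x * V x = 1 := fun x => mul_eq_one_comm.1 (hVW x)
  have cu := hu.continuous
  have ce := he.continuous
  have ca := ha.continuous
  have cy : Continuous y := continuous_iff_continuousAt.2 fun x => (hu.deriv_y x).continuousAt
  have ce₁ : Continuous e₁ := continuous_iff_continuousAt.2 fun x => (he.deriv₁ x).continuousAt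
  have ca₁ : Continuous a₁ := continuous_iff_continuousAt.2 fun x => (ha.deriv₁ x).continuousAt
  have cB : ∀ i j, Continuous fun x => B x i j := fun i j => by
    fin_cases i <;> fin_cases j <;>
      simp [hB, variationMatrix] <;> fun_prop
  set K : ℝ → Matrix (Fin 3) (Fin 3) ℝ := fun x => Matrix.of fun i j => ∫ t in (0 : ℝ)..x, B t i j
    with hKdef
  have hK : ∀ x i j, HasDerivAt (fun x => K x i j) (B x i j) x := fun x i j =>
    hasDerivAt_integral_of_continuous (cB i j) x
  have cK : ∀ i j, Continuous fun x => K x i j := fun i j =>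
    continuous_iff_continuousAt.2 fun x => (hK x i j).continuousAt
  have cBK : ∀ i j, Continuous fun x => (B x * K x) i j := fun i j => by
    simp only [Matrix.mul_apply]
    exact continuous_finsetSum _ fun l _ => (cB i l).mul (cK l j)
  set J : ℝ → Matrix (Fin 3) (Fin 3) ℝ :=
    fun x => Matrix.of fun i j => ∫ t in (0 : ℝ)..x, (B t * K t) i j with hJdef
  have hJ : ∀ x i j, HasDerivAt (fun x => J x i j) ((B x * K x) i j) x :=
    fun x i j => hasDerivAt_integral_of_continuous (cBK i j) x
  have hK0 : K 0 = 0 := by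
    ext i j
    simp [hKdef]
  have hJ0 : J 0 = 0 := by
    ext i j
    simp [hJdef]
  have key := trace_second_order hu he ha hk hK hK0 hJ hJ0
  obtain ⟨C, hC⟩ := exists_picard_remainder_le (B := fun x => c (B x)) (K := fun x => c (K x))
    (J := fun x => c (J x)) (Z := fun μ x => c (V x) * Φ μ x * c (W 0)) (T := T)
    (continuous_matrix fun i j => Complex.continuous_ofReal.comp (cB i j))
    (fun x => hasDerivAt_mapMatrix_ofReal (hK x)) (by simp [hK0])
    (fun x => by
      rw [← map_mul]
      exact hasDerivAt_mapMatrix_ofReal (hJ x)) (by simp [hJ0])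
    (fun μ x => by
      have h1 := hasDerivAt_mapMatrix_ofReal (hasDerivAt_variationCoframe hu he ha x)
      have h2 := hasDerivAt_matrix_of_entries (hΦ μ x)
      refine ((h1.mul h2).mul_const (c (W 0))).congr_deriv ?_
      have h3 : (!![0, 1, 0; 0, 0, 1; -μ - (h x : ℂ), (g x : ℂ), 0] : Matrix (Fin 3) (Fin 3) ℂ) =
          c !![0, 1, 0; 0, 0, 1; -h x, g x, 0] + μ • c !![0, 0, 0; 0, 0, 0; -1, 0, 0] := by
        ext i j
        fin_cases i <;> fin_cases j <;> simp [hc, sub_eq_neg_add]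
      have h4 := congrArg c (variationCoframe_mul_perturbation he ha x)
      rw [map_mul, map_mul] at h4
      rw [h3, map_neg, map_mul]
      change (-(c (V x) * _) * Φ μ x + c (V x) * _) * c (W 0) = _
      have h5 : c (B x) * (c (V x) * Φ μ x * c (W 0)) =
          c (V x) * (c !![0, 0, 0; 0, 0, 0; -1, 0, 0] * (Φ μ x * c (W 0))) := by
        rw [← Matrix.mul_assoc, ← Matrix.mul_assoc, ← Matrix.mul_assoc, ← Matrix.mul_assoc, ← h4]
      rw [h5]
      simp only [Matrix.mul_add, Matrix.add_mul, Matrix.mul_smul, Matrix.smul_mul, Matrix.neg_mul,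
        Matrix.mul_assoc]
      exact neg_add_cancel_left _ _)
    (fun μ => by rw [hΦ0, Matrix.mul_one, ← map_mul, hVW, map_one]) hT
  set N : Matrix (Fin 3) (Fin 3) ℝ := !![1, -TE, -Ta; 0, 1, 0; 0, 0, 1] with hN
  have hNVW : V 0 * W T = N := variationCoframe_zero_mul_variationFrame hu he ha
  set ℓ : Matrix (Fin 3) (Fin 3) ℂ →ₗ[ℂ] ℂ :=
    (Matrix.traceLinearMap (Fin 3) ℂ ℂ).comp (LinearMap.mulLeft ℂ (c N))
  have hℓ : ∀ X, ℓ X = (c N * X).trace := fun X => rfl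
  obtain ⟨r, hr0, hr⟩ := exists_norm_le_of_linearMap ℓ
  have htr : ∀ μ, (Φ μ T).trace = ℓ (c (V T) * Φ μ T * c (W 0)) := fun μ => by
    have h1 : c (W T) * c (V T) = 1 := by rw [← map_mul, hWV, map_one]
    have h2 : c (W 0) * c (V 0) = 1 := by rw [← map_mul, hWV, map_one]
    rw [hℓ, ← hNVW, map_mul, Matrix.trace_mul_comm, Matrix.mul_assoc, ← Matrix.mul_assoc (c (W 0)),
      h2, Matrix.one_mul, Matrix.trace_mul_comm, ← Matrix.mul_assoc, h1, Matrix.one_mul]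
  have hfin := iteratedDeriv_two_of_cubic_remainder hana (α := ℓ 1) (β := ℓ (c (K T)))
    (γ := ℓ (c (J T))) (r := r * C) (fun μ hμ => by
      have h1 := (hr _).trans (mul_le_mul_of_nonneg_left (hC μ hμ) hr0)
      rw [map_sub, map_add, map_add, map_smul, map_smul, ← htr] at h1
      rw [mul_assoc]
      exact h1)
  rw [hfin, ← key, hℓ, ← map_mul]
  have : (c (N * J T)).trace = (((N * J T).trace : ℝ) : ℂ) :=
    (AddMonoidHom.map_trace Complex.ofRealHom (N * J T)).symm
  rw [this]
  push_cast
  ring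

end Monodromy

section ParametricIntegrals

open Filter Topology

variable {S : Set ℝ} {G : ℝ × ℝ → ℝ}

lemma prod_univ_mem_nhds (hS : IsOpen S) {s : ℝ} (hs : s ∈ S) (x : ℝ) :
    S ×ˢ (univ : Set ℝ) ∈ 𝓝 (s, x) :=
  (hS.prod isOpen_univ).mem_nhds ⟨hs, mem_univ x⟩

lemma ContDiffOn.hasFDerivAt_strip (hS : IsOpen S) (hG : ContDiffOn ℝ 1 G (S ×ˢ univ)) {s : ℝ}
    (hs : s ∈ S) (x : ℝ) : HasFDerivAt G (fderiv ℝ G (s, x)) (s, x) :=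
  ((hG.contDiffAt (prod_univ_mem_nhds hS hs x)).differentiableAt (by norm_num)).hasFDerivAt

lemma ContDiffOn.hasDerivAt_fst (hS : IsOpen S) (hG : ContDiffOn ℝ 1 G (S ×ˢ univ)) {s : ℝ}
    (hs : s ∈ S) (x : ℝ) : HasDerivAt (fun r => G (r, x)) (fderiv ℝ G (s, x) (1, 0)) s :=
  (hG.hasFDerivAt_strip hS hs x).comp_hasDerivAt s
    ((hasDerivAt_id s).prodMk (hasDerivAt_const s x))

lemma ContDiffOn.hasDerivAt_snd (hS : IsOpen S) (hG : ContDiffOn ℝ 1 G (S ×ˢ univ)) {s : ℝ}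
    (hs : s ∈ S) (x : ℝ) : HasDerivAt (fun r => G (s, r)) (fderiv ℝ G (s, x) (0, 1)) x :=
  (hG.hasFDerivAt_strip hS hs x).comp_hasDerivAt x
    ((hasDerivAt_const x s).prodMk (hasDerivAt_id x))

lemma ContDiffOn.continuousOn_partial (hS : IsOpen S) (hG : ContDiffOn ℝ 1 G (S ×ˢ univ)) :
    ContinuousOn (fun q => fderiv ℝ G q (1, 0)) (S ×ˢ univ) :=
  (hG.continuousOn_fderiv_of_isOpen (hS.prod isOpen_univ) le_rfl).clm_apply continuousOn_const

lemma ContDiffOn.continuous_slice (hG : ContDiffOn ℝ 1 G (S ×ˢ univ)) {s : ℝ} (hs : s ∈ S) :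
    Continuous fun t => G (s, t) :=
  hG.continuousOn.comp_continuous (by fun_prop) fun t => ⟨hs, mem_univ t⟩

lemma ContDiffOn.continuous_partial_slice (hS : IsOpen S) (hG : ContDiffOn ℝ 1 G (S ×ˢ univ))
    {s : ℝ} (hs : s ∈ S) : Continuous fun t => fderiv ℝ G (s, t) (1, 0) :=
  (hG.continuousOn_partial hS).comp_continuous (f := fun t : ℝ => (s, t)) (by fun_prop)
    fun t => ⟨hs, mem_univ t⟩

/-- Differentiation under the integral sign for a `C¹` integrand. -/
lemma ContDiffOn.hasDerivAt_integral_param (hS : IsOpen S) (h0 : (0 : ℝ) ∈ S)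
    (hG : ContDiffOn ℝ 1 G (S ×ˢ univ)) (a b : ℝ) :
    HasDerivAt (fun s => ∫ t in a..b, G (s, t)) (∫ t in a..b, fderiv ℝ G (0, t) (1, 0)) 0 := by
  obtain ⟨r, hr, hrS⟩ := Metric.nhds_basis_closedBall.mem_iff.1 (hS.mem_nhds h0)
  obtain ⟨C, hC⟩ := ((isCompact_closedBall (0 : ℝ) r).prod
    (isCompact_uIcc (a := a) (b := b))).exists_bound_of_continuousOn
      ((hG.continuousOn_partial hS).mono (prod_mono hrS (subset_univ _)))
  refine (intervalIntegral.hasDerivAt_integral_of_dominated_loc_of_deriv_le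
    (F := fun s t => G (s, t)) (F' := fun s t => fderiv ℝ G (s, t) (1, 0)) (bound := fun _ => C)
    (Metric.closedBall_mem_nhds 0 hr) ?_ ((hG.continuous_slice h0).intervalIntegrable _ _)
    (hG.continuous_partial_slice hS h0).aestronglyMeasurable ?_ (by simp) ?_).2
  · filter_upwards [hS.mem_nhds h0] with s hs
    exact (hG.continuous_slice hs).aestronglyMeasurable
  · exact Eventually.of_forall fun t ht s hs => hC (s, t) ⟨hs, uIoc_subset_uIcc ht⟩
  · exact Eventually.of_forall fun t _ s hs => hG.hasDerivAt_fst hS (hrS hs) t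

/-- The parameter derivative of a solution of `Y' = G` solves the differentiated equation. -/
lemma hasDerivAt_partial_of_hasDerivAt {Y : ℝ × ℝ → ℝ} (hS : IsOpen S) (h0 : (0 : ℝ) ∈ S)
    (hY : ContDiffOn ℝ 1 Y (S ×ˢ univ)) (hG : ContDiffOn ℝ 1 G (S ×ˢ univ))
    (hYG : ∀ s ∈ S, ∀ x, HasDerivAt (fun x => Y (s, x)) (G (s, x)) x) (x : ℝ) :
    HasDerivAt (fun x => fderiv ℝ Y (0, x) (1, 0)) (fderiv ℝ G (0, x) (1, 0)) x := by
  have key : ∀ x, fderiv ℝ Y (0, x) (1, 0) =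
      (∫ t in (0 : ℝ)..x, fderiv ℝ G (0, t) (1, 0)) + fderiv ℝ Y (0, 0) (1, 0) := fun x => by
    have h1 := (hY.hasDerivAt_fst hS h0 x).sub (hY.hasDerivAt_fst hS h0 0)
    have h2 := (hG.hasDerivAt_integral_param hS h0 0 x).unique (h1.congr_of_eventuallyEq (by
      filter_upwards [hS.mem_nhds h0] with s hs
      exact intervalIntegral.integral_eq_sub_of_hasDerivAt (fun t _ => hYG s hs t)
        ((hG.continuous_slice hs).intervalIntegrable _ _)))
    rw [h2, sub_add_cancel]
  rw [funext key]
  exact (hasDerivAt_integral_of_continuous (hG.continuous_partial_slice hS h0) x).add_const _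

/-- Leibniz rule for an integral over one period, the period depending on the parameter. -/
lemma ContDiffOn.hasDerivAt_integral_period (hS : IsOpen S) (h0 : (0 : ℝ) ∈ S)
    (hG : ContDiffOn ℝ 1 G (S ×ˢ univ)) {τ : ℝ → ℝ} (hτ : ContDiffOn ℝ 1 τ S) :
    HasDerivAt (fun s => ∫ t in (0 : ℝ)..τ s, G (s, t))
      ((∫ t in (0 : ℝ)..τ 0, fderiv ℝ G (0, t) (1, 0)) + deriv τ 0 * G (0, τ 0)) 0 := by
  have hτ' : HasDerivAt τ (deriv τ 0) 0 :=
    ((hτ.contDiffAt (hS.mem_nhds h0)).differentiableAt (by norm_num)).hasDerivAt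
  have hτ1 : ContDiffOn ℝ 1 (fun q : ℝ × ℝ => τ q.1) (S ×ˢ univ) :=
    hτ.comp contDiffOn_fst fun q hq => hq.1
  set N : ℝ × ℝ → ℝ := fun q => τ q.1 * G (q.1, τ q.1 * q.2) with hN
  have hNc : ContDiffOn ℝ 1 N (S ×ˢ univ) :=
    hτ1.mul (hG.comp (contDiffOn_fst.prodMk (hτ1.mul contDiffOn_snd))
      fun q hq => ⟨hq.1, mem_univ _⟩)
  have hNd : ∀ θ, fderiv ℝ N (0, θ) (1, 0) = deriv τ 0 * G (0, τ 0 * θ) +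
      τ 0 * (fderiv ℝ G (0, τ 0 * θ) (1, 0) + deriv τ 0 * θ * fderiv ℝ G (0, τ 0 * θ) (0, 1)) :=
    fun θ => by
      have h1 := (hG.hasFDerivAt_strip hS h0 (τ 0 * θ)).comp_hasDerivAt (0 : ℝ)
        ((hasDerivAt_id (0 : ℝ)).prodMk (hτ'.mul_const θ))
      have h2 := (hNc.hasDerivAt_fst hS h0 θ).unique (hτ'.mul h1)
      rw [h2]
      have h3 : ((1 : ℝ), deriv τ 0 * θ) = (1, 0) + (deriv τ 0 * θ) • ((0 : ℝ), (1 : ℝ)) := by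
        simp
      rw [h3, map_add, map_smul, smul_eq_mul]
  have hprim : ∀ θ, HasDerivAt
      (fun θ => deriv τ 0 * (θ * G (0, τ 0 * θ)) +
        ∫ t in (0 : ℝ)..τ 0 * θ, fderiv ℝ G (0, t) (1, 0)) (fderiv ℝ N (0, θ) (1, 0)) θ :=
    fun θ => by
      have hl : HasDerivAt (fun θ => τ 0 * θ) (τ 0) θ := by
        simpa using (hasDerivAt_id θ).const_mul (τ 0)
      have h1 := (hG.hasDerivAt_snd hS h0 (τ 0 * θ)).comp θ hl
      have h2 := (hasDerivAt_integral_of_continuous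
        (hG.continuous_partial_slice hS h0) (τ 0 * θ)).comp θ hl
      refine ((((hasDerivAt_id θ).mul h1).const_mul (deriv τ 0)).add h2).congr_deriv ?_
      rw [hNd]
      simp
      ring
  have h := hNc.hasDerivAt_integral_param hS h0 0 1
  rw [intervalIntegral.integral_eq_sub_of_hasDerivAt (fun θ _ => hprim θ)
    ((hNc.continuous_partial_slice hS h0).intervalIntegrable _ _)] at h
  have hfun : (fun s => ∫ θ in (0 : ℝ)..1, N (s, θ)) = fun s => ∫ t in (0 : ℝ)..τ s, G (s, t) := by
    funext s
    have := intervalIntegral.mul_integral_comp_mul_left (a := 0) (b := 1)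
      (f := fun t => G (s, t)) (τ s)
    simpa [hN] using this
  rw [hfun] at h
  refine h.congr_deriv ?_
  simp
  ring

end ParametricIntegrals

/-- A `C²` one-parameter family of periodic profiles yields a variation. -/
lemma exists_isVariation {f F : ℝ → ℝ} (hf : ContDiff ℝ 2 f) (hF : ∀ x, HasDerivAt F (f x) x)
    {S : Set ℝ} (hS : IsOpen S) (h0 : (0 : ℝ) ∈ S) {U : ℝ → ℝ → ℝ}
    (hU : ContDiffOn ℝ 2 (fun q : ℝ × ℝ => U q.1 q.2) (S ×ˢ univ)) {a₀ E₀ c₀ va vE vc : ℝ}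
    (hODE : ∀ s ∈ S, ∀ x, deriv (deriv (U s)) x + f (U s x) - (c₀ + s * vc) * U s x = a₀ + s * va)
    (hEn : ∀ s ∈ S, ∀ x, 1 / 2 * (deriv (U s) x) ^ 2 + F (U s x) - (c₀ + s * vc) / 2 * (U s x) ^ 2
      - (a₀ + s * va) * U s x = E₀ + s * vE)
    (hturn : ∀ s ∈ S, deriv (U s) 0 = 0) {τ : ℝ → ℝ} (hτ : ContDiffOn ℝ 1 τ S)
    (hper : ∀ s ∈ S, ∀ x, U s (x + τ s) = U s x) {dT dM dP : ℝ} (hdT : HasDerivAt τ dT 0)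
    (hM : HasDerivAt (fun s => ∫ x in (0 : ℝ)..τ s, U s x) dM 0)
    (hP : HasDerivAt (fun s => ∫ x in (0 : ℝ)..τ s, (U s x) ^ 2) dP 0) :
    ∃ e e₁, IsVariation (U 0) (deriv (U 0)) (fun x => a₀ + c₀ * U 0 x - f (U 0 x))
      (fun x => c₀ - deriv f (U 0 x)) (τ 0) va vE vc dT dM dP e e₁ := by
  set G : ℝ × ℝ → ℝ := fun q => U q.1 q.2 with hGdef
  have hG : ContDiffOn ℝ 1 G (S ×ˢ univ) := hU.of_le (by norm_num)
  set Y : ℝ × ℝ → ℝ := fun q => deriv (U q.1) q.2 with hYdef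
  have hYeq : ∀ s ∈ S, ∀ x, Y (s, x) = fderiv ℝ G (s, x) (0, 1) := fun s hs x =>
    (hG.hasDerivAt_snd hS hs x).deriv
  have hY : ContDiffOn ℝ 1 Y (S ×ˢ univ) := by
    refine ContDiffOn.congr (f := fun q => fderiv ℝ G q (0, 1)) ?_
      fun q hq => hYeq q.1 hq.1 q.2
    exact (hU.fderiv_of_isOpen (hS.prod isOpen_univ) (by norm_num)).clm_apply contDiffOn_const
  set A : ℝ × ℝ → ℝ := fun q => (a₀ + q.1 * va) + (c₀ + q.1 * vc) * G q - f (G q) with hAdef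
  have hA : ContDiffOn ℝ 1 A (S ×ˢ univ) := by
    have h1 : ContDiffOn ℝ 1 (fun q => f (G q)) (S ×ˢ univ) :=
      (hf.of_le (by norm_num)).comp_contDiffOn hG
    have h2 : ContDiffOn ℝ 1 (fun q : ℝ × ℝ => q.1) (S ×ˢ univ) := contDiffOn_fst
    exact ((contDiffOn_const.add (h2.mul contDiffOn_const)).add
      ((contDiffOn_const.add (h2.mul contDiffOn_const)).mul hG)).sub h1
  have hGY : ∀ s ∈ S, ∀ x, HasDerivAt (fun x => G (s, x)) (Y (s, x)) x := fun s hs x => by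
    rw [hYeq s hs x]
    exact hG.hasDerivAt_snd hS hs x
  have hYA : ∀ s ∈ S, ∀ x, HasDerivAt (fun x => Y (s, x)) (A (s, x)) x := fun s hs x => by
    have h1 := (hY.hasDerivAt_snd hS hs x).differentiableAt.hasDerivAt
    refine h1.congr_deriv ?_
    have := hODE s hs x
    change deriv (deriv (U s)) x = a₀ + s * va + (c₀ + s * vc) * U s x - f (U s x)
    linarith
  set e : ℝ → ℝ := fun x => fderiv ℝ G (0, x) (1, 0) with he
  set e₁ : ℝ → ℝ := fun x => fderiv ℝ Y (0, x) (1, 0) with he₁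
  have hes : ∀ x, HasDerivAt (fun s => U s x) (e x) 0 := fun x => hG.hasDerivAt_fst hS h0 x
  have he₁s : ∀ x, HasDerivAt (fun s => deriv (U s) x) (e₁ x) 0 := fun x =>
    hY.hasDerivAt_fst hS h0 x
  have hde : ∀ x, HasDerivAt e (e₁ x) x := hasDerivAt_partial_of_hasDerivAt hS h0 hG hY hGY
  have hfd : ∀ x, HasDerivAt f (deriv f x) x := fun x =>
    (hf.differentiable (by norm_num) x).hasDerivAt
  have hlin : ∀ α β : ℝ, HasDerivAt (fun s : ℝ => α + s * β) β 0 := fun α β => by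
    simpa using ((hasDerivAt_id (0 : ℝ)).mul_const β).const_add α
  have hA' : ∀ x, fderiv ℝ A (0, x) (1, 0) =
      va + vc * U 0 x + (c₀ - deriv f (U 0 x)) * e x := fun x => by
    have h1 := ((hlin a₀ va).add ((hlin c₀ vc).mul (hes x))).sub ((hfd (U 0 x)).comp 0 (hes x))
    rw [(hA.hasDerivAt_fst hS h0 x).unique h1]
    ring
  have hper' : ∀ x, e (x + τ 0) + dT * Y (0, x + τ 0) = e x := fun x => by
    have h1 := (hG.hasFDerivAt_strip hS h0 (x + τ 0)).comp_hasDerivAt (0 : ℝ)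
      ((hasDerivAt_id (0 : ℝ)).prodMk (hdT.const_add x))
    have h2 := (hes x).unique (h1.congr_of_eventuallyEq (by
      filter_upwards [hS.mem_nhds h0] with s hs
      exact (hper s hs x).symm))
    have h3 : ((1 : ℝ), dT) = (1, 0) + dT • ((0 : ℝ), (1 : ℝ)) := by simp
    rw [h2, h3, map_add, map_smul, smul_eq_mul, hYeq 0 h0]
  have hYper : ∀ x, Y (0, x + τ 0) = Y (0, x) := fun x => by
    have h1 := (hGY 0 h0 (x + τ 0)).comp_add_const x (τ 0)
    exact h1.unique ((hGY 0 h0 x).congr_of_eventuallyEq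
      (Filter.Eventually.of_forall fun z => hper 0 h0 z))
  have hY0 : Y (0, 0) = 0 := hturn 0 h0
  have hU0 : U 0 (τ 0) = U 0 0 := by simpa using hper 0 h0 0
  refine ⟨e, e₁, hde, fun x => ?_, fun x => ?_, ?_, ?_, ?_, ?_, ?_⟩
  · rw [← hA']
    exact hasDerivAt_partial_of_hasDerivAt hS h0 hY hA hYA x
  · have h1 := (((((he₁s x).pow 2).const_mul (1 / 2)).add ((hF (U 0 x)).comp 0 (hes x))).sub
      (((hlin c₀ vc).div_const 2).mul ((hes x).pow 2))).sub ((hlin a₀ va).mul (hes x))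
    have h2 := (hlin E₀ vE).unique (h1.congr_of_eventuallyEq (by
      filter_upwards [hS.mem_nhds h0] with s hs
      exact (hEn s hs x).symm))
    simp at h2
    linear_combination -h2
  · exact (he₁s 0).unique ((hasDerivAt_const (0 : ℝ) (0 : ℝ)).congr_of_eventuallyEq (by
      filter_upwards [hS.mem_nhds h0] with s hs
      exact hturn s hs))
  · have h1 := hper' 0
    rw [hYper, hY0] at h1
    simpa using h1
  · have h1 := ((hde (0 + τ 0)).comp_add_const 0 (τ 0)).add
      (((hYA 0 h0 (0 + τ 0)).comp_add_const 0 (τ 0)).const_mul dT)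
    have h2 := (hde 0).unique (h1.congr_of_eventuallyEq
      (Filter.Eventually.of_forall fun z => (hper' z).symm))
    have h3 : e₁ 0 = 0 := (he₁s 0).unique
      ((hasDerivAt_const (0 : ℝ) (0 : ℝ)).congr_of_eventuallyEq (by
        filter_upwards [hS.mem_nhds h0] with s hs
        exact hturn s hs))
    rw [h3, zero_add] at h2
    simp only [hAdef, hGdef, hU0, zero_mul, add_zero] at h2
    linarith
  · have h1 := hM.unique (hG.hasDerivAt_integral_period hS h0 hτ)
    rw [h1, hdT.deriv, ← hU0]
    simp [hGdef, he]
  · have hG2 : ContDiffOn ℝ 1 (fun q => G q ^ 2) (S ×ˢ univ) := hG.pow 2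
    have h1 := hP.unique (hG2.hasDerivAt_integral_period hS h0 hτ)
    have h2 : ∀ x, fderiv ℝ (fun q => G q ^ 2) (0, x) (1, 0) = 2 * (U 0 x * e x) := fun x => by
      rw [(hG2.hasDerivAt_fst hS h0 x).unique ((hes x).pow 2)]
      simp
      ring
    simp only [h2, intervalIntegral.integral_const_mul, hdT.deriv] at h1
    rw [h1, ← hU0]
    simp [hGdef]

section Family

variable {f F : ℝ → ℝ} {D : Set (ℝ × ℝ × ℝ)} {u : ℝ × ℝ × ℝ → ℝ → ℝ} {T M P : ℝ × ℝ × ℝ → ℝ}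
  {p : ℝ × ℝ × ℝ}

lemma ContDiffOn.hasFDerivAt_of_isOpen {Q : ℝ × ℝ × ℝ → ℝ} (hD : IsOpen D)
    (hQ : ContDiffOn ℝ 1 Q D) (hp : p ∈ D) : HasFDerivAt Q (fderiv ℝ Q p) p :=
  ((hQ.contDiffAt (hD.mem_nhds hp)).differentiableAt (by norm_num)).hasFDerivAt

/-- The directional derivative of the family of waves in the parameters is a variation. -/
lemma exists_isVariation_direction (hf : ContDiff ℝ 2 f) (hF : ∀ x, HasDerivAt F (f x) x)
    (hD : IsOpen D)
    (hu : ContDiffOn ℝ 2 (fun q : (ℝ × ℝ × ℝ) × ℝ => u q.1 q.2) (D ×ˢ univ))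
    (hODE : ∀ p ∈ D, ∀ x, deriv (deriv (u p)) x + f (u p x) - p.2.2 * u p x = p.1)
    (hEn : ∀ p ∈ D, ∀ x, 1 / 2 * (deriv (u p) x) ^ 2 + F (u p x) - p.2.2 / 2 * (u p x) ^ 2
      - p.1 * u p x = p.2.1)
    (hturn : ∀ p ∈ D, deriv (u p) 0 = 0)
    (hper : ∀ p ∈ D, ∀ x, u p (x + T p) = u p x)
    (hM : ∀ p ∈ D, M p = ∫ x in (0 : ℝ)..T p, u p x)
    (hP : ∀ p ∈ D, P p = ∫ x in (0 : ℝ)..T p, (u p x) ^ 2)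
    (hTc : ContDiffOn ℝ 1 T D) (hMc : ContDiffOn ℝ 1 M D) (hPc : ContDiffOn ℝ 1 P D)
    (hp : p ∈ D) (v : ℝ × ℝ × ℝ) :
    ∃ e e₁, IsVariation (u p) (deriv (u p)) (fun x => p.1 + p.2.2 * u p x - f (u p x))
      (fun x => p.2.2 - deriv f (u p x)) (T p) v.1 v.2.1 v.2.2
      (fderiv ℝ T p v) (fderiv ℝ M p v) (fderiv ℝ P p v) e e₁ := by
  set γ : ℝ → ℝ × ℝ × ℝ := fun s => p + s • v with hγ
  have hγc : ContDiff ℝ 2 γ := by fun_prop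
  have hγ0 : γ 0 = p := by simp [hγ]
  have hγd : HasDerivAt γ v 0 :=
    (((hasDerivAt_id (0 : ℝ)).smul_const v).const_add p).congr_deriv (one_smul ℝ v)
  have hS : IsOpen (γ ⁻¹' D) := hD.preimage hγc.continuous
  have h0 : (0 : ℝ) ∈ γ ⁻¹' D := by rwa [mem_preimage, hγ0]
  have hdir : ∀ {Q : ℝ × ℝ × ℝ → ℝ}, ContDiffOn ℝ 1 Q D →
      HasDerivAt (fun s => Q (γ s)) (fderiv ℝ Q p v) 0 := fun hQ =>
    HasFDerivAt.comp_hasDerivAt 0 (by rw [hγ0]; exact hQ.hasFDerivAt_of_isOpen hD hp) hγd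
  have hU : ContDiffOn ℝ 2 (fun q : ℝ × ℝ => u (γ q.1) q.2) ((γ ⁻¹' D) ×ˢ univ) :=
    hu.comp ((hγc.comp contDiff_fst).prodMk contDiff_snd).contDiffOn
      fun q hq => ⟨hq.1, mem_univ _⟩
  have h := exists_isVariation hf hF hS h0 (U := fun s => u (γ s)) hU (a₀ := p.1) (E₀ := p.2.1)
    (c₀ := p.2.2) (va := v.1) (vE := v.2.1) (vc := v.2.2)
    (fun s hs => hODE (γ s) hs) (fun s hs => hEn (γ s) hs) (fun s hs => hturn (γ s) hs)
    (τ := fun s => T (γ s)) (hTc.comp (hγc.of_le (by norm_num)).contDiffOn fun s hs => hs)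
    (fun s hs => hper (γ s) hs) (hdir hTc)
    ((hdir hMc).congr_of_eventuallyEq (by
      filter_upwards [hS.mem_nhds h0] with s hs using (hM (γ s) hs).symm))
    ((hdir hPc).congr_of_eventuallyEq (by
      filter_upwards [hS.mem_nhds h0] with s hs using (hP (γ s) hs).symm))
  simpa only [hγ0] using h

/-- The traveling waves of the family are periodic profiles. -/
lemma isPeriodicProfile_of_family (hf : ContDiff ℝ 2 f) {w : ℝ → ℝ} (hw : ContDiff ℝ 2 w)
    {a c τ : ℝ} (hODE : ∀ x, deriv (deriv w) x + f (w x) - c * w x = a)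
    (hturn : deriv w 0 = 0 ∧ f (w 0) - c * w 0 - a < 0) (hper : ∀ x, w (x + τ) = w x) :
    IsPeriodicProfile w (deriv w) (fun x => a + c * w x - f (w x))
      (fun x => c - deriv f (w x)) (fun x => deriv (deriv f) (w x) * deriv w x) τ := by
  have hdw : ∀ x, HasDerivAt w (deriv w x) x := fun x =>
    (hw.differentiable (by norm_num) x).hasDerivAt
  have hw' : ContDiff ℝ 1 (deriv w) := (contDiff_succ_iff_deriv.1 hw).2.2
  have hf' : ContDiff ℝ 1 (deriv f) := (contDiff_succ_iff_deriv.1 hf).2.2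
  have hτ : w τ = w 0 := by simpa using hper 0
  have hyτ : deriv w (0 + τ) = deriv w 0 := by
    rw [← deriv_comp_add_const, funext hper]
  refine ⟨hdw, fun x => ?_, fun x => ?_, fun x => ?_, hturn.1, ?_, hτ, ?_, ?_, ?_⟩
  · refine (hw'.differentiable (by norm_num) x).hasDerivAt.congr_deriv ?_
    linear_combination hODE x
  · refine ((((hdw x).const_mul c).const_add a).sub
      ((hf.differentiable (by norm_num) (w x)).hasDerivAt.comp x (hdw x))).congr_deriv ?_
    ring
  · exact ((hf'.differentiable (by norm_num) (w x)).hasDerivAt.comp x (hdw x)).const_sub c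
  · linarith [hturn.2]
  · rw [← hturn.1, ← hyτ, zero_add]
  · rw [hτ]
  · rw [hτ]

lemma deriv_partial_fst {Q : ℝ × ℝ × ℝ → ℝ} (hQ : HasFDerivAt Q (fderiv ℝ Q p) p) :
    deriv (fun a => Q (a, p.2.1, p.2.2)) p.1 = fderiv ℝ Q p (1, 0, 0) :=
  (hQ.comp_hasDerivAt p.1 ((hasDerivAt_id p.1).prodMk
    ((hasDerivAt_const p.1 p.2.1).prodMk (hasDerivAt_const p.1 p.2.2)))).deriv

lemma deriv_partial_snd {Q : ℝ × ℝ × ℝ → ℝ} (hQ : HasFDerivAt Q (fderiv ℝ Q p) p) :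
    deriv (fun E => Q (p.1, E, p.2.2)) p.2.1 = fderiv ℝ Q p (0, 1, 0) :=
  (hQ.comp_hasDerivAt p.2.1 ((hasDerivAt_const p.2.1 p.1).prodMk
    ((hasDerivAt_id p.2.1).prodMk (hasDerivAt_const p.2.1 p.2.2)))).deriv

lemma deriv_partial_thd {Q : ℝ × ℝ × ℝ → ℝ} (hQ : HasFDerivAt Q (fderiv ℝ Q p) p) :
    deriv (fun c => Q (p.1, p.2.1, c)) p.2.2 = fderiv ℝ Q p (0, 0, 1) :=
  (hQ.comp_hasDerivAt p.2.2 ((hasDerivAt_const p.2.2 p.1).prodMk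
    ((hasDerivAt_const p.2.2 p.2.1).prodMk (hasDerivAt_id p.2.2)))).deriv

end Family

/-- The trace `a(μ) = tr Φ(T; μ)` of the monodromy of the linearized gKdV spectral
problem about a periodic traveling wave `u(·; a, E, c)` is twice differentiable at
`μ = 0` with `a″(0) = {T, P}_{E,c} + 2 {M, P}_{a,E}`, i.e.
`a″(0) = (∂_E T ∂_c P - ∂_c T ∂_E P) + 2 (∂_a M ∂_E P - ∂_E M ∂_a P)`.
Parameters: `p = (a, E, c)` with `a = p.1`, `E = p.2.1`, `c = p.2.2`. -/
theorem stmt_18 (f F : ℝ → ℝ) (hf : ContDiff ℝ 2 f)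
    (hF : ∀ x : ℝ, HasDerivAt F (f x) x)
    (D : Set (ℝ × ℝ × ℝ)) (hD : IsOpen D)
    (u : ℝ × ℝ × ℝ → ℝ → ℝ)
    (hu : ContDiffOn ℝ 2 (fun q : (ℝ × ℝ × ℝ) × ℝ => u q.1 q.2)
      (D ×ˢ (univ : Set ℝ)))
    (hODE : ∀ p ∈ D, ∀ x : ℝ,
      deriv (deriv (u p)) x + f (u p x) - p.2.2 * u p x = p.1)
    (hEn : ∀ p ∈ D, ∀ x : ℝ,
      1 / 2 * (deriv (u p) x) ^ 2 + F (u p x) - p.2.2 / 2 * (u p x) ^ 2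
        - p.1 * u p x = p.2.1)
    (hturn : ∀ p ∈ D,
      deriv (u p) 0 = 0 ∧ f (u p 0) - p.2.2 * u p 0 - p.1 < 0)
    (T M P : ℝ × ℝ × ℝ → ℝ)
    (hTpos : ∀ p ∈ D, 0 < T p)
    (hper : ∀ p ∈ D, ∀ x : ℝ, u p (x + T p) = u p x)
    (hM : ∀ p ∈ D, M p = ∫ x in (0 : ℝ)..T p, u p x)
    (hP : ∀ p ∈ D, P p = ∫ x in (0 : ℝ)..T p, (u p x) ^ 2)
    (hTc : ContDiffOn ℝ 1 T D) (hMc : ContDiffOn ℝ 1 M D)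
    (hPc : ContDiffOn ℝ 1 P D)
    (Φ : ℝ × ℝ × ℝ → ℂ → ℝ → Matrix (Fin 3) (Fin 3) ℂ)
    (hΦ0 : ∀ p ∈ D, ∀ μ : ℂ, Φ p μ 0 = 1)
    (hΦ : ∀ p ∈ D, ∀ (μ : ℂ) (x : ℝ) (i j : Fin 3),
      HasDerivAt (fun y => Φ p μ y i j)
        ((!![0, 1, 0;
             0, 0, 1;
             -μ - ((deriv (deriv f) (u p x) * deriv (u p) x : ℝ) : ℂ),
               ((p.2.2 - deriv f (u p x) : ℝ) : ℂ), 0] * Φ p μ x) i j) x)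
    (hana : ∀ p ∈ D, ∀ (x : ℝ) (i j : Fin 3),
      AnalyticAt ℂ (fun μ => Φ p μ x i j) 0) :
    ∀ p ∈ D,
      DifferentiableAt ℂ (fun μ => (Φ p μ (T p)).trace) 0 ∧
      DifferentiableAt ℂ (deriv fun μ => (Φ p μ (T p)).trace) 0 ∧
      iteratedDeriv 2 (fun μ => (Φ p μ (T p)).trace) 0 =
        (((deriv (fun E => T (p.1, E, p.2.2)) p.2.1
              * deriv (fun c => P (p.1, p.2.1, c)) p.2.2
            - deriv (fun c => T (p.1, p.2.1, c)) p.2.2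
              * deriv (fun E => P (p.1, E, p.2.2)) p.2.1)
          + 2 * (deriv (fun a => M (a, p.2.1, p.2.2)) p.1
              * deriv (fun E => P (p.1, E, p.2.2)) p.2.1
            - deriv (fun E => M (p.1, E, p.2.2)) p.2.1
              * deriv (fun a => P (a, p.2.1, p.2.2)) p.1) : ℝ) : ℂ) := by
  intro p hp
  have hslice : ContDiff ℝ 2 (u p) := contDiffOn_univ.1
    (hu.comp (contDiff_const.prodMk contDiff_id).contDiffOn fun x _ => ⟨hp, mem_univ x⟩)
  have hprof := isPeriodicProfile_of_family hf hslice (hODE p hp) (hturn p hp) (hper p hp)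
  have hvar := exists_isVariation_direction hf hF hD hu hODE hEn (fun q hq => (hturn q hq).1)
    hper hM hP hTc hMc hPc hp
  obtain ⟨a, a₁, ha⟩ := hvar (1, 0, 0)
  obtain ⟨e, e₁, he⟩ := hvar (0, 1, 0)
  obtain ⟨k, k₁, hk⟩ := hvar (0, 0, 1)
  have htr : AnalyticAt ℂ (fun μ => (Φ p μ (T p)).trace) 0 := by
    simp only [Matrix.trace, Matrix.diag]
    exact Finset.analyticAt_fun_sum _ fun i _ => hana p hp (T p) i i
  have hT := hTc.hasFDerivAt_of_isOpen hD hp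
  have hM' := hMc.hasFDerivAt_of_isOpen hD hp
  have hP' := hPc.hasFDerivAt_of_isOpen hD hp
  refine ⟨htr.differentiableAt, htr.deriv.differentiableAt, ?_⟩
  rw [deriv_partial_snd hT, deriv_partial_snd hM', deriv_partial_snd hP', deriv_partial_thd hT,
    deriv_partial_thd hP', deriv_partial_fst hM', deriv_partial_fst hP']
  exact iteratedDeriv_two_trace_monodromy (hTpos p hp).le hprof he ha hk (hΦ0 p hp) (hΦ p hp) htr
end
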